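/- Let q(x,y) = A·x² + B·x·y + C·y² be a primitive, Minkowski reduced (|B| ≤ A ≤ C), positive definite integral binary quadratic form with discriminant D = A·C − B²/4, let Q be a positive definite integral quadratic form in 4 variables, and let p be an odd prime with v_p(D) = 0. For every ε > 0 there is a constant κ, depending only on Q, p and ε, such that: (i) for every n ∈ ℕ with p^{4n} < √D and every δ ∈ (0,1/4), #𝒳(Q,2n) ≤ κ·( D^{δ+ε}·#𝒮(n) + D^{3/2−δ+ε}·p^{−8n} + D^{7/8+ε}·p^{−5n} + D^{1/2+ε} ); and (ii) if moreover −4D is a fundamental discriminant (i.e. equals the discriminant of the quadratic field ℚ(√−D)), then for every n ∈ ℕ, #𝒳(Q,2n) ≤ κ·D^ε·#𝒮(n). -/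

import Mathlib

open Matrix

noncomputable section

/-- Congruence of rationals modulo `p^k`: `v_p(a − b) ≥ k` (with `v_p(0) = ∞`). -/
def PCong (p k : ℕ) (a b : ℚ) : Prop :=
  a = b ∨ (k : ℤ) ≤ padicValRat p (a - b)

/-- `M` is the Gram matrix of a positive definite integral quadratic form in `n` variables. -/
def IsIntegralPosDefForm {n : ℕ} (M : Matrix (Fin n) (Fin n) ℚ) : Prop :=
  M.IsSymm ∧ (∀ i, ∃ z : ℤ, M i i = z) ∧ (∀ i j, ∃ z : ℤ, 2 * M i j = z) ∧
    ∀ v : Fin n → ℚ, v ≠ 0 → 0 < v ⬝ᵥ M.mulVec v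

/-- Coordinatewise cast of an integer vector to a rational vector. -/
def intCastVec {m : ℕ} (v : Fin m → ℤ) : Fin m → ℚ := fun i => (v i : ℚ)

/-- `ι : ℤ² → ℤ⁴` (a 4×2 integer matrix) is a representation of the binary quadratic form
`A·x² + B·x·y + C·y²` by the quaternary form with Gram matrix `MQ`. -/
def IsRep (MQ : Matrix (Fin 4) (Fin 4) ℚ) (A B C : ℤ) (ι : Matrix (Fin 4) (Fin 2) ℤ) : Prop :=
  (ι.map (Int.cast : ℤ → ℚ))ᵀ * MQ * ι.map (Int.cast : ℤ → ℚ) =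
    !![(A : ℚ), (B : ℚ) / 2; (B : ℚ) / 2, (C : ℚ)]

/-- A representation is primitive if `ι(ℤ²) = (ι(ℤ²) ⊗ ℚ) ∩ ℤ⁴`. -/
def IsPrimitiveRep (MQ : Matrix (Fin 4) (Fin 4) ℚ) (A B C : ℤ)
    (ι : Matrix (Fin 4) (Fin 2) ℤ) : Prop :=
  IsRep MQ A B C ι ∧
    ∀ v : Fin 4 → ℤ,
      intCastVec v ∈ Submodule.span ℚ (Set.range fun j => intCastVec fun i => ι i j) →
        ∃ w : Fin 2 → ℤ, ι.mulVec w = v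

/-- The set `𝒳(Q, m)` of pairs of primitive representations of `q = ⟨A,B,C⟩` by `Q` with
distinct images which agree modulo `p^m` up to a special orthogonal `ℤ_p`-rotation fixing
the orthogonal complement of the first image pointwise. -/
def XSet (MQ : Matrix (Fin 4) (Fin 4) ℚ) (A B C : ℤ) (p : ℕ) [Fact p.Prime] (m : ℕ) :
    Set (Matrix (Fin 4) (Fin 2) ℤ × Matrix (Fin 4) (Fin 2) ℤ) :=
  {P | IsPrimitiveRep MQ A B C P.1 ∧ IsPrimitiveRep MQ A B C P.2 ∧
    {v : Fin 4 → ℤ | ∃ w, P.1.mulVec w = v} ≠ {v : Fin 4 → ℤ | ∃ w, P.2.mulVec w = v} ∧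
    ∃ k : Matrix (Fin 4) (Fin 4) ℤ_[p],
      (k.map (fun z : ℤ_[p] => (z : ℚ_[p])))ᵀ * MQ.map (fun x : ℚ => (x : ℚ_[p])) *
          k.map (fun z : ℤ_[p] => (z : ℚ_[p])) = MQ.map (fun x : ℚ => (x : ℚ_[p])) ∧
      k.det = 1 ∧
      (∀ w : Fin 4 → ℚ_[p],
        (∀ v : Fin 2 → ℤ,
          w ⬝ᵥ (MQ.map (fun x : ℚ => (x : ℚ_[p]))).mulVec
            (fun i => ((P.1.mulVec v) i : ℚ_[p])) = 0) →
        (k.map (fun z : ℤ_[p] => (z : ℚ_[p]))).mulVec w = w) ∧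
      ∀ v : Fin 2 → ℤ, ∀ i,
        (p : ℤ_[p]) ^ m ∣
          (((P.2.mulVec v) i : ℤ_[p]) -
            k.mulVec (fun i' => ((P.1.mulVec v) i' : ℤ_[p])) i)}

/-- Membership conditions for the set `𝒮(n)`. -/
def SMem (MQ : Matrix (Fin 4) (Fin 4) ℚ) (A B C : ℤ) (p n : ℕ)
    (x0 x1 x2 x3 x4 : ℚ) : Prop :=
  -- half-integrality
  (∃ z : ℤ, 2 * x0 = z) ∧ (∃ z : ℤ, 2 * x1 = z) ∧ (∃ z : ℤ, 2 * x2 = z) ∧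
    (∃ z : ℤ, 2 * x3 = z) ∧ (∃ z : ℤ, 2 * x4 = z) ∧
  -- (E) the degree four equation
  MQ.det * x0 ^ 2 =
    (x1 * x4 - x2 * x3 - ((A : ℚ) * C - (B : ℚ) ^ 2 / 4)) ^ 2 -
      ((C : ℚ) * x1 - (A : ℚ) * x4) ^ 2 -
      ((B : ℚ) * x1 - (A : ℚ) * (x2 + x3)) * ((B : ℚ) * x4 - (C : ℚ) * (x2 + x3)) ∧
  -- (S1) archimedean constraints
  |x1| ≤ (A : ℚ) ∧ |x4| ≤ (C : ℚ) ∧ x2 ^ 2 ≤ (A : ℚ) * C ∧ x3 ^ 2 ≤ (A : ℚ) * C ∧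
  -- (S2) congruence constraints mod `p^(4n)`
  PCong p (4 * n) (x1 * x4 - x2 * x3) ((A : ℚ) * C - (B : ℚ) ^ 2 / 4) ∧
  PCong p (4 * n) ((C : ℚ) * x1) ((A : ℚ) * x4) ∧
  PCong p (4 * n) ((C : ℚ) * (x2 + x3)) ((B : ℚ) * x4) ∧
  PCong p (4 * n) ((A : ℚ) * (x2 + x3)) ((B : ℚ) * x1) ∧
  -- (S3) boundary conditions
  ((x1 = (A : ℚ) ∨ x4 = (C : ℚ)) → x0 = 0 ∧ x2 = (B : ℚ) / 2 ∧ x3 = (B : ℚ) / 2) ∧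
  ((x1 = -(A : ℚ) ∨ x4 = -(C : ℚ)) → x0 = 0 ∧ x2 = -((B : ℚ) / 2) ∧ x3 = -((B : ℚ) / 2))

/-- The set `𝒮(n)` of half-integral tuples `(x0, x1, x2, x3, x4)`. -/
def SSetQ (MQ : Matrix (Fin 4) (Fin 4) ℚ) (A B C : ℤ) (p n : ℕ) : Set (Fin 5 → ℚ) :=
  {x | SMem MQ A B C p n (x 0) (x 1) (x 2) (x 3) (x 4)}

/-- `−4·disc(q)` is a fundamental discriminant, for `q = ⟨A,B,C⟩` positive definite:
either `disc(q) ∉ ℤ` (i.e. `B` is odd) and `−4·disc(q) = B² − 4AC` is squarefree, or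
`disc(q) ∈ ℤ` (i.e. `B` is even), `disc(q)` is squarefree and `disc(q) ≡ 1, 2 (mod 4)`. -/
def FundDisc (A B C : ℤ) : Prop :=
  (Odd B ∧ Squarefree (B ^ 2 - 4 * A * C)) ∨
    (Even B ∧ Squarefree ((4 * A * C - B ^ 2) / 4) ∧
      ((4 * A * C - B ^ 2) / 4 % 4 = 1 ∨ (4 * A * C - B ^ 2) / 4 % 4 = 2))

/-- If every element of `F` is related to some key in `K`, and every subset of `F` of elements
related to a common key has at most `M` elements, then `F` has at most `#K * M` elements. -/
theorem card_le_of_cover {α β : Type*} (F : Finset α) (K : Finset β) (r : α → β → Prop) (M : ℕ)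
    (h1 : ∀ x ∈ F, ∃ k ∈ K, r x k)
    (h2 : ∀ k ∈ K, ∀ G : Finset α, G ⊆ F → (∀ x ∈ G, r x k) → G.card ≤ M) :
    F.card ≤ K.card * M := by
  classical
  have hsub : F ⊆ K.biUnion fun k => F.filter fun x => r x k := by
    intro x hx
    obtain ⟨k, hk, hr⟩ := h1 x hx
    exact Finset.mem_biUnion.2 ⟨k, hk, Finset.mem_filter.2 ⟨hx, hr⟩⟩
  refine (Finset.card_le_card hsub).trans (Finset.card_biUnion_le_card_mul _ _ _ ?_)
  intro k hk
  exact h2 k hk _ (Finset.filter_subset _ _) fun x hx => (Finset.mem_filter.1 hx).2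

/-- The divisor bound. -/
theorem card_divisors_le_rpow (η : ℝ) (hη : 0 < η) :
    ∃ C : ℝ, 1 ≤ C ∧ ∀ n : ℕ, 0 < n → (n.divisors.card : ℝ) ≤ C * (n : ℝ) ^ η := by
  have hl : 0 < Real.log 2 := Real.log_pos one_lt_two
  set c : ℝ := 1 + 1 / (η * Real.log 2) with hc
  have hc1 : 1 ≤ c := by
    have : 0 < 1 / (η * Real.log 2) := by positivity
    linarith
  set B : ℕ := ⌈(2 : ℝ) ^ (1 / η)⌉₊ with hB
  refine ⟨c ^ B, one_le_pow₀ hc1, fun n hn => ?_⟩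
  have key : ∀ q ∈ n.primeFactors, ((n.factorization q + 1 : ℕ) : ℝ) ≤
      (if q < B then c else 1) * (((q ^ n.factorization q : ℕ) : ℝ)) ^ η := by
    intro q hq
    have hq2 : 2 ≤ q := (Nat.prime_of_mem_primeFactors hq).two_le
    set k := n.factorization q
    have hq2' : (2 : ℝ) ≤ q := by exact_mod_cast hq2
    push_cast
    rw [← Real.rpow_natCast, ← Real.rpow_mul (by positivity), mul_comm (k : ℝ) η,
      Real.rpow_mul (by positivity), Real.rpow_natCast]
    split_ifs with h
    · have h2 : ((2 : ℝ) ^ η) ^ k ≤ ((q : ℝ) ^ η) ^ k := by gcongr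
      have h3 : 1 + (k : ℝ) * (η * Real.log 2) ≤ ((2 : ℝ) ^ η) ^ k := by
        rw [Real.rpow_def_of_pos two_pos, ← Real.exp_nat_mul]
        have := Real.add_one_le_exp ((k : ℝ) * (Real.log 2 * η))
        linarith
      have h4 : (k : ℝ) + 1 ≤ c * (1 + (k : ℝ) * (η * Real.log 2)) := by
        have : 1 / (η * Real.log 2) * (η * Real.log 2) = 1 := by field_simp
        have h5 : 0 < 1 / (η * Real.log 2) := by positivity
        have h6 : 0 ≤ (k : ℝ) * (η * Real.log 2) := by positivity
        calc (k : ℝ) + 1 = k * (1 / (η * Real.log 2) * (η * Real.log 2)) + 1 := by rw [this]; ring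
          _ ≤ _ := by rw [hc]; nlinarith
      calc (k : ℝ) + 1 ≤ _ := h4
        _ ≤ c * ((q : ℝ) ^ η) ^ k := by gcongr; exact h3.trans h2
    · have h2 : (2 : ℝ) ≤ (q : ℝ) ^ η := by
        have : (2 : ℝ) ^ (1 / η) ≤ q := (Nat.le_ceil _).trans (by exact_mod_cast not_lt.1 h)
        calc (2 : ℝ) = ((2 : ℝ) ^ (1 / η)) ^ η := by
              rw [← Real.rpow_mul (by norm_num)]; field_simp; norm_num
          _ ≤ _ := Real.rpow_le_rpow (by positivity) this hη.le
      have h3 : ((k : ℝ) + 1) ≤ 2 ^ k := by exact_mod_cast Nat.lt_two_pow_self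
      rw [one_mul]
      exact h3.trans (by gcongr)
  rw [Nat.card_divisors hn.ne']
  have hprod : (n : ℝ) ^ η = ∏ q ∈ n.primeFactors, (((q ^ n.factorization q : ℕ) : ℝ)) ^ η := by
    rw [Real.finsetProd_rpow _ _ (fun _ _ => by positivity)]
    congr 1
    conv_lhs => rw [← Nat.prod_factorization_pow_eq_self hn.ne']
    rw [Finsupp.prod, Nat.support_factorization]
    push_cast
    rfl
  rw [hprod, Nat.cast_prod]
  calc _ ≤ ∏ q ∈ n.primeFactors,
        ((if q < B then c else 1) * (((q ^ n.factorization q : ℕ) : ℝ)) ^ η) :=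
        Finset.prod_le_prod (fun _ _ => by positivity) key
    _ = (∏ q ∈ n.primeFactors, if q < B then c else 1) * _ := Finset.prod_mul_distrib
    _ ≤ _ := by
      refine mul_le_mul_of_nonneg_right ?_ (Finset.prod_nonneg fun _ _ => by positivity)
      rw [← Finset.prod_filter, Finset.prod_const]
      refine pow_le_pow_right₀ hc1 ?_
      calc _ ≤ (Finset.range B).card := Finset.card_le_card fun q hq => by
              simpa using (Finset.mem_filter.1 hq).2
        _ = B := Finset.card_range B

/-- A set of residues modulo `g`, partitioned according to a divisor of `g` such that elements of
the same class agree modulo `g / t` with `t ≤ T`, has at most `τ(g) * T` elements. -/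
theorem card_residues_le (g T : ℕ) (hg : 0 < g) (F : Finset ℕ) (hF : ∀ x ∈ F, x < g)
    (key : ℕ → ℕ) (hk : ∀ x ∈ F, key x ∣ g)
    (h : ∀ k, k ∣ g → (∃ x ∈ F, key x = k) → ∃ t, t ≤ T ∧ ∃ s, s * t = g ∧
      ∀ x ∈ F, ∀ y ∈ F, key x = k → key y = k → x ≡ y [MOD s]) :
    F.card ≤ g.divisors.card * T := by
  refine card_le_of_cover F g.divisors (fun x k => key x = k) T
    (fun x hx => ⟨_, Nat.mem_divisors.2 ⟨hk x hx, hg.ne'⟩, rfl⟩) ?_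
  intro k hkd G hGF hG
  rcases G.eq_empty_or_nonempty with rfl | ⟨x0, hx0⟩
  · simp
  obtain ⟨t, htT, s, hst, hcong⟩ := h k (Nat.dvd_of_mem_divisors hkd) ⟨x0, hGF hx0, hG x0 hx0⟩
  have hs : 0 < s := Nat.pos_of_ne_zero (by rintro rfl; omega)
  refine le_trans ?_ htT
  have := Finset.card_le_card_of_injOn (s := G) (t := Finset.range t) (fun x => x / s) ?_ ?_
  · simpa using this
  · intro x hx
    simp only [Finset.coe_range, Set.mem_Iio]
    rw [Nat.div_lt_iff_lt_mul hs, mul_comm, hst]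
    exact hF x (hGF hx)
  · intro x hx y hy hxy
    have h1 := hcong x (hGF hx) y (hGF hy) (hG x hx) (hG y hy)
    have h2 : x / s = y / s := hxy
    rw [← Nat.div_add_mod x s, ← Nat.div_add_mod y s, h2, h1]

/-- The number of square roots of `K` modulo `d`. -/
theorem card_sqrt_mod_le (d : ℕ) (hd : 0 < d) (K : ℕ) (hK : 0 < K) (F : Finset ℕ)
    (hF : ∀ x ∈ F, x < d) (hs : ∀ x ∈ F, (d : ℤ) ∣ (x : ℤ) ^ 2 - K) :
    F.card ≤ d.divisors.card * (4 * K) := by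
  rcases F.eq_empty_or_nonempty with rfl | ⟨z, hz⟩
  · simp
  refine card_residues_le d (4 * K) hd F hF (fun x => Int.gcd d ((x : ℤ) - z)) ?_ ?_
  · intro x _
    exact Int.gcd_dvd_natAbs_left _ _
  · rintro k ⟨e, he⟩ -
    have hk : 0 < k := Nat.pos_of_ne_zero (by rintro rfl; omega)
    have he0 : 0 < e := Nat.pos_of_ne_zero (by rintro rfl; omega)
    by_cases hne : ∃ x ∈ F, Int.gcd d ((x : ℤ) - z) = k
    swap
    · exact ⟨1, by omega, d, by simp, fun x hx y hy h => (hne ⟨x, hx, h⟩).elim⟩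
    have hmod : ∀ x ∈ F, Int.gcd d ((x : ℤ) - z) = k →
        (k : ℤ) ∣ (x : ℤ) - z ∧ (e : ℤ) ∣ (x : ℤ) + z := by
      intro x hx hxk
      have h1 : (k : ℤ) ∣ (x : ℤ) - z := hxk ▸ Int.gcd_dvd_right _ _
      refine ⟨h1, ?_⟩
      have h2 : (d : ℤ) ∣ ((x : ℤ) - z) * (x + z) := by
        have := dvd_sub (hs x hx) (hs z hz)
        ring_nf at this ⊢
        exact this
      obtain ⟨m, hm⟩ := h1
      have hde : (d : ℤ) = k * e := by exact_mod_cast he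
      rw [hm, hde, mul_assoc] at h2
      have h3 : (e : ℤ) ∣ m * (x + z) := Int.dvd_of_mul_dvd_mul_left (by exact_mod_cast hk.ne') h2
      refine Int.dvd_of_dvd_mul_right_of_gcd_one h3 ?_
      have h4 : Int.gcd ((k : ℤ) * e) (k * m) = k := by rw [← hde, ← hm]; exact hxk
      rw [Int.gcd_mul_left] at h4
      simpa [hk.ne'] using h4
    refine ⟨Nat.gcd k e, ?_, Nat.lcm k e, by rw [mul_comm, Nat.gcd_mul_lcm, he], ?_⟩
    · obtain ⟨x, hx, hxk⟩ := hne
      obtain ⟨h1, h2⟩ := hmod x hx hxk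
      set r := Nat.gcd k e
      have hrk : (r : ℤ) ∣ k := by exact_mod_cast Nat.gcd_dvd_left k e
      have hre : (r : ℤ) ∣ e := by exact_mod_cast Nat.gcd_dvd_right k e
      have h3 : (r : ℤ) ∣ 2 * z := by
        have := dvd_sub (hre.trans h2) (hrk.trans h1)
        ring_nf at this ⊢
        exact this
      have h4 : (r : ℤ) * r ∣ 4 * ((z : ℤ) ^ 2 - K) := by
        have : (r : ℤ) * r ∣ d := by
          have hde : (d : ℤ) = k * e := by exact_mod_cast he
          rw [hde]; exact mul_dvd_mul hrk hre
        exact Dvd.dvd.mul_left (this.trans (hs z hz)) 4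
      have h5 : (r : ℤ) * r ∣ (2 * z) * (2 * z) := mul_dvd_mul h3 h3
      have h6 : (r : ℤ) * r ∣ ((4 * K : ℕ) : ℤ) := by
        have := dvd_sub h5 h4
        push_cast
        ring_nf at this ⊢
        exact this
      have h7 : r * r ∣ 4 * K := by exact_mod_cast h6
      exact Nat.le_of_dvd (by omega) ((Dvd.intro _ rfl).trans h7)
    · intro x hx y hy hxk hyk
      have hx' := hmod x hx hxk
      have hy' := hmod y hy hyk
      rw [Nat.modEq_iff_dvd]
      have : (Nat.lcm k e : ℤ) = ((k : ℤ).lcm e : ℤ) := by simp [Int.lcm]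
      rw [this]
      refine Int.coe_lcm_dvd ?_ ?_
      · have := dvd_sub hy'.1 hx'.1
        ring_nf at this ⊢
        exact this
      · have := dvd_sub hy'.2 hx'.2
        ring_nf at this ⊢
        exact this

/-- A family of integer binary forms that is primitive represents a number coprime to `c`. -/
theorem exists_coprime_value (A B C : ℤ) (h : Int.gcd (Int.gcd A B) C = 1) (c : ℕ) (hc : 0 < c) :
    ∃ s t : ℤ, IsCoprime (A * s ^ 2 + B * s * t + C * t ^ 2) (c : ℤ) := by
  classical
  set P := c.primeFactors
  set S1 : Finset ℕ := P.filter fun l : ℕ => ¬ (l : ℤ) ∣ A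
  set S2 : Finset ℕ := P.filter fun l : ℕ => (l : ℤ) ∣ A ∧ ¬ (l : ℤ) ∣ C
  have hprime : ∀ l ∈ P, l.Prime := fun l hl => Nat.prime_of_mem_primeFactors hl
  have hdiv : ∀ S ⊆ P, ∀ l ∈ P, (l : ℤ) ∣ ((∏ x ∈ S, x : ℕ) : ℤ) ↔ l ∈ S := by
    intro S hS l hl
    rw [Int.natCast_dvd_natCast, (hprime l hl).prime.dvd_finsetProd_iff]
    constructor
    · rintro ⟨x, hx, hlx⟩
      rw [(Nat.prime_dvd_prime_iff_eq (hprime l hl) (hprime x (hS hx))).1 hlx]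
      exact hx
    · exact fun hl => ⟨l, hl, dvd_rfl⟩
  have hd1 := hdiv S1 (Finset.filter_subset _ _)
  have hd2 := hdiv S2 (Finset.filter_subset _ _)
  set t : ℤ := ((∏ x ∈ S1, x : ℕ) : ℤ)
  set s : ℤ := ((∏ x ∈ S2, x : ℕ) : ℤ)
  refine ⟨s, t, ?_⟩
  rw [Int.isCoprime_iff_gcd_eq_one]
  by_contra hne
  obtain ⟨l, hl, hlg⟩ := Nat.exists_prime_and_dvd hne
  have hlc : l ∣ c := by
    have := hlg.trans (Int.gcd_dvd_natAbs_right _ _)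
    simpa using this
  have hlP : l ∈ P := Nat.mem_primeFactors.2 ⟨hl, hlc, hc.ne'⟩
  have hlq : (l : ℤ) ∣ A * s ^ 2 + B * s * t + C * t ^ 2 :=
    (Int.natCast_dvd_natCast.2 hlg).trans (Int.gcd_dvd_left _ _)
  have hpl : Prime (l : ℤ) := Nat.prime_iff_prime_int.1 hl
  have h1 := hd1 l hlP
  have h2 := hd2 l hlP
  simp only [S1, S2, Finset.mem_filter, hlP, true_and] at h1 h2
  by_cases hA : (l : ℤ) ∣ A
  · by_cases hC : (l : ℤ) ∣ C
    · have ht : ¬ (l : ℤ) ∣ t := by rw [h1]; simpa using hA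
      have hs : ¬ (l : ℤ) ∣ s := by rw [h2]; simp [hC]
      have hB : (l : ℤ) ∣ B := by
        have h3 : (l : ℤ) ∣ B * s * t := by
          have h4 := dvd_sub (dvd_sub hlq (hA.mul_right (s ^ 2))) (hC.mul_right (t ^ 2))
          ring_nf at h4 ⊢
          exact h4
        rcases hpl.dvd_or_dvd h3 with h4 | h4
        · exact (hpl.dvd_or_dvd h4).resolve_right hs
        · exact absurd h4 ht
      have : (l : ℤ) ∣ ((Int.gcd (Int.gcd A B) C : ℕ) : ℤ) :=
        Int.dvd_coe_gcd (Int.dvd_coe_gcd hA hB) hC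
      rw [h] at this
      exact hpl.not_dvd_one (by simpa using this)
    · have ht : ¬ (l : ℤ) ∣ t := by rw [h1]; simpa using hA
      have hs : (l : ℤ) ∣ s := h2.2 ⟨hA, hC⟩
      have h3 : (l : ℤ) ∣ C * t ^ 2 := by
        have h4 := dvd_sub hlq (hs.mul_right (A * s + B * t))
        ring_nf at h4 ⊢
        exact h4
      rcases hpl.dvd_or_dvd h3 with h4 | h4
      · exact hC h4
      · exact ht (hpl.dvd_of_dvd_pow h4)
  · have ht : (l : ℤ) ∣ t := h1.2 hA
    have hs : ¬ (l : ℤ) ∣ s := by rw [h2]; simp [hA]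
    have h3 : (l : ℤ) ∣ A * s ^ 2 := by
      have h4 := dvd_sub hlq (ht.mul_right (C * t + B * s))
      ring_nf at h4 ⊢
      exact h4
    rcases hpl.dvd_or_dvd h3 with h4 | h4
    · exact hA h4
    · exact hs (hpl.dvd_of_dvd_pow h4)

/-- Given two integer vectors, some combination `i r + j r'` with `i, j` dividing `2 f` is non-zero
(if the vectors are not both zero) and has the same common divisor with `f` as the pair. -/
theorem exists_combination_gcd (f : ℕ) (hf : 0 < f) (a b a' b' : ℤ)
    (hne : ¬ (a = 0 ∧ b = 0 ∧ a' = 0 ∧ b' = 0)) :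
    ∃ i j h : ℕ, i ∣ 2 * f ∧ j ∣ 2 * f ∧ h ∣ f ∧
      ((h : ℤ) ∣ a ∧ (h : ℤ) ∣ b ∧ (h : ℤ) ∣ a' ∧ (h : ℤ) ∣ b') ∧
      ¬ (i * a + j * a' = 0 ∧ i * b + j * b' = 0) ∧
      Int.gcd (Int.gcd (i * a + j * a') (i * b + j * b')) f = h := by
  classical
  set h : ℕ := Int.gcd (Int.gcd (Int.gcd a b) (Int.gcd a' b')) f with hh
  have hhf : h ∣ f := Int.gcd_dvd_natAbs_right (Int.gcd (Int.gcd a b) (Int.gcd a' b')) f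
  have hpos : 0 < h := Nat.pos_of_dvd_of_pos hhf hf
  have hl : (h : ℤ) ∣ ((Int.gcd (Int.gcd a b) (Int.gcd a' b') : ℕ) : ℤ) := Int.gcd_dvd_left _ _
  have hl1 := hl.trans (Int.gcd_dvd_left _ _)
  have hl2 := hl.trans (Int.gcd_dvd_right _ _)
  obtain ⟨a1, ha⟩ := hl1.trans (Int.gcd_dvd_left _ _)
  obtain ⟨b1, hb⟩ := hl1.trans (Int.gcd_dvd_right _ _)
  obtain ⟨a2, ha'⟩ := hl2.trans (Int.gcd_dvd_left _ _)
  obtain ⟨b2, hb'⟩ := hl2.trans (Int.gcd_dvd_right _ _)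
  obtain ⟨f1, hf1⟩ := hhf
  have hh0 : (h : ℤ) ≠ 0 := by exact_mod_cast hpos.ne'
  have hcop : ∀ l : ℕ, l.Prime → l ∣ f1 → (l : ℤ) ∣ a1 → (l : ℤ) ∣ b1 → (l : ℤ) ∣ a2 →
      (l : ℤ) ∣ b2 → False := by
    intro l hlp h0 h1 h2 h3 h4
    have hd : ((h * l : ℕ) : ℤ) ∣ (h : ℤ) := by
      rw [hh]
      push_cast
      rw [← hh]
      refine Int.dvd_coe_gcd (Int.dvd_coe_gcd (Int.dvd_coe_gcd ?_ ?_) (Int.dvd_coe_gcd ?_ ?_)) ?_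
      · rw [ha]; exact mul_dvd_mul_left _ h1
      · rw [hb]; exact mul_dvd_mul_left _ h2
      · rw [ha']; exact mul_dvd_mul_left _ h3
      · rw [hb']; exact mul_dvd_mul_left _ h4
      · rw [hf1]; push_cast; exact mul_dvd_mul_left _ (by exact_mod_cast h0)
    have := Nat.le_of_dvd hpos (Int.natCast_dvd_natCast.1 hd)
    nlinarith [hlp.two_le]
  -- it suffices to treat the reduced vectors
  suffices hs : ∃ i j : ℕ, i ∣ 2 * f ∧ j ∣ 2 * f ∧
      ¬ (i * a1 + j * a2 = 0 ∧ i * b1 + j * b2 = 0) ∧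
      ∀ l : ℕ, l.Prime → l ∣ f1 → (l : ℤ) ∣ i * a1 + j * a2 → (l : ℤ) ∣ i * b1 + j * b2 → False by
    obtain ⟨i, j, hi, hj, hn, hg⟩ := hs
    have e1 : (i : ℤ) * a + j * a' = h * (i * a1 + j * a2) := by rw [ha, ha']; ring
    have e2 : (i : ℤ) * b + j * b' = h * (i * b1 + j * b2) := by rw [hb, hb']; ring
    refine ⟨i, j, h, hi, hj, ⟨f1, hf1⟩, ⟨⟨_, ha⟩, ⟨_, hb⟩, ⟨_, ha'⟩, ⟨_, hb'⟩⟩, ?_, ?_⟩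
    · rw [e1, e2]
      simp only [mul_eq_zero, hh0, false_or]
      exact hn
    · rw [e1, e2, hf1, Int.gcd_mul_left, Int.natAbs_natCast]
      push_cast
      rw [Int.gcd_mul_left, Int.natAbs_natCast]
      have : Int.gcd (Int.gcd (i * a1 + j * a2) (i * b1 + j * b2)) f1 = 1 := by
        by_contra hne1
        obtain ⟨l, hlp, hlg⟩ := Nat.exists_prime_and_dvd hne1
        have h1 : (l : ℤ) ∣ ((Int.gcd (i * a1 + j * a2) (i * b1 + j * b2) : ℕ) : ℤ) :=
          (Int.natCast_dvd_natCast.2 hlg).trans (Int.gcd_dvd_left _ _)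
        refine hg l hlp ?_ (h1.trans (Int.gcd_dvd_left _ _)) (h1.trans (Int.gcd_dvd_right _ _))
        have := hlg.trans (Int.gcd_dvd_natAbs_right _ _)
        simpa using this
      rw [this, mul_one]
  have hne1 : ¬ (a1 = 0 ∧ b1 = 0 ∧ a2 = 0 ∧ b2 = 0) := by
    rintro ⟨rfl, rfl, rfl, rfl⟩
    exact hne (by simp [ha, hb, ha', hb'])
  have hf10 : f1 ≠ 0 := by rintro rfl; omega
  by_cases hf11 : f1 = 1
  · by_cases hz : a1 + a2 = 0 ∧ b1 + b2 = 0
    · refine ⟨1, 2, one_dvd _, dvd_mul_right _ _, ?_, ?_⟩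
      · rintro ⟨h1, h2⟩
        push_cast at h1 h2
        exact hne1 (by omega)
      · intro l hlp h0
        rw [hf11] at h0
        exact absurd (Nat.dvd_one.1 h0) hlp.ne_one
    · refine ⟨1, 1, one_dvd _, one_dvd _, by simpa using hz, ?_⟩
      intro l hlp h0
      rw [hf11] at h0
      exact absurd (Nat.dvd_one.1 h0) hlp.ne_one
  set P := f1.primeFactors
  set S1 : Finset ℕ := P.filter fun l : ℕ => ¬ ((l : ℤ) ∣ a1 ∧ (l : ℤ) ∣ b1)
  set S2 : Finset ℕ := P.filter fun l : ℕ => ((l : ℤ) ∣ a1 ∧ (l : ℤ) ∣ b1)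
  have hprime : ∀ l ∈ P, l.Prime := fun l hl => Nat.prime_of_mem_primeFactors hl
  have hdvd : ∀ S ⊆ P, (∏ x ∈ S, x) ∣ 2 * f := by
    intro S hS
    refine (Finset.prod_dvd_prod_of_subset _ _ _ hS).trans ((Nat.prod_primeFactors_dvd f1).trans ?_)
    rw [hf1]
    exact ⟨2 * h, by ring⟩
  have hdiv : ∀ S ⊆ P, ∀ l ∈ P, (l : ℤ) ∣ ((∏ x ∈ S, x : ℕ) : ℤ) ↔ l ∈ S := by
    intro S hS l hl
    rw [Int.natCast_dvd_natCast, (hprime l hl).prime.dvd_finsetProd_iff]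
    constructor
    · rintro ⟨x, hx, hlx⟩
      rw [(Nat.prime_dvd_prime_iff_eq (hprime l hl) (hprime x (hS hx))).1 hlx]
      exact hx
    · exact fun hl => ⟨l, hl, dvd_rfl⟩
  have hd1 := hdiv S1 (Finset.filter_subset _ _)
  have hd2 := hdiv S2 (Finset.filter_subset _ _)
  have hv1 := hdvd S1 (Finset.filter_subset _ _)
  have hv2 := hdvd S2 (Finset.filter_subset _ _)
  have hg : ∀ l : ℕ, l.Prime → l ∣ f1 →
      (l : ℤ) ∣ ((∏ x ∈ S2, x : ℕ) : ℤ) * a1 + ((∏ x ∈ S1, x : ℕ) : ℤ) * a2 →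
      (l : ℤ) ∣ ((∏ x ∈ S2, x : ℕ) : ℤ) * b1 + ((∏ x ∈ S1, x : ℕ) : ℤ) * b2 → False := by
    intro l hlp hlf h1 h2
    have hlP : l ∈ P := Nat.mem_primeFactors.2 ⟨hlp, hlf, hf10⟩
    have hpl : Prime (l : ℤ) := Nat.prime_iff_prime_int.1 hlp
    have e1 := hd1 l hlP
    have e2 := hd2 l hlP
    simp only [S1, S2, Finset.mem_filter, hlP, true_and] at e1 e2
    by_cases hab : (l : ℤ) ∣ a1 ∧ (l : ℤ) ∣ b1
    · have ht : ¬ (l : ℤ) ∣ ((∏ x ∈ S1, x : ℕ) : ℤ) := by rw [e1]; simpa using hab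
      have g1 := (dvd_add_right (hab.1.mul_left _)).1 h1
      have g2 := (dvd_add_right (hab.2.mul_left _)).1 h2
      exact hcop l hlp hlf hab.1 hab.2 ((hpl.dvd_or_dvd g1).resolve_left ht)
        ((hpl.dvd_or_dvd g2).resolve_left ht)
    · have ht : ¬ (l : ℤ) ∣ ((∏ x ∈ S2, x : ℕ) : ℤ) := by rw [e2]; exact hab
      have hs := e1.2 hab
      have g1 := (dvd_add_left (hs.mul_right a2)).1 h1
      have g2 := (dvd_add_left (hs.mul_right b2)).1 h2
      exact hab ⟨(hpl.dvd_or_dvd g1).resolve_left ht, (hpl.dvd_or_dvd g2).resolve_left ht⟩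
  refine ⟨∏ x ∈ S2, x, ∏ x ∈ S1, x, hv2, hv1, ?_, hg⟩
  rintro ⟨h1, h2⟩
  obtain ⟨l, hlp, hlf⟩ := Nat.exists_prime_and_dvd hf11
  exact hg l hlp hlf (by rw [h1]; exact dvd_zero _) (by rw [h2]; exact dvd_zero _)

theorem int_dvd_of_eq {a b c : ℤ} (h : a ∣ b) (e : c = b) : a ∣ c := e ▸ h

theorem card_quadratic_residues_le (g : ℕ) (hg : 0 < g) (E' ρ : ℤ) (h : ℕ)
    (hh : ∀ t : ℕ, t ∣ g → ((t : ℤ) * t ∣ g * E') → t ≤ h) (F : Finset ℕ)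
    (hF : ∀ x ∈ F, x < g) (hdvd : ∀ x ∈ F, (g : ℤ) ∣ x * (E' * x + ρ)) :
    F.card ≤ g.divisors.card * h := by
  refine card_residues_le g h hg F hF (fun x => Nat.gcd g x) (fun x _ => Nat.gcd_dvd_left _ _) ?_
  rintro k ⟨e, he⟩ -
  have hk : 0 < k := Nat.pos_of_ne_zero (by rintro rfl; omega)
  have he0 : 0 < e := Nat.pos_of_ne_zero (by rintro rfl; omega)
  have key : ∀ x ∈ F, Nat.gcd g x = k → (k : ℤ) ∣ x ∧ (e : ℤ) ∣ E' * x + ρ := by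
    intro x hx hxk
    have h1 : k ∣ x := hxk ▸ Nat.gcd_dvd_right _ _
    refine ⟨by exact_mod_cast h1, ?_⟩
    obtain ⟨m, rfl⟩ := h1
    have h2 : (k : ℤ) * e ∣ k * (m * (E' * (k * m : ℕ) + ρ)) := by
      have := hdvd _ hx
      rw [he] at this
      push_cast at this ⊢
      rwa [mul_assoc] at this
    have h3 := Int.dvd_of_mul_dvd_mul_left (by exact_mod_cast hk.ne') h2
    refine Int.dvd_of_dvd_mul_right_of_gcd_one h3 ?_
    rw [he, Nat.gcd_mul_left] at hxk
    rw [Int.gcd_natCast_natCast]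
    exact Nat.eq_of_mul_eq_mul_left hk (by omega)
  obtain ⟨t, ht⟩ : ∃ t, t = Int.gcd e (E' * k) := ⟨_, rfl⟩
  have hte : (t : ℤ) ∣ e := ht ▸ Int.gcd_dvd_left _ _
  have htk : (t : ℤ) ∣ E' * k := ht ▸ Int.gcd_dvd_right _ _
  obtain ⟨u, hu⟩ : t ∣ e := by exact_mod_cast hte
  have ht0 : 0 < t := Nat.pos_of_ne_zero (by rintro rfl; omega)
  refine ⟨t, hh t ?_ ?_, k * u, by rw [he, hu]; ring, ?_⟩
  · rw [he]; exact Dvd.dvd.mul_left ⟨u, hu⟩ _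
  · have h1 := mul_dvd_mul hte htk
    have h2 : (g : ℤ) * E' = e * (E' * k) := by rw [he]; push_cast; ring
    rw [h2]; exact h1
  · intro x hx y hy hxk hyk
    obtain ⟨h1, h2⟩ := key x hx hxk
    obtain ⟨h3, h4⟩ := key y hy hyk
    obtain ⟨m, hm⟩ := dvd_sub h3 h1
    rw [Nat.modEq_iff_dvd, hm]
    push_cast
    refine mul_dvd_mul_left _ ?_
    have h5 : (e : ℤ) ∣ E' * k * m := by
      have h6 := dvd_sub h4 h2
      have h7 : E' * k * m = E' * y + ρ - (E' * x + ρ) := by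
        linear_combination -E' * hm
      rwa [h7]
    obtain ⟨w, hw⟩ := htk
    have h8 : (t : ℤ) * u ∣ t * (w * m) := by
      have : (e : ℤ) = t * u := by exact_mod_cast hu
      rw [← this, ← mul_assoc, ← hw]; exact h5
    have ht0' : (t : ℤ) ≠ 0 := by exact_mod_cast ht0.ne'
    have h9 := Int.dvd_of_mul_dvd_mul_left ht0' h8
    refine Int.dvd_of_dvd_mul_right_of_gcd_one h9 ?_
    have h10 : (e : ℤ) = t * u := by exact_mod_cast hu
    rw [h10, hw, Int.gcd_mul_left, Int.natAbs_natCast] at ht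
    exact Nat.eq_of_mul_eq_mul_left ht0 (by omega)

/-- Bound for the number of residue vectors `α` modulo `c` solving simultaneous linear congruences
modulo `c` and a quadratic congruence modulo `c ^ 2`. -/
theorem card_vectors_mod_le (A B C : ℤ) (hprim : Int.gcd (Int.gcd A B) C = 1)
    (hE : 0 < 4 * A * C - B ^ 2) (c h : ℕ) (hc : 0 < c)
    (hh : ∀ t : ℕ, t ∣ c → (t : ℤ) * t ∣ 4 * A * C - B ^ 2 → t ≤ h) (m ξ₁ ξ₂ : ℤ)
    (F : Finset (ℤ × ℤ)) (hF : ∀ α ∈ F, 0 ≤ α.1 ∧ α.1 < c ∧ 0 ≤ α.2 ∧ α.2 < c)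
    (h1 : ∀ α ∈ F, (c : ℤ) ∣ ξ₁ - (2 * A * α.1 + B * α.2))
    (h2 : ∀ α ∈ F, (c : ℤ) ∣ ξ₂ - (B * α.1 + 2 * C * α.2))
    (h3 : ∀ α ∈ F, (c : ℤ) * c ∣ m - (α.1 * ξ₁ + α.2 * ξ₂) +
      (A * α.1 ^ 2 + B * α.1 * α.2 + C * α.2 ^ 2)) :
    F.card ≤ (4 * A * C - B ^ 2).toNat.divisors.card * h * 4 := by
  classical
  rcases F.eq_empty_or_nonempty with rfl | ⟨β, hβ⟩
  · simp
  obtain ⟨s, t, hcop⟩ := exists_coprime_value A B C hprim c hc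
  obtain ⟨Q0, hQ0⟩ : ∃ Q0, Q0 = A * s ^ 2 + B * s * t + C * t ^ 2 := ⟨_, rfl⟩
  rw [← hQ0] at hcop
  obtain ⟨E, hEE⟩ : ∃ E, E = 4 * A * C - B ^ 2 := ⟨_, rfl⟩
  rw [← hEE] at hE hh ⊢
  obtain ⟨η₁, hη₁⟩ := h1 β hβ
  obtain ⟨η₂, hη₂⟩ := h2 β hβ
  obtain ⟨g, hg⟩ : ∃ g : ℕ, g = Int.gcd c E := ⟨_, rfl⟩
  have hgc : g ∣ c := by
    have : (g : ℤ) ∣ c := hg ▸ Int.gcd_dvd_left _ _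
    exact_mod_cast this
  have hgE : (g : ℤ) ∣ E := hg ▸ Int.gcd_dvd_right _ _
  have hg0 : 0 < g := Nat.pos_of_dvd_of_pos hgc hc
  have hg0' : (g : ℤ) ≠ 0 := by exact_mod_cast hg0.ne'
  obtain ⟨c', hc'⟩ := hgc
  obtain ⟨E', hE'⟩ := hgE
  have hcc : (c : ℤ) = g * c' := by exact_mod_cast hc'
  have hc0 : (c' : ℤ) ≠ 0 := by
    have : c' ≠ 0 := by rintro rfl; omega
    exact_mod_cast this
  have hcop' : Int.gcd (c' : ℤ) E' = 1 := by
    rw [hcc, hE', Int.gcd_mul_left, Int.natAbs_natCast] at hg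
    exact Nat.eq_of_mul_eq_mul_left hg0 (by omega)
  obtain ⟨ρ, hρ⟩ : ∃ ρ, ρ = -2 * (η₁ * (-(B * s + 2 * C * t)) + η₂ * (2 * A * s + B * t)) :=
    ⟨_, rfl⟩
  obtain ⟨δ, hδ⟩ : ∃ δ : ℤ × ℤ → ℤ, δ = fun α => s * (α.2 - β.2) - t * (α.1 - β.1) := ⟨_, rfl⟩
  -- divisibility of the linear forms
  have hlin : ∀ α ∈ F, (c : ℤ) ∣ 2 * A * (α.1 - β.1) + B * (α.2 - β.2) ∧
      (c : ℤ) ∣ B * (α.1 - β.1) + 2 * C * (α.2 - β.2) := by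
    intro α hα
    have e1 := dvd_sub (h1 β hβ) (h1 α hα)
    have e2 := dvd_sub (h2 β hβ) (h2 α hα)
    constructor
    · exact int_dvd_of_eq e1 (by ring)
    · exact int_dvd_of_eq e2 (by ring)
  have hj : ∀ α ∈ F, ∃ j, δ α = c' * j := by
    intro α hα
    obtain ⟨e1, e2⟩ := hlin α hα
    have e3 : (c : ℤ) ∣ E * δ α := by
      have := dvd_add (e1.mul_left (-(B * s + 2 * C * t))) (e2.mul_left (2 * A * s + B * t))
      exact int_dvd_of_eq this (by rw [hEE, hδ]; ring)
    rw [hcc, hE', mul_assoc] at e3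
    exact Int.dvd_of_dvd_mul_right_of_gcd_one (Int.dvd_of_mul_dvd_mul_left hg0' e3) hcop'
  choose! j hj using hj
  have hquad : ∀ α ∈ F, (g : ℤ) ∣ j α * (E' * j α + ρ) := by
    intro α hα
    obtain ⟨⟨u1, e1⟩, ⟨u2, e2⟩⟩ := hlin α hα
    have e3 := dvd_sub (h3 α hα) (h3 β hβ)
    -- `b(e, γ) = c * u`
    have e4 : (c : ℤ) * c ∣ E * δ α ^ 2 + ρ * c * δ α := by
      have e5 : E * δ α ^ 2 + ρ * c * δ α =
          4 * Q0 * ((m - (α.1 * ξ₁ + α.2 * ξ₂) + (A * α.1 ^ 2 + B * α.1 * α.2 + C * α.2 ^ 2)) -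
            (m - (β.1 * ξ₁ + β.2 * ξ₂) + (A * β.1 ^ 2 + B * β.1 * β.2 + C * β.2 ^ 2))) -
          c * c * ((s * u1 + t * u2) ^ 2 - 2 * (s * u1 + t * u2) * (η₁ * s + η₂ * t)) := by
        have k1 : c * (s * u1 + t * u2) = s * (2 * A * (α.1 - β.1) + B * (α.2 - β.2)) +
          t * (B * (α.1 - β.1) + 2 * C * (α.2 - β.2)) := by rw [e1, e2]; ring
        have k2 : (c : ℤ) * c * ((s * u1 + t * u2) ^ 2 -
            2 * (s * u1 + t * u2) * (η₁ * s + η₂ * t)) =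
            (c * (s * u1 + t * u2)) ^ 2 -
            2 * (c * (s * u1 + t * u2)) * (c * η₁ * s + c * η₂ * t) := by ring
        have k3 : ρ * c = -2 * ((c * η₁) * (-(B * s + 2 * C * t)) +
          (c * η₂) * (2 * A * s + B * t)) := by rw [hρ]; ring
        rw [k2, k3, k1, ← hη₁, ← hη₂, hEE, hQ0, hδ]
        ring
      rw [e5]
      exact dvd_sub (e3.mul_left _) (dvd_mul_right _ _)
    rw [hj α hα, hcc, hE'] at e4
    have e6 : (g : ℤ) * c' * (g * c') = (g * c' * c') * g := by ring
    have e7 : (g : ℤ) * E' * (c' * j α) ^ 2 + ρ * (g * c') * (c' * j α) =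
      (g * c' * c') * (j α * (E' * j α + ρ)) := by ring
    rw [e6, e7] at e4
    exact Int.dvd_of_mul_dvd_mul_left (mul_ne_zero (mul_ne_zero hg0' hc0) hc0) e4
  set K : Finset ℕ := F.image fun α => (j α % g).toNat with hK
  have hcast : ∀ α, (((j α % g).toNat : ℕ) : ℤ) = j α % g := fun α =>
    Int.toNat_of_nonneg (Int.emod_nonneg _ hg0')
  have hgpos : (0 : ℤ) < g := by exact_mod_cast hg0
  have hKcard : K.card ≤ g.divisors.card * h := by
    refine card_quadratic_residues_le g hg0 E' ρ h ?_ K ?_ ?_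
    · intro t ht htt
      exact hh t (hc' ▸ ht.mul_right c') (hE' ▸ htt)
    · intro x hx
      obtain ⟨α, hα, rfl⟩ := Finset.mem_image.1 hx
      have := Int.emod_lt_of_pos (j α) hgpos
      have h4 := hcast α
      omega
    · intro x hx
      obtain ⟨α, hα, rfl⟩ := Finset.mem_image.1 hx
      rw [hcast]
      have e1 : (j α % g) ≡ j α [ZMOD g] := Int.mod_modEq _ _
      have e2 := (e1.mul ((e1.mul_left E').add_right ρ))
      exact e2.dvd_iff.2 (hquad α hα)
  have hgdiv : g.divisors.card ≤ E.toNat.divisors.card := by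
    refine Finset.card_le_card (Nat.divisors_subset_of_dvd (by omega) ?_)
    have : (g : ℤ) ∣ E.toNat := by rw [Int.toNat_of_nonneg hE.le, hE']; exact dvd_mul_right _ _
    exact_mod_cast this
  have hmain : F.card ≤ K.card * 4 := by
    refine card_le_of_cover F K (fun α x => (j α % g).toNat = x) 4
      (fun α hα => ⟨_, Finset.mem_image_of_mem _ hα, rfl⟩) ?_
    intro k _ G hGF hG
    have hcpos : (0 : ℤ) < c := by exact_mod_cast hc
    have hcong : ∀ α ∈ G, ∀ α' ∈ G, (c : ℤ) ∣ 2 * (α.1 - α'.1) ∧ (c : ℤ) ∣ 2 * (α.2 - α'.2) := by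
      intro α hα α' hα'
      have e1 : j α % g = j α' % g := by
        have := (hG α hα).trans (hG α' hα').symm
        rw [← hcast α, ← hcast α', this]
      have e2 : (g : ℤ) ∣ j α - j α' := Int.ModEq.dvd (Int.ModEq.symm e1)
      have e3 : (c : ℤ) ∣ δ α - δ α' := by
        rw [hj α (hGF hα), hj α' (hGF hα'), ← mul_sub, hcc, mul_comm]
        exact mul_dvd_mul_left _ e2
      obtain ⟨f1, f2⟩ := hlin α (hGF hα)
      obtain ⟨f3, f4⟩ := hlin α' (hGF hα')
      have e4 := dvd_add ((dvd_sub f1 f3).mul_left s) ((dvd_sub f2 f4).mul_left t)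
      have e5 : (c : ℤ) ∣ Q0 * (2 * (α.1 - α'.1)) := by
        have := dvd_add (e4.mul_left s) (e3.mul_left (-(B * s + 2 * C * t)))
        exact int_dvd_of_eq this (by rw [hQ0, hδ]; ring)
      have e6 : (c : ℤ) ∣ Q0 * (2 * (α.2 - α'.2)) := by
        have := dvd_add (e4.mul_left t) (e3.mul_left (2 * A * s + B * t))
        exact int_dvd_of_eq this (by rw [hQ0, hδ]; ring)
      exact ⟨hcop.symm.dvd_of_dvd_mul_left e5, hcop.symm.dvd_of_dvd_mul_left e6⟩
    have hle := Finset.card_le_card_of_injOn (s := G)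
      (t := ({0, 1} : Finset ℤ) ×ˢ ({0, 1} : Finset ℤ))
      (fun α => (2 * α.1 / c, 2 * α.2 / c)) ?_ ?_
    · simpa using hle
    · intro α hα
      obtain ⟨b1, b2, b3, b4⟩ := hF α (hGF hα)
      have r : ∀ z : ℤ, 0 ≤ z → z < c → 2 * z / c = 0 ∨ 2 * z / c = 1 := by
        intro z z0 z1
        have r1 : 0 ≤ 2 * z / c := Int.ediv_nonneg (by omega) hcpos.le
        have r2 : 2 * z / c < 2 := Int.ediv_lt_of_lt_mul hcpos (by omega)
        omega
      simp only [Finset.coe_product, Set.mem_prod, Finset.mem_coe, Finset.mem_insert,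
        Finset.mem_singleton]
      exact ⟨r _ b1 b2, r _ b3 b4⟩
    · intro α hα α' hα' heq
      simp only [Prod.mk.injEq] at heq
      obtain ⟨d1, d2⟩ := hcong α hα α' hα'
      have r : ∀ z z' : ℤ, 2 * z / c = 2 * z' / c → (c : ℤ) ∣ 2 * (z - z') → z = z' := by
        intro z z' h1 h2
        have r1 := Int.mul_ediv_add_emod (2 * z) c
        have r2 := Int.mul_ediv_add_emod (2 * z') c
        have r3 : 2 * z % c = 2 * z' % c := by
          refine (Int.ModEq.symm ?_ : 2 * z ≡ 2 * z' [ZMOD c])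
          rw [Int.modEq_iff_dvd, ← mul_sub]; exact h2
        rw [h1, r3] at r1
        omega
      exact Prod.ext (r _ _ heq.1 d1) (r _ _ heq.2 d2)
  calc F.card ≤ K.card * 4 := hmain
    _ ≤ (g.divisors.card * h) * 4 := Nat.mul_le_mul_right _ hKcard
    _ ≤ _ := Nat.mul_le_mul_right _ (Nat.mul_le_mul_right _ hgdiv)

/-- The bilinear form attached to a matrix. -/
def bl (N : Matrix (Fin 4) (Fin 4) ℤ) (v w : Fin 4 → ℤ) : ℤ := v ⬝ᵥ N *ᵥ w

/-- Symmetric positive definite integer matrices. -/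
structure IsPD (N : Matrix (Fin 4) (Fin 4) ℤ) : Prop where
  symm : N.IsSymm
  pos : ∀ v : Fin 4 → ℤ, v ≠ 0 → 0 < bl N v v

section bl
variable (N : Matrix (Fin 4) (Fin 4) ℤ)

theorem bl_add_left (u v w : Fin 4 → ℤ) : bl N (u + v) w = bl N u w + bl N v w := by
  simp [bl, add_dotProduct]

theorem bl_add_right (u v w : Fin 4 → ℤ) : bl N u (v + w) = bl N u v + bl N u w := by
  simp [bl, mulVec_add, dotProduct_add]

theorem bl_sub_left (u v w : Fin 4 → ℤ) : bl N (u - v) w = bl N u w - bl N v w := by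
  simp [bl, sub_dotProduct]

theorem bl_sub_right (u v w : Fin 4 → ℤ) : bl N u (v - w) = bl N u v - bl N u w := by
  simp [bl, mulVec_sub, dotProduct_sub]

theorem bl_smul_left (a : ℤ) (v w : Fin 4 → ℤ) : bl N (a • v) w = a * bl N v w := by
  rw [bl, smul_dotProduct, smul_eq_mul, bl]

theorem bl_smul_right (a : ℤ) (v w : Fin 4 → ℤ) : bl N v (a • w) = a * bl N v w := by
  rw [bl, mulVec_smul, dotProduct_smul, smul_eq_mul, bl]

theorem bl_zero_left (w : Fin 4 → ℤ) : bl N 0 w = 0 := by simp [bl]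

theorem bl_zero_right (w : Fin 4 → ℤ) : bl N w 0 = 0 := by simp [bl]

theorem bl_neg_left (v w : Fin 4 → ℤ) : bl N (-v) w = - bl N v w := by
  simp [bl]

theorem bl_neg_right (v w : Fin 4 → ℤ) : bl N v (-w) = - bl N v w := by
  simp [bl, mulVec_neg]

theorem gram_apply {n : ℕ} (M : Matrix (Fin n) (Fin 4) ℤ) (i j : Fin n) :
    (M * N * Mᵀ) i j = bl N (M i) (M j) := by
  rw [Matrix.mul_assoc, Matrix.mul_apply, bl, dotProduct]
  refine Finset.sum_congr rfl fun k _ => ?_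
  rw [Matrix.mul_apply, mulVec, dotProduct]
  rfl

variable {N}

theorem bl_comm (hN : IsPD N) (v w : Fin 4 → ℤ) : bl N v w = bl N w v := by
  rw [bl, bl, dotProduct_mulVec, ← mulVec_transpose, hN.symm.eq, dotProduct_comm]

theorem bl_self_nonneg (hN : IsPD N) (v : Fin 4 → ℤ) : 0 ≤ bl N v v := by
  by_cases h : v = 0
  · rw [h, bl_zero_left]
  · exact (hN.pos v h).le

theorem eq_zero_of_bl_self (hN : IsPD N) {v : Fin 4 → ℤ} (h : bl N v v = 0) : v = 0 := by
  by_contra hv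
  exact (hN.pos v hv).ne' h

theorem bl_sq_le (hN : IsPD N) (v w : Fin 4 → ℤ) : bl N v w ^ 2 ≤ bl N v v * bl N w w := by
  by_cases h : w = 0
  · simp [h, bl_zero_right]
  have hw := hN.pos w h
  have h1 := bl_self_nonneg hN (bl N w w • v - bl N v w • w)
  simp only [bl_sub_left, bl_sub_right, bl_smul_left, bl_smul_right, bl_comm hN w v] at h1
  have h2 : 0 ≤ bl N w w * (bl N v v * bl N w w - bl N v w ^ 2) := by nlinarith
  have := nonneg_of_mul_nonneg_right h2 hw
  linarith

theorem gram_det (M : Matrix (Fin 4) (Fin 4) ℤ) :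
    (Matrix.of fun i j => bl N (M i) (M j)).det = M.det ^ 2 * N.det := by
  have : (Matrix.of fun i j => bl N (M i) (M j)) = M * N * Mᵀ := by
    ext i j; rw [gram_apply]; rfl
  rw [this, det_mul, det_mul, det_transpose]; ring

theorem det_ne_zero_of_isPD (hN : IsPD N) : N.det ≠ 0 := by
  intro h
  obtain ⟨v, hv, hv0⟩ := Matrix.exists_mulVec_eq_zero_iff.2 h
  have := hN.pos v hv
  rw [bl, hv0, dotProduct_zero] at this
  exact lt_irrefl _ this

theorem finite_bl_le (hN : IsPD N) (T : ℤ) :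
    ∃ M : ℤ, ∀ v : Fin 4 → ℤ, bl N v v ≤ T → ∀ i, -M ≤ v i ∧ v i ≤ M := by
  classical
  have hd := det_ne_zero_of_isPD hN
  set a : Fin 4 → Fin 4 → ℤ := fun i => Pi.single i 1 ᵥ* N.adjugate
  refine ⟨∑ i, bl N (a i) (a i) * |T|, fun v hv i => ?_⟩
  have h1 : bl N (a i) v = N.det * v i := by
    simp only [a, bl]
    rw [dotProduct_mulVec, vecMul_vecMul, adjugate_mul, ← dotProduct_mulVec, smul_mulVec,
      one_mulVec]
    simp
  have h2 := bl_sq_le hN (a i) v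
  have h3 : v i ^ 2 ≤ bl N (a i) (a i) * |T| := by
    have h4 : 1 ≤ N.det ^ 2 := by have := sq_pos_of_ne_zero hd; linarith
    have h5 := bl_self_nonneg hN (a i)
    have h6 : bl N v v ≤ |T| := hv.trans (le_abs_self T)
    rw [h1] at h2
    calc v i ^ 2 ≤ N.det ^ 2 * v i ^ 2 := by nlinarith [sq_nonneg (v i)]
      _ ≤ bl N (a i) (a i) * bl N v v := by rw [← mul_pow]; exact h2
      _ ≤ _ := mul_le_mul_of_nonneg_left h6 h5
  have h7 : bl N (a i) (a i) * |T| ≤ ∑ i, bl N (a i) (a i) * |T| :=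
    Finset.single_le_sum (f := fun i => bl N (a i) (a i) * |T|)
      (fun i _ => mul_nonneg (bl_self_nonneg hN _) (abs_nonneg _)) (Finset.mem_univ i)
  have h8 : |v i| ≤ v i ^ 2 := by
    rw [← sq_abs]
    rcases (abs_nonneg (v i)).eq_or_lt with h | h
    · rw [← h]; norm_num
    · nlinarith
  exact abs_le.1 (h8.trans (h3.trans h7))

/-- The orthogonal group of a positive definite matrix is finite. -/
theorem finite_orthogonal (hN : IsPD N) :
    {g : Matrix (Fin 4) (Fin 4) ℤ | g * N * gᵀ = N}.Finite := by
  obtain ⟨M, hM⟩ := finite_bl_le hN (∑ i, |N i i|)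
  refine (Set.finite_Icc (α := Fin 4 → Fin 4 → ℤ) (fun _ _ => -M) (fun _ _ => M)).subset ?_
  intro (g : Matrix (Fin 4) (Fin 4) ℤ) (hg : g * N * gᵀ = N)
  have h : ∀ i, bl N (g i) (g i) ≤ ∑ i, |N i i| := by
    intro i
    have e := gram_apply N g i i
    rw [hg] at e
    rw [← e]
    exact (le_abs_self _).trans
      (Finset.single_le_sum (f := fun i => |N i i|) (fun _ _ => abs_nonneg _) (Finset.mem_univ i))
  exact ⟨fun i j => (hM _ (h i) j).1, fun i j => (hM _ (h i) j).2⟩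

theorem finite_orthogonal_bound (hN : IsPD N) : ∃ m : ℕ,
    ∀ F : Finset (Matrix (Fin 4) (Fin 4) ℤ), (∀ g ∈ F, g * N * gᵀ = N) → F.card ≤ m := by
  refine ⟨(finite_orthogonal hN).toFinset.card, fun F hF => Finset.card_le_card fun g hg => ?_⟩
  exact (finite_orthogonal hN).mem_toFinset.2 (hF g hg)

/-- The determinant of the Gram matrix of three vectors. -/
def gram3 (N : Matrix (Fin 4) (Fin 4) ℤ) (u v w : Fin 4 → ℤ) : ℤ :=
  bl N u u * bl N v v * bl N w w + 2 * bl N u v * bl N u w * bl N v w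
    - bl N u u * bl N v w ^ 2 - bl N v v * bl N u w ^ 2 - bl N w w * bl N u v ^ 2

theorem gram3_ne_zero (hN : IsPD N) (u v w : Fin 4 → ℤ)
    (h : ∀ a b c : ℤ, a • u + b • v + c • w = 0 → a = 0 ∧ b = 0 ∧ c = 0) :
    gram3 N u v w ≠ 0 := by
  intro h0
  set G : Matrix (Fin 3) (Fin 3) ℤ := Matrix.of fun i j => bl N (![u, v, w] i) (![u, v, w] j)
  have hdet : G.det = 0 := by
    rw [← h0, Matrix.det_fin_three, gram3]
    simp only [G, of_apply, cons_val, bl_comm hN v u, bl_comm hN w u, bl_comm hN w v]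
    ring
  obtain ⟨x, hx, hx0⟩ := Matrix.exists_mulVec_eq_zero_iff.2 hdet
  have e : ∀ i, bl N (![u, v, w] i) (x 0 • u + x 1 • v + x 2 • w) = 0 := by
    intro i
    have := congrFun hx0 i
    simp only [mulVec, dotProduct, Fin.sum_univ_three, G, of_apply, cons_val, Pi.zero_apply] at this
    simp only [bl_add_right, bl_smul_right]
    linarith
  have e1 : bl N (x 0 • u + x 1 • v + x 2 • w) (x 0 • u + x 1 • v + x 2 • w) = 0 := by
    have f0 := e 0
    have f1 := e 1
    have f2 := e 2
    simp only [cons_val] at f0 f1 f2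
    rw [bl_add_left, bl_add_left, bl_smul_left, bl_smul_left, bl_smul_left, f0, f1, f2]
    ring
  obtain ⟨h1, h2, h3⟩ := h _ _ _ (eq_zero_of_bl_self hN e1)
  apply hx
  ext i
  fin_cases i
  · exact h1
  · exact h2
  · exact h3

theorem indep_of_det_ne_zero (u v w y : Fin 4 → ℤ) (h : (Matrix.of ![u, v, w, y]).det ≠ 0)
    (a b c d : ℤ) (h0 : a • u + b • v + c • w + d • y = 0) : a = 0 ∧ b = 0 ∧ c = 0 ∧ d = 0 := by
  have : ![a, b, c, d] = 0 := by
    refine Matrix.eq_zero_of_vecMul_eq_zero h ?_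
    ext i
    have := congrFun h0 i
    simpa [vecMul, dotProduct, Fin.sum_univ_four] using this
  have h1 := fun i => congrFun this i
  exact ⟨h1 0, h1 1, h1 2, h1 3⟩

end bl

theorem det_bordered (a b c e f g h₀ h₁ h₂ s : ℤ) :
    (Matrix.of ![![a, e, f, h₀], ![e, b, g, h₁], ![f, g, c, h₂], ![h₀, h₁, h₂, s]]).det =
      s * (a * b * c + 2 * e * f * g - a * g ^ 2 - b * f ^ 2 - c * e ^ 2) -
      (h₀ * ((b * c - g ^ 2) * h₀ + (f * g - c * e) * h₁ + (e * g - b * f) * h₂) +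
       h₁ * ((f * g - c * e) * h₀ + (a * c - f ^ 2) * h₁ + (e * f - a * g) * h₂) +
       h₂ * ((e * g - b * f) * h₀ + (e * f - a * g) * h₁ + (a * b - e ^ 2) * h₂)) := by
  rw [Matrix.det_succ_row_zero]
  simp [Fin.sum_univ_succ, Matrix.det_fin_three, Fin.succAbove]
  ring

theorem gram_of_vec {N : Matrix (Fin 4) (Fin 4) ℤ} (hN : IsPD N) (u v w y : Fin 4 → ℤ) :
    (Matrix.of fun i j => bl N ((Matrix.of ![u, v, w, y]) i) ((Matrix.of ![u, v, w, y]) j)) =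
      Matrix.of ![![bl N u u, bl N u v, bl N u w, bl N u y],
        ![bl N u v, bl N v v, bl N v w, bl N v y], ![bl N u w, bl N v w, bl N w w, bl N w y],
        ![bl N u y, bl N v y, bl N w y, bl N y y]] := by
  ext i j
  fin_cases i <;> fin_cases j <;> first | rfl | exact bl_comm hN _ _

/-- The number of positively oriented triples with prescribed non-degenerate Gram matrix which can
be completed to a basis of the lattice. -/
theorem card_triples_le {N : Matrix (Fin 4) (Fin 4) ℤ} (hN : IsPD N) (m : ℕ)
    (hm : ∀ F : Finset (Matrix (Fin 4) (Fin 4) ℤ), (∀ g ∈ F, g * N * gᵀ = N) → F.card ≤ m)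
    (a b c e f g : ℤ) (F : Finset (Fin 3 → Fin 4 → ℤ))
    (hext : ∀ r ∈ F, ∃ y, (Matrix.of ![r 0, r 1, r 2, y]).det = 1)
    (hd : a * b * c + 2 * e * f * g - a * g ^ 2 - b * f ^ 2 - c * e ^ 2 ≠ 0)
    (ha : ∀ r ∈ F, bl N (r 0) (r 0) = a) (hb : ∀ r ∈ F, bl N (r 1) (r 1) = b)
    (hc : ∀ r ∈ F, bl N (r 2) (r 2) = c) (he : ∀ r ∈ F, bl N (r 0) (r 1) = e)
    (hf : ∀ r ∈ F, bl N (r 0) (r 2) = f) (hg : ∀ r ∈ F, bl N (r 1) (r 2) = g) :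
    F.card ≤ (a * b * c + 2 * e * f * g - a * g ^ 2 - b * f ^ 2 - c * e ^ 2).natAbs.divisors.card *
      (4 * (N.det.natAbs ^ 2)) * (N.det.natAbs ^ 3 * m) := by
  classical
  have hΔ := det_ne_zero_of_isPD hN
  obtain ⟨Δ, hΔdef⟩ : ∃ Δ, Δ = N.det := ⟨_, rfl⟩
  obtain ⟨d, hdd⟩ : ∃ d, d = a * b * c + 2 * e * f * g - a * g ^ 2 - b * f ^ 2 - c * e ^ 2 :=
    ⟨_, rfl⟩
  rw [← hdd] at hd ⊢
  rw [← hΔdef] at hΔ ⊢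
  choose! y hy using hext
  rcases F.eq_empty_or_nonempty with rfl | ⟨r', hr'⟩
  · simp
  obtain ⟨h, hh⟩ : ∃ h : (Fin 3 → Fin 4 → ℤ) → Fin 3 → ℤ, h = fun r i => bl N (r i) (y r) :=
    ⟨_, rfl⟩
  obtain ⟨n, hn⟩ : ∃ n : (Fin 3 → Fin 4 → ℤ) → Fin 3 → ℤ, n = fun r =>
    ![(b * c - g ^ 2) * h r 0 + (f * g - c * e) * h r 1 + (e * g - b * f) * h r 2,
      (f * g - c * e) * h r 0 + (a * c - f ^ 2) * h r 1 + (e * f - a * g) * h r 2,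
      (e * g - b * f) * h r 0 + (e * f - a * g) * h r 1 + (a * b - e ^ 2) * h r 2] := ⟨_, rfl⟩
  have hn0 : ∀ r, n r 0 = (b * c - g ^ 2) * h r 0 + (f * g - c * e) * h r 1 +
    (e * g - b * f) * h r 2 := fun r => by rw [hn]; rfl
  have hn1 : ∀ r, n r 1 = (f * g - c * e) * h r 0 + (a * c - f ^ 2) * h r 1 +
    (e * f - a * g) * h r 2 := fun r => by rw [hn]; rfl
  have hn2 : ∀ r, n r 2 = (e * g - b * f) * h r 0 + (e * f - a * g) * h r 1 +
    (a * b - e ^ 2) * h r 2 := fun r => by rw [hn]; rfl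
  have hgram : ∀ r ∈ F, (Matrix.of fun i j =>
      bl N ((Matrix.of ![r 0, r 1, r 2, y r]) i) ((Matrix.of ![r 0, r 1, r 2, y r]) j)) =
      Matrix.of ![![a, e, f, h r 0], ![e, b, g, h r 1], ![f, g, c, h r 2],
        ![h r 0, h r 1, h r 2, bl N (y r) (y r)]] := by
    intro r hr
    rw [gram_of_vec hN, ha r hr, hb r hr, hc r hr, he r hr, hf r hr, hg r hr, hh]
  have hdet : ∀ r ∈ F, bl N (y r) (y r) * d - (h r 0 * n r 0 + h r 1 * n r 1 + h r 2 * n r 2) =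
      Δ := by
    intro r hr
    have h1 := gram_det (N := N) (Matrix.of ![r 0, r 1, r 2, y r])
    rw [hgram r hr, hy r hr, det_bordered, ← hΔdef] at h1
    rw [hn0, hn1, hn2, hdd]
    linarith
  obtain ⟨lam, hlam⟩ : ∃ lam : (Fin 3 → Fin 4 → ℤ) → ℤ,
    lam = fun r => h r' 0 * n r 0 + h r' 1 * n r 1 + h r' 2 * n r 2 := ⟨_, rfl⟩
  have hlam2 : ∀ r ∈ F, d ∣ lam r ^ 2 - Δ ^ 2 := by
    intro r hr
    obtain ⟨s, hs⟩ : ∃ s, s = bl N (y r) (y r) := ⟨_, rfl⟩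
    obtain ⟨s', hs'⟩ : ∃ s, s = bl N (y r') (y r') := ⟨_, rfl⟩
    have e1 := hdet r hr
    have e2 := hdet r' hr'
    rw [← hs] at e1
    rw [← hs'] at e2
    obtain ⟨k0, hk0⟩ : ∃ k, k = h r 1 * h r' 2 - h r 2 * h r' 1 := ⟨_, rfl⟩
    obtain ⟨k1, hk1⟩ : ∃ k, k = h r 2 * h r' 0 - h r 0 * h r' 2 := ⟨_, rfl⟩
    obtain ⟨k2, hk2⟩ : ∃ k, k = h r 0 * h r' 1 - h r 1 * h r' 0 := ⟨_, rfl⟩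
    have e3 : (h r 0 * n r 0 + h r 1 * n r 1 + h r 2 * n r 2) *
        (h r' 0 * n r' 0 + h r' 1 * n r' 1 + h r' 2 * n r' 2) - lam r ^ 2 =
        d * (a * k0 ^ 2 + b * k1 ^ 2 + c * k2 ^ 2 + 2 * e * k0 * k1 + 2 * f * k0 * k2 +
          2 * g * k1 * k2) := by
      rw [hlam, hdd, hk0, hk1, hk2]
      simp only [hn0, hn1, hn2]
      ring
    have e4 : h r 0 * n r 0 + h r 1 * n r 1 + h r 2 * n r 2 = s * d - Δ := by linarith
    have e5 : h r' 0 * n r' 0 + h r' 1 * n r' 1 + h r' 2 * n r' 2 = s' * d - Δ := by linarith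
    rw [e4, e5] at e3
    refine ⟨s * s' * d - Δ * s - Δ * s' - (a * k0 ^ 2 + b * k1 ^ 2 + c * k2 ^ 2 +
      2 * e * k0 * k1 + 2 * f * k0 * k2 + 2 * g * k1 * k2), ?_⟩
    linear_combination -e3
  have hcross : ∀ r ∈ F, ∀ i, d ∣ Δ * n r i + lam r * n r' i := by
    intro r hr i
    obtain ⟨s', hs'⟩ : ∃ s, s = bl N (y r') (y r') := ⟨_, rfl⟩
    have e2 := hdet r' hr'
    rw [← hs'] at e2
    have e5 : Δ = s' * d - (h r' 0 * n r' 0 + h r' 1 * n r' 1 + h r' 2 * n r' 2) := by linarith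
    obtain ⟨k0, hk0⟩ : ∃ k, k = h r 1 * h r' 2 - h r 2 * h r' 1 := ⟨_, rfl⟩
    obtain ⟨k1, hk1⟩ : ∃ k, k = h r 2 * h r' 0 - h r 0 * h r' 2 := ⟨_, rfl⟩
    obtain ⟨k2, hk2⟩ : ∃ k, k = h r 0 * h r' 1 - h r 1 * h r' 0 := ⟨_, rfl⟩
    fin_cases i
    · refine ⟨s' * n r 0 - (h r' 1 * (f * k0 + g * k1 + c * k2) -
        h r' 2 * (e * k0 + b * k1 + g * k2)), ?_⟩
      simp only [Fin.zero_eta]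
      rw [e5, hlam, hk0, hk1, hk2, hdd]
      simp only [hn0, hn1, hn2]
      ring
    · refine ⟨s' * n r 1 - (h r' 2 * (a * k0 + e * k1 + f * k2) -
        h r' 0 * (f * k0 + g * k1 + c * k2)), ?_⟩
      simp only [Fin.mk_one]
      rw [e5, hlam, hk0, hk1, hk2, hdd]
      simp only [hn0, hn1, hn2]
      ring
    · refine ⟨s' * n r 2 - (h r' 0 * (e * k0 + b * k1 + g * k2) -
        h r' 1 * (a * k0 + e * k1 + f * k2)), ?_⟩
      simp only [Fin.reduceFinMk]
      rw [e5, hlam, hk0, hk1, hk2, hdd]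
      simp only [hn0, hn1, hn2]
      ring
  set K : Finset ℕ := F.image fun r => (lam r % d).toNat with hK
  have hcast : ∀ r, (((lam r % d).toNat : ℕ) : ℤ) = lam r % d := fun r =>
    Int.toNat_of_nonneg (Int.emod_nonneg _ hd)
  have hKcard : K.card ≤ d.natAbs.divisors.card * (4 * Δ.natAbs ^ 2) := by
    refine card_sqrt_mod_le _ (Int.natAbs_pos.2 hd) _ (pow_pos (Int.natAbs_pos.2 hΔ) 2) _ ?_ ?_
    · intro x hx
      obtain ⟨r, hr, rfl⟩ := Finset.mem_image.1 hx
      have h1 := Int.emod_lt_abs (lam r) hd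
      have h2 := hcast r
      have h3 := Int.natCast_natAbs d
      omega
    · intro x hx
      obtain ⟨r, hr, rfl⟩ := Finset.mem_image.1 hx
      rw [hcast, Int.natAbs_dvd]
      push_cast
      rw [sq_abs]
      have e1 : lam r % d ≡ lam r [ZMOD d] := Int.mod_modEq _ _
      exact ((e1.pow 2).sub_right _).dvd_iff.2 (hlam2 r hr)
  refine (card_le_of_cover F K (fun r x => (lam r % d).toNat = x) (Δ.natAbs ^ 3 * m)
      (fun r hr => ⟨_, Finset.mem_image_of_mem _ hr, rfl⟩) ?_).trans
      (Nat.mul_le_mul_right _ hKcard)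
  intro k _ G hGF hG
  rcases G.eq_empty_or_nonempty with rfl | ⟨r₁, hr₁⟩
  · simp
  have hdvd : ∀ r ∈ G, ∀ i, d ∣ Δ * (n r i - n r₁ i) := by
    intro r hr i
    have e1 : d ∣ lam r - lam r₁ := by
      have := (hG r hr).trans (hG r₁ hr₁).symm
      have e2 : lam r % d = lam r₁ % d := by rw [← hcast r, ← hcast r₁, this]
      exact Int.ModEq.dvd (Int.ModEq.symm e2)
    have e3 := dvd_sub (dvd_sub (hcross r (hGF hr) i) (hcross r₁ (hGF hr₁) i))
      (e1.mul_right (n r' i))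
    exact int_dvd_of_eq e3 (by ring)
  choose! w hw using hdvd
  have hcard2 : ((Finset.range Δ.natAbs ×ˢ Finset.range Δ.natAbs) ×ˢ
      Finset.range Δ.natAbs).card = Δ.natAbs ^ 3 := by
    simp; ring
  rw [← hcard2]
  refine card_le_of_cover G _ (fun r x => (w r 0 % Δ = x.1.1 ∧ w r 1 % Δ = x.1.2) ∧
    w r 2 % Δ = x.2) m ?_ ?_
  · intro r hr
    have q : ∀ z : ℤ, (z % Δ).toNat < Δ.natAbs ∧ z % Δ = ((z % Δ).toNat : ℕ) := by
      intro z
      have h1 := Int.emod_lt_abs z hΔ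
      have h2 := Int.emod_nonneg z hΔ
      have h3 := Int.natCast_natAbs Δ
      omega
    refine ⟨(((w r 0 % Δ).toNat, (w r 1 % Δ).toNat), (w r 2 % Δ).toNat), ?_,
      ⟨(q _).2, (q _).2⟩, (q _).2⟩
    simp only [Finset.mem_product, Finset.mem_range]
    exact ⟨⟨(q _).1, (q _).1⟩, (q _).1⟩
  intro κ _ G' hGG' hG'
  rcases G'.eq_empty_or_nonempty with rfl | ⟨r₂, hr₂⟩
  · simp
  have hr₂F := hGF (hGG' hr₂)
  have hcongr : ∀ r ∈ G', ∀ i, ∃ t, n r i - n r₂ i = d * t := by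
    intro r hr i
    have e1 : w r i % Δ = w r₂ i % Δ := by
      obtain ⟨⟨a1, a2⟩, a3⟩ := hG' r hr
      obtain ⟨⟨b1, b2⟩, b3⟩ := hG' r₂ hr₂
      fin_cases i
      · exact a1.trans b1.symm
      · exact a2.trans b2.symm
      · exact a3.trans b3.symm
    obtain ⟨t, ht⟩ : Δ ∣ w r i - w r₂ i := Int.ModEq.dvd (Int.ModEq.symm e1)
    refine ⟨t, mul_left_cancel₀ hΔ ?_⟩
    have e2 := hw r (hGG' hr) i
    have e3 := hw r₂ (hGG' hr₂) i
    linear_combination e2 - e3 + d * ht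
  choose! t ht using hcongr
  set M₂ := Matrix.of ![r₂ 0, r₂ 1, r₂ 2, y r₂] with hM₂
  have hM₂u : IsUnit M₂.det := by rw [hy r₂ hr₂F]; exact isUnit_one
  have hmap : ∀ r ∈ G', ∃ o : Matrix (Fin 4) (Fin 4) ℤ, o * N * oᵀ = N ∧ ∀ i, r i = r₂ i ᵥ* o := by
    intro r hr
    have hrF := hGF (hGG' hr)
    obtain ⟨y', hy'⟩ : ∃ y', y' = y r - (t r 0 • r 0 + t r 1 • r 1 + t r 2 • r 2) := ⟨_, rfl⟩
    have q1 := ha r hrF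
    have q2 := hb r hrF
    have q3 := hc r hrF
    have q4 := he r hrF
    have q5 := hf r hrF
    have q6 := hg r hrF
    have p0 := ht r hr 0
    have p1 := ht r hr 1
    have p2 := ht r hr 2
    rw [hn0, hn0] at p0
    rw [hn1, hn1] at p1
    rw [hn2, hn2] at p2
    have g0 : h r 0 - h r₂ 0 = a * t r 0 + e * t r 1 + f * t r 2 := by
      refine mul_left_cancel₀ hd ?_
      linear_combination (h r 0 - h r₂ 0) * hdd + a * p0 + e * p1 + f * p2
    have g1 : h r 1 - h r₂ 1 = e * t r 0 + b * t r 1 + g * t r 2 := by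
      refine mul_left_cancel₀ hd ?_
      linear_combination (h r 1 - h r₂ 1) * hdd + e * p0 + b * p1 + g * p2
    have g2 : h r 2 - h r₂ 2 = f * t r 0 + g * t r 1 + c * t r 2 := by
      refine mul_left_cancel₀ hd ?_
      linear_combination (h r 2 - h r₂ 2) * hdd + f * p0 + g * p1 + c * p2
    have b0 : bl N (r 0) y' = h r₂ 0 := by
      have : bl N (r 0) (y r) = h r 0 := by rw [hh]
      simp only [hy', bl_sub_right, bl_add_right, bl_smul_right, q1, q4, q5, this]
      linarith
    have b1 : bl N (r 1) y' = h r₂ 1 := by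
      have : bl N (r 1) (y r) = h r 1 := by rw [hh]
      simp only [hy', bl_sub_right, bl_add_right, bl_smul_right, q2, q6, this,
        bl_comm hN (r 1) (r 0), q4]
      linarith
    have b2 : bl N (r 2) y' = h r₂ 2 := by
      have : bl N (r 2) (y r) = h r 2 := by rw [hh]
      simp only [hy', bl_sub_right, bl_add_right, bl_smul_right, q3, this,
        bl_comm hN (r 2) (r 0), bl_comm hN (r 2) (r 1), q5, q6]
      linarith
    set M' := Matrix.of ![r 0, r 1, r 2, y'] with hM'
    have hdetM' : M'.det = 1 := by
      rw [← hy r hrF]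
      have : M' = (Matrix.of ![r 0, r 1, r 2, y r]).updateRow 3
          ((Matrix.of ![r 0, r 1, r 2, y r]) 3 +
            ∑ j : Fin 4, (![-t r 0, -t r 1, -t r 2, 0] j) • (Matrix.of ![r 0, r 1, r 2, y r]) j) := by
        ext i j
        fin_cases i <;> simp [hM', hy', Fin.sum_univ_four, Matrix.updateRow_apply]
        ring
      rw [this, Matrix.det_updateRow_add, Matrix.updateRow_eq_self, Matrix.det_updateRow_sum]
      simp
    have hgr : (Matrix.of fun i j => bl N (M' i) (M' j)) =
        Matrix.of ![![a, e, f, h r₂ 0], ![e, b, g, h r₂ 1], ![f, g, c, h r₂ 2],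
          ![h r₂ 0, h r₂ 1, h r₂ 2, bl N y' y']] := by
      rw [hM', gram_of_vec hN, q1, q2, q3, q4, q5, q6, b0, b1, b2]
    have hs : bl N y' y' = bl N (y r₂) (y r₂) := by
      have h1 := gram_det (N := N) M'
      have h2 := hdet r₂ hr₂F
      rw [hgr, hdetM', det_bordered, ← hΔdef] at h1
      rw [hn0, hn1, hn2] at h2
      refine mul_right_cancel₀ hd ?_
      linear_combination h1 - h2 + bl N y' y' * hdd
    have hMM : M' * N * M'ᵀ = M₂ * N * M₂ᵀ := by
      have e1 : M' * N * M'ᵀ = Matrix.of fun i j => bl N (M' i) (M' j) := by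
        ext i j; rw [gram_apply]; rfl
      have e2 : M₂ * N * M₂ᵀ = Matrix.of fun i j => bl N (M₂ i) (M₂ j) := by
        ext i j; rw [gram_apply]; rfl
      rw [e1, e2, hgr, hs, ← hgram r₂ hr₂F]
    refine ⟨M₂⁻¹ * M', ?_, ?_⟩
    · calc M₂⁻¹ * M' * N * (M₂⁻¹ * M')ᵀ = M₂⁻¹ * (M' * N * M'ᵀ) * (M₂⁻¹)ᵀ := by
            rw [transpose_mul]; simp only [Matrix.mul_assoc]
        _ = (M₂⁻¹ * M₂) * N * (M₂⁻¹ * M₂)ᵀ := by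
            rw [hMM, transpose_mul]; simp only [Matrix.mul_assoc]
        _ = N := by rw [Matrix.nonsing_inv_mul _ hM₂u]; simp
    · have e1 : M₂ * (M₂⁻¹ * M') = M' := by
        rw [← Matrix.mul_assoc, Matrix.mul_nonsing_inv _ hM₂u, Matrix.one_mul]
      have e2 : ∀ i, M' i = M₂ i ᵥ* (M₂⁻¹ * M') := by
        intro i
        conv_lhs => rw [← e1]
        rfl
      intro i
      fin_cases i
      · exact e2 0
      · exact e2 1
      · exact e2 2
  choose! o ho1 ho2 using hmap
  rw [← Finset.card_image_of_injOn (f := o) (s := G') ?_]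
  · refine hm _ fun x hx => ?_
    obtain ⟨r, hr, rfl⟩ := Finset.mem_image.1 hx
    exact ho1 r hr
  · intro r hr s hs hrs
    funext i
    rw [ho2 r hr, ho2 s hs, hrs]

/-- Two pairs of vectors `P 0, P 1` and `P 2, P 3` both having the Gram matrix of
`⟨A, B, C⟩`. -/
structure IsRepPair (N : Matrix (Fin 4) (Fin 4) ℤ) (A B C : ℤ) (P : Fin 4 → Fin 4 → ℤ) : Prop where
  h00 : bl N (P 0) (P 0) = 2 * A
  h01 : bl N (P 0) (P 1) = B
  h11 : bl N (P 1) (P 1) = 2 * C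
  h22 : bl N (P 2) (P 2) = 2 * A
  h23 : bl N (P 2) (P 3) = B
  h33 : bl N (P 3) (P 3) = 2 * C

theorem abs_gram3_le {N : Matrix (Fin 4) (Fin 4) ℤ} (hN : IsPD N) (u v w : Fin 4 → ℤ) :
    |gram3 N u v w| ≤ 4 * (bl N u u * bl N v v * bl N w w) := by
  have h1 := bl_sq_le hN u v
  have h2 := bl_sq_le hN u w
  have h3 := bl_sq_le hN v w
  have a0 := bl_self_nonneg hN u
  have b0 := bl_self_nonneg hN v
  have c0 := bl_self_nonneg hN w
  rw [gram3]
  set a := bl N u u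
  set b := bl N v v
  set c := bl N w w
  set e := bl N u v
  set f := bl N u w
  set g := bl N v w
  have p1 : a * g ^ 2 ≤ a * (b * c) := mul_le_mul_of_nonneg_left h3 a0
  have p2 : b * f ^ 2 ≤ b * (a * c) := mul_le_mul_of_nonneg_left h2 b0
  have p3 : c * e ^ 2 ≤ c * (a * b) := mul_le_mul_of_nonneg_left h1 c0
  have p4 : |e * f * g| ≤ a * b * c := by
    refine abs_le_of_sq_le_sq ?_ (by positivity)
    calc (e * f * g) ^ 2 = e ^ 2 * f ^ 2 * g ^ 2 := by ring
      _ ≤ (a * b) * (a * c) * (b * c) := by gcongr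
      _ = (a * b * c) ^ 2 := by ring
  have p5 := abs_le.1 p4
  have q1 : 0 ≤ a * g ^ 2 := by positivity
  have q2 : 0 ≤ b * f ^ 2 := by positivity
  have q3 : 0 ≤ c * e ^ 2 := by positivity
  rw [abs_le]
  constructor <;> nlinarith

theorem gram3_add_smul {N : Matrix (Fin 4) (Fin 4) ℤ} (hN : IsPD N) (u v z : Fin 4 → ℤ)
    (a b c : ℤ) : gram3 N u v (a • u + b • v + c • z) = c ^ 2 * gram3 N u v z := by
  simp only [gram3, bl_add_left, bl_add_right, bl_smul_left, bl_smul_right, bl_comm hN v u,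
    bl_comm hN z u, bl_comm hN z v]
  ring

theorem det_of_updates (v₁ v₂ w₁ w₂ w₁' w₂' : Fin 4 → ℤ) (i j : ℤ)
    (h : i • w₁ + j • w₂ = i • w₁' + j • w₂')
    (hdet : (Matrix.of ![v₁, v₂, w₁, w₂]).det = (Matrix.of ![v₁, v₂, w₁', w₂']).det) :
    (Matrix.of ![v₁, v₂, i • w₁ + j • w₂, w₁ - w₁']).det = 0 := by
  have key : ∀ x y : Fin 4 → ℤ, (Matrix.of ![v₁, v₂, i • x + j • y, x]).det =
      - j * (Matrix.of ![v₁, v₂, x, y]).det := by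
    intro x y
    rw [Matrix.det_succ_row_zero, Matrix.det_succ_row_zero]
    simp [Fin.sum_univ_succ, Matrix.det_fin_three, Fin.succAbove]
    ring
  have sub : ∀ w x y : Fin 4 → ℤ, (Matrix.of ![v₁, v₂, w, x - y]).det =
      (Matrix.of ![v₁, v₂, w, x]).det - (Matrix.of ![v₁, v₂, w, y]).det := by
    intro w x y
    rw [Matrix.det_succ_row_zero, Matrix.det_succ_row_zero, Matrix.det_succ_row_zero]
    simp [Fin.sum_univ_succ, Matrix.det_fin_three, Fin.succAbove]
    ring
  rw [sub, key, h, key, hdet, sub_self]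

/-- Number of pairs of representations with given mutual inner products and determinant. -/
theorem card_fibre_le {N : Matrix (Fin 4) (Fin 4) ℤ} (hN : IsPD N)
    (heven : ∀ v, (2 : ℤ) ∣ bl N v v) (m : ℕ)
    (hm : ∀ F : Finset (Matrix (Fin 4) (Fin 4) ℤ), (∀ g ∈ F, g * N * gᵀ = N) → F.card ≤ m)
    (A B C : ℤ) (hA : 0 < A) (hBA : |B| ≤ A) (hAC : A ≤ C)
    (hprim : Int.gcd (Int.gcd A B) C = 1) (f h t : ℕ) (hf : 0 < f)
    (hfE : (f : ℤ) * f ∣ 4 * A * C - B ^ 2)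
    (hfmax : ∀ s : ℕ, (s : ℤ) * s ∣ 4 * A * C - B ^ 2 → s ∣ f)
    (ht : ∀ n : ℕ, 0 < n → (n : ℤ) ≤ 384 * (4 * A * C - B ^ 2) ^ 5 → n.divisors.card ≤ t)
    (Y₁ Y₂ Y₃ Y₄ x₀ : ℤ) (F : Finset (Fin 4 → Fin 4 → ℤ))
    (hP : ∀ P ∈ F, IsRepPair N A B C P)
    (h1 : ∀ P ∈ F, bl N (P 0) (P 2) = Y₁) (h2 : ∀ P ∈ F, bl N (P 0) (P 3) = Y₂)
    (h3 : ∀ P ∈ F, bl N (P 1) (P 2) = Y₃) (h4 : ∀ P ∈ F, bl N (P 1) (P 3) = Y₄)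
    (h0 : ∀ P ∈ F, (Matrix.of ![P 0, P 1, P 2, P 3]).det = x₀)
    (hex : ∀ P ∈ F, ∃ i j c : ℕ, ∃ α₁ α₂ : ℤ, ∃ z y : Fin 4 → ℤ, i ∣ 2 * f ∧ j ∣ 2 * f ∧ 0 < c ∧
      Nat.gcd c f = h ∧ 0 ≤ α₁ ∧ α₁ < c ∧ 0 ≤ α₂ ∧ α₂ < c ∧
      (i : ℤ) • P 2 + (j : ℤ) • P 3 = α₁ • P 0 + α₂ • P 1 + (c : ℤ) • z ∧
      (Matrix.of ![P 0, P 1, z, y]).det = 1) :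
    F.card ≤ t ^ 5 * h * (16 * N.det.natAbs ^ 5 * m) := by
  classical
  obtain ⟨E, hEdef⟩ : ∃ E, E = 4 * A * C - B ^ 2 := ⟨_, rfl⟩
  have hB2 : B ^ 2 ≤ A ^ 2 := sq_le_sq' (by linarith [(abs_le.1 hBA).1]) (abs_le.1 hBA).2
  have hEAC : 3 * (A * C) ≤ E := by nlinarith
  have hAE : A ≤ E := by nlinarith
  have hCE : C ≤ E := by nlinarith
  have hE0 : 0 < E := by linarith
  have hE5 : E ≤ E ^ 5 := le_self_pow₀ (by linarith) (by norm_num)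
  rw [← hEdef] at hfE hfmax ht
  have hf2E : ((f : ℤ)) ≤ E := by
    have e1 := Int.le_of_dvd hE0 hfE
    have : (1 : ℤ) ≤ f := by exact_mod_cast hf
    nlinarith
  have ht2f : (2 * f).divisors.card ≤ t := by
    refine ht _ (by omega) ?_
    push_cast; linarith
  have htE : E.toNat.divisors.card ≤ t := by
    refine ht _ (by omega) ?_
    rw [Int.toNat_of_nonneg hE0.le]; linarith
  have hkey : F.card ≤ ((2 * f).divisors ×ˢ (2 * f).divisors).card *
      (t * (t * h * 4 * (t * (4 * (N.det.natAbs ^ 2)) * (N.det.natAbs ^ 3 * m)))) := by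
    refine card_le_of_cover F _ (fun P k => ∃ c : ℕ, ∃ α₁ α₂ : ℤ, ∃ z y : Fin 4 → ℤ, 0 < c ∧
      Nat.gcd c f = h ∧ 0 ≤ α₁ ∧ α₁ < c ∧ 0 ≤ α₂ ∧ α₂ < c ∧
      (k.1 : ℤ) • P 2 + (k.2 : ℤ) • P 3 = α₁ • P 0 + α₂ • P 1 + (c : ℤ) • z ∧
      (Matrix.of ![P 0, P 1, z, y]).det = 1) _ ?_ ?_
    · intro P hPF
      obtain ⟨i, j, c, α₁, α₂, z, y, hi, hj, hrest⟩ := hex P hPF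
      refine ⟨(i, j), ?_, c, α₁, α₂, z, y, hrest⟩
      simp only [Finset.mem_product, Nat.mem_divisors]
      exact ⟨⟨hi, by omega⟩, ⟨hj, by omega⟩⟩
    rintro ⟨i, j⟩ hij G hGF hG
    simp only [Finset.mem_product, Nat.mem_divisors] at hij
    have hi0 : (0 : ℤ) < i := by exact_mod_cast Nat.pos_of_dvd_of_pos hij.1.1 (by omega)
    have hj0 : (0 : ℤ) < j := by exact_mod_cast Nat.pos_of_dvd_of_pos hij.2.1 (by omega)
    have hi2 : (i : ℤ) ≤ 2 * E := by
      have : (i : ℤ) ≤ ((2 * f : ℕ) : ℤ) := by exact_mod_cast Nat.le_of_dvd (by omega) hij.1.1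
      push_cast at this; linarith
    have hj2 : (j : ℤ) ≤ 2 * E := by
      have : (j : ℤ) ≤ ((2 * f : ℕ) : ℤ) := by exact_mod_cast Nat.le_of_dvd (by omega) hij.2.1
      push_cast at this; linarith
    simp only at hG
    rcases G.eq_empty_or_nonempty with rfl | ⟨P', hP'⟩
    · simp
    -- inner products with `w = i w₁ + j w₂`
    obtain ⟨w, hw⟩ : ∃ w : (Fin 4 → Fin 4 → ℤ) → Fin 4 → ℤ,
      w = fun P => (i : ℤ) • P 2 + (j : ℤ) • P 3 := ⟨_, rfl⟩
    have hwP : ∀ P, (i : ℤ) • P 2 + (j : ℤ) • P 3 = w P := fun P => by rw [hw]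
    simp only [hwP] at hG
    obtain ⟨ξ₁, hξ₁⟩ : ∃ ξ, ξ = i * Y₁ + j * Y₂ := ⟨_, rfl⟩
    obtain ⟨ξ₂, hξ₂⟩ : ∃ ξ, ξ = i * Y₃ + j * Y₄ := ⟨_, rfl⟩
    obtain ⟨μ, hμ⟩ : ∃ μ, μ = A * i ^ 2 + B * i * j + C * j ^ 2 := ⟨_, rfl⟩
    have k1 : ∀ P ∈ G, bl N (P 0) (w P) = ξ₁ := fun P hPG => by
      simp only [hw, bl_add_right, bl_smul_right]
      rw [h1 P (hGF hPG), h2 P (hGF hPG), hξ₁]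
    have k2 : ∀ P ∈ G, bl N (P 1) (w P) = ξ₂ := fun P hPG => by
      simp only [hw, bl_add_right, bl_smul_right]
      rw [h3 P (hGF hPG), h4 P (hGF hPG), hξ₂]
    have k3 : ∀ P ∈ G, bl N (w P) (w P) = 2 * μ := fun P hPG => by
      have q := hP P (hGF hPG)
      simp only [hw, bl_add_right, bl_smul_right, bl_add_left, bl_smul_left,
        bl_comm hN (P 3) (P 2), q.h22, q.h23, q.h33]
      rw [hμ]; ring
    obtain ⟨d₃, hd₃⟩ : ∃ d, d = gram3 N (P' 0) (P' 1) (w P') := ⟨_, rfl⟩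
    have hd₃G : ∀ P ∈ G, gram3 N (P 0) (P 1) (w P) = d₃ := by
      intro P hPG
      have q := hP P (hGF hPG)
      have q' := hP P' (hGF hP')
      rw [hd₃, gram3, gram3, k1 P hPG, k2 P hPG, k3 P hPG, k1 P' hP', k2 P' hP', k3 P' hP', q.h00,
        q.h01, q.h11, q'.h00, q'.h01, q'.h11]
    have hz0 : ∀ P : Fin 4 → Fin 4 → ℤ, ∀ z y, (Matrix.of ![P 0, P 1, z, y]).det = 1 →
        gram3 N (P 0) (P 1) z ≠ 0 := by
      intro P z y hdet
      refine gram3_ne_zero hN _ _ _ fun a b c h => ?_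
      have := indep_of_det_ne_zero (P 0) (P 1) z y (by rw [hdet]; exact one_ne_zero) a b c 0
        (by simpa using h)
      exact ⟨this.1, this.2.1, this.2.2.1⟩
    have hd₃c : ∀ P ∈ G, ∀ (c : ℕ) (α₁ α₂ : ℤ) (z : Fin 4 → ℤ),
        w P = α₁ • P 0 + α₂ • P 1 + (c : ℤ) • z → d₃ = (c : ℤ) ^ 2 * gram3 N (P 0) (P 1) z := by
      intro P hPG c α₁ α₂ z hwz
      rw [← hd₃G P hPG, hwz, gram3_add_smul hN]
    have hd₃0 : d₃ ≠ 0 := by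
      obtain ⟨c, α₁, α₂, z, y, hc, -, -, -, -, -, hwz, hdet⟩ := hG P' hP'
      rw [hd₃c P' hP' c α₁ α₂ z hwz]
      exact mul_ne_zero (by positivity) (hz0 P' z y hdet)
    have hd₃le : |d₃| ≤ 384 * E ^ 5 := by
      have q := hP P' (hGF hP')
      have e1 := abs_gram3_le hN (P' 0) (P' 1) (w P')
      rw [← hd₃, q.h00, q.h11, k3 P' hP'] at e1
      have e2 : μ ≤ 12 * E ^ 3 := by
        have c1 : A * (i : ℤ) ^ 2 ≤ E * (2 * E) ^ 2 := by gcongr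
        have c2 : C * (j : ℤ) ^ 2 ≤ E * (2 * E) ^ 2 := by gcongr
        have c3 : B * i * j ≤ E * (2 * E) * (2 * E) := by
          have : B ≤ E := (abs_le.1 hBA).2.trans hAE
          gcongr
        rw [hμ]; nlinarith
      have e3 : 0 ≤ μ := by
        have := bl_self_nonneg hN (w P'); rw [k3 P' hP'] at this; linarith
      calc |d₃| ≤ 4 * (2 * A * (2 * C) * (2 * μ)) := e1
        _ ≤ 4 * (2 * E * (2 * E) * (2 * (12 * E ^ 3))) := by
          have : 0 ≤ C := by linarith
          gcongr
        _ = 384 * E ^ 5 := by ring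
    have htd : ∀ n : ℕ, (n : ℤ) ∣ d₃ → n.divisors.card ≤ t := by
      intro n hn
      have hn' : n ∣ d₃.natAbs := Int.natCast_dvd.1 hn
      have hpos := Int.natAbs_pos.2 hd₃0
      refine ht n (Nat.pos_of_dvd_of_pos hn' hpos) ?_
      have := Nat.le_of_dvd hpos hn'
      have e4 := Int.natCast_natAbs d₃
      omega
    refine (card_le_of_cover G d₃.natAbs.divisors (fun P c => ∃ α₁ α₂ : ℤ, ∃ z y : Fin 4 → ℤ,
      0 < c ∧ Nat.gcd c f = h ∧ 0 ≤ α₁ ∧ α₁ < c ∧ 0 ≤ α₂ ∧ α₂ < c ∧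
      w P = α₁ • P 0 + α₂ • P 1 + (c : ℤ) • z ∧ (Matrix.of ![P 0, P 1, z, y]).det = 1)
      (t * h * 4 * (t * (4 * (N.det.natAbs ^ 2)) * (N.det.natAbs ^ 3 * m))) ?_ ?_).trans
      (Nat.mul_le_mul_right _ (htd _ (Int.natAbs_dvd.2 dvd_rfl)))
    · intro P hPG
      obtain ⟨c, α₁, α₂, z, y, hrest⟩ := hG P hPG
      refine ⟨c, ?_, α₁, α₂, z, y, hrest⟩
      refine Nat.mem_divisors.2 ⟨?_, Int.natAbs_ne_zero.2 hd₃0⟩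
      rw [← Int.natCast_dvd, hd₃c P hPG c α₁ α₂ z hrest.2.2.2.2.2.2.1, pow_two, mul_assoc]
      exact dvd_mul_right _ _
    intro c _ G' hGG' hG'
    rcases G'.eq_empty_or_nonempty with rfl | ⟨P₁, hP₁⟩
    · simp
    obtain ⟨-, -, -, -, hc0, hch, -⟩ := hG' P₁ hP₁
    have hcpos : (0 : ℤ) < c := by exact_mod_cast hc0
    choose! α₁ α₂ z y _ _ ha1 ha2 ha3 ha4 hwz hdet using hG'
    have b1 : ∀ P ∈ G', c * bl N (P 0) (z P) = ξ₁ - (2 * A * α₁ P + B * α₂ P) := by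
      intro P hPG
      have q := hP P (hGF (hGG' hPG))
      rw [← k1 P (hGG' hPG), hwz P hPG]
      simp only [bl_add_right, bl_smul_right, q.h00, q.h01]
      ring
    have b2 : ∀ P ∈ G', c * bl N (P 1) (z P) = ξ₂ - (B * α₁ P + 2 * C * α₂ P) := by
      intro P hPG
      have q := hP P (hGF (hGG' hPG))
      rw [← k2 P (hGG' hPG), hwz P hPG]
      simp only [bl_add_right, bl_smul_right, bl_comm hN (P 1) (P 0), q.h01, q.h11]
      ring
    have b3 : ∀ P ∈ G', (c : ℤ) * c * bl N (z P) (z P) = 2 * (μ - (α₁ P * ξ₁ + α₂ P * ξ₂) +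
        (A * α₁ P ^ 2 + B * α₁ P * α₂ P + C * α₂ P ^ 2)) := by
      intro P hPG
      have q := hP P (hGF (hGG' hPG))
      have e1 := k3 P (hGG' hPG)
      rw [hwz P hPG] at e1
      simp only [bl_add_right, bl_smul_right, bl_add_left, bl_smul_left, bl_comm hN (P 1) (P 0),
        bl_comm hN (z P) _, q.h00, q.h01, q.h11] at e1
      linear_combination e1 - 2 * α₁ P * b1 P hPG - 2 * α₂ P * b2 P hPG
    set K : Finset (ℤ × ℤ) := G'.image fun P => (α₁ P, α₂ P) with hK
    have hKcard : K.card ≤ t * h * 4 := by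
      refine (card_vectors_mod_le A B C hprim (by rw [← hEdef]; exact hE0) c h hc0 ?_ μ ξ₁ ξ₂ K
        ?_ ?_ ?_ ?_).trans ?_
      · intro s hs hsE
        rw [← hEdef] at hsE
        have : s ∣ h := hch ▸ Nat.dvd_gcd hs (hfmax s hsE)
        exact Nat.le_of_dvd (hch ▸ Nat.gcd_pos_of_pos_left _ hc0) this
      · intro a ha
        obtain ⟨P, hPG, rfl⟩ := Finset.mem_image.1 ha
        exact ⟨ha1 P hPG, ha2 P hPG, ha3 P hPG, ha4 P hPG⟩
      · intro a ha
        obtain ⟨P, hPG, rfl⟩ := Finset.mem_image.1 ha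
        exact ⟨_, (b1 P hPG).symm⟩
      · intro a ha
        obtain ⟨P, hPG, rfl⟩ := Finset.mem_image.1 ha
        exact ⟨_, (b2 P hPG).symm⟩
      · intro a ha
        obtain ⟨P, hPG, rfl⟩ := Finset.mem_image.1 ha
        obtain ⟨k, hk⟩ := heven (z P)
        refine ⟨k, ?_⟩
        have := b3 P hPG
        rw [hk] at this
        simp only
        linarith
      · rw [← hEdef]
        exact Nat.mul_le_mul_right _ (Nat.mul_le_mul_right _ htE)
    refine (card_le_of_cover G' K (fun P a => (α₁ P, α₂ P) = a)
      (t * (4 * (N.det.natAbs ^ 2)) * (N.det.natAbs ^ 3 * m))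
      (fun P hPG => ⟨_, Finset.mem_image_of_mem _ hPG, rfl⟩) ?_).trans
      (Nat.mul_le_mul_right _ hKcard)
    rintro ⟨a1, a2⟩ _ H hHG' hH
    rcases H.eq_empty_or_nonempty with rfl | ⟨P₂, hP₂⟩
    · simp
    have hα1 : ∀ P ∈ H, α₁ P = a1 := fun P hPH => (Prod.mk.inj (hH P hPH)).1
    have hα2 : ∀ P ∈ H, α₂ P = a2 := fun P hPH => (Prod.mk.inj (hH P hPH)).2
    have hinj : Set.InjOn (fun P : Fin 4 → Fin 4 → ℤ => ![P 0, P 1, z P]) H := by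
      intro P hPH R hRH hPR
      have e0 : P 0 = R 0 := congrFun hPR 0
      have e1 : P 1 = R 1 := congrFun hPR 1
      have ez : z P = z R := congrFun hPR 2
      have hPF := hGF (hGG' (hHG' hPH))
      have hRF := hGF (hGG' (hHG' hRH))
      have ew : (i : ℤ) • P 2 + (j : ℤ) • P 3 = (i : ℤ) • R 2 + (j : ℤ) • R 3 := by
        rw [hwP, hwP, hwz P (hHG' hPH), hwz R (hHG' hRH), e0, e1, ez, hα1 P hPH, hα1 R hRH,
          hα2 P hPH, hα2 R hRH]
      have hdet0 := det_of_updates (P 0) (P 1) (P 2) (P 3) (R 2) (R 3) i j ew (by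
        rw [h0 P hPF, e0, e1, h0 R hRF])
      have qP := hP P hPF
      have qR := hP R hRF
      have o1 : bl N (P 2 - R 2) (P 0) = 0 := by
        rw [bl_comm hN, bl_sub_right, h1 P hPF, e0, h1 R hRF, sub_self]
      have o2 : bl N (P 2 - R 2) (P 1) = 0 := by
        rw [bl_comm hN, bl_sub_right, h3 P hPF, e1, h3 R hRF, sub_self]
      have o3 : bl N (P 2 - R 2) ((i : ℤ) • P 2 + (j : ℤ) • P 3) = 0 := by
        rw [bl_sub_left]
        conv_lhs => rw [ew]
        conv_lhs => enter [1]; rw [← ew]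
        simp only [bl_add_right, bl_smul_right, qP.h22, qP.h23, qR.h22, qR.h23, sub_self]
      have e2 : P 2 = R 2 := by
        by_contra hne
        have hne' : P 2 - R 2 ≠ 0 := sub_ne_zero.2 hne
        obtain ⟨x, hx, hx0⟩ := Matrix.exists_vecMul_eq_zero_iff.2 hdet0
        have hlin : x 0 • P 0 + x 1 • P 1 + x 2 • ((i : ℤ) • P 2 + (j : ℤ) • P 3) +
            x 3 • (P 2 - R 2) = 0 := by
          ext l
          have := congrFun hx0 l
          simp [vecMul, dotProduct, Fin.sum_univ_four] at this
          simp
          linarith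
        have hx3 : x 3 = 0 := by
          have e3 : bl N (P 2 - R 2) (x 0 • P 0 + x 1 • P 1 +
              x 2 • ((i : ℤ) • P 2 + (j : ℤ) • P 3) + x 3 • (P 2 - R 2)) = 0 := by
            rw [hlin, bl_zero_right]
          rw [bl_add_right, bl_add_right, bl_add_right, bl_smul_right, bl_smul_right,
            bl_smul_right, bl_smul_right, o1, o2, o3] at e3
          simp only [mul_zero, zero_add, mul_eq_zero] at e3
          exact e3.resolve_right (hN.pos _ hne').ne'
        rw [hwP, hwz P (hHG' hPH), hx3] at hlin
        have e4 := indep_of_det_ne_zero (P 0) (P 1) (z P) (y P)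
          (by rw [hdet P (hHG' hPH)]; exact one_ne_zero)
          (x 0 + x 2 * α₁ P) (x 1 + x 2 * α₂ P) (x 2 * c) 0 (by
            rw [← hlin]; ext l; simp; ring)
        have hx2 : x 2 = 0 := by
          rcases mul_eq_zero.1 e4.2.2.1 with h | h
          · exact h
          · exact absurd h hcpos.ne'
        rw [hx2, zero_mul, add_zero, zero_mul, add_zero] at e4
        apply hx
        ext l
        fin_cases l
        · exact e4.1
        · exact e4.2.1
        · exact hx2
        · exact hx3
      have e3 : P 3 = R 3 := by
        rw [e2] at ew
        have := add_left_cancel ew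
        ext l
        have h5 := congrFun this l
        simp only [Pi.smul_apply, smul_eq_mul] at h5
        exact mul_left_cancel₀ hj0.ne' h5
      funext l
      fin_cases l
      · exact e0
      · exact e1
      · exact e2
      · exact e3
    rw [← Finset.card_image_of_injOn hinj]
    have hP₂G := hHG' hP₂
    have cancel : ∀ x y : ℤ, (c : ℤ) * x = c * y → x = y := fun x y h =>
      mul_left_cancel₀ hcpos.ne' h
    have hgr3 : 2 * A * (2 * C) * bl N (z P₂) (z P₂) +
        2 * B * bl N (P₂ 0) (z P₂) * bl N (P₂ 1) (z P₂) - 2 * A * bl N (P₂ 1) (z P₂) ^ 2 -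
        2 * C * bl N (P₂ 0) (z P₂) ^ 2 - bl N (z P₂) (z P₂) * B ^ 2 =
        gram3 N (P₂ 0) (P₂ 1) (z P₂) := by
      have q := hP P₂ (hGF (hGG' hP₂G))
      rw [gram3, q.h00, q.h01, q.h11]
    refine (card_triples_le hN m hm (2 * A) (2 * C) (bl N (z P₂) (z P₂)) B (bl N (P₂ 0) (z P₂))
      (bl N (P₂ 1) (z P₂)) (H.image fun P => ![P 0, P 1, z P]) ?_ ?_ ?_ ?_ ?_ ?_ ?_ ?_).trans ?_
    · intro r hr
      obtain ⟨P, hPH, rfl⟩ := Finset.mem_image.1 hr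
      exact ⟨y P, hdet P (hHG' hPH)⟩
    · rw [hgr3]
      exact hz0 P₂ _ _ (hdet P₂ hP₂G)
    · intro r hr
      obtain ⟨P, hPH, rfl⟩ := Finset.mem_image.1 hr
      exact (hP P (hGF (hGG' (hHG' hPH)))).h00
    · intro r hr
      obtain ⟨P, hPH, rfl⟩ := Finset.mem_image.1 hr
      exact (hP P (hGF (hGG' (hHG' hPH)))).h11
    · intro r hr
      obtain ⟨P, hPH, rfl⟩ := Finset.mem_image.1 hr
      refine cancel _ _ (cancel _ _ ?_)
      have e1 := b3 P (hHG' hPH)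
      have e2 := b3 P₂ hP₂G
      rw [hα1 P hPH, hα2 P hPH] at e1
      rw [hα1 P₂ hP₂, hα2 P₂ hP₂] at e2
      show (c : ℤ) * (c * bl N (z P) (z P)) = _
      linarith
    · intro r hr
      obtain ⟨P, hPH, rfl⟩ := Finset.mem_image.1 hr
      exact (hP P (hGF (hGG' (hHG' hPH)))).h01
    · intro r hr
      obtain ⟨P, hPH, rfl⟩ := Finset.mem_image.1 hr
      refine cancel _ _ ?_
      have e1 := b1 P (hHG' hPH)
      have e2 := b1 P₂ hP₂G
      rw [hα1 P hPH, hα2 P hPH] at e1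
      rw [hα1 P₂ hP₂, hα2 P₂ hP₂] at e2
      exact e1.trans e2.symm
    · intro r hr
      obtain ⟨P, hPH, rfl⟩ := Finset.mem_image.1 hr
      refine cancel _ _ ?_
      have e1 := b2 P (hHG' hPH)
      have e2 := b2 P₂ hP₂G
      rw [hα1 P hPH, hα2 P hPH] at e1
      rw [hα1 P₂ hP₂, hα2 P₂ hP₂] at e2
      exact e1.trans e2.symm
    · rw [hgr3]
      refine Nat.mul_le_mul_right _ (Nat.mul_le_mul_right _ (htd _ ?_))
      rw [Int.natAbs_dvd, hd₃c P₂ (hGG' hP₂G) c _ _ _ (hwz P₂ hP₂G)]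
      exact dvd_mul_left _ _
  refine hkey.trans ?_
  rw [Finset.card_product]
  calc _ ≤ t * t *
      (t * (t * h * 4 * (t * (4 * (N.det.natAbs ^ 2)) * (N.det.natAbs ^ 3 * m)))) :=
        Nat.mul_le_mul_right _ (Nat.mul_le_mul ht2f ht2f)
    _ = _ := by ring

/-- The quadratic form `τ₁² + τ₂τ₃` on triples `(y₁, y₄, σ)`. -/
def tauForm (A B C : ℤ) (x : ℤ × ℤ × ℤ) : ℤ :=
  (C * x.1 - A * x.2.1) ^ 2 + (B * x.1 - A * x.2.2) * (B * x.2.1 - C * x.2.2)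

/-- The polarisation of `tauForm`. -/
def tauPolar (A B C : ℤ) (x x' : ℤ × ℤ × ℤ) : ℤ :=
  2 * (C * x.1 - A * x.2.1) * (C * x'.1 - A * x'.2.1) +
    (B * x.1 - A * x.2.2) * (B * x'.2.1 - C * x'.2.2) +
    (B * x'.1 - A * x'.2.2) * (B * x.2.1 - C * x.2.2)

/-- The determinant of `(A, C, B)`, `x` and `x'`. -/
def tauDet (A B C : ℤ) (x x' : ℤ × ℤ × ℤ) : ℤ :=
  A * (x.2.1 * x'.2.2 - x.2.2 * x'.2.1) - C * (x.1 * x'.2.2 - x.2.2 * x'.1) +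
    B * (x.1 * x'.2.1 - x.2.1 * x'.1)

theorem tauDet_sq (A B C : ℤ) (x x' : ℤ × ℤ × ℤ) :
    (4 * A * C - B ^ 2) * tauDet A B C x x' ^ 2 =
      4 * tauForm A B C x * tauForm A B C x' - tauPolar A B C x x' ^ 2 := by
  simp only [tauDet, tauForm, tauPolar]; ring

theorem tauDet_sub (A B C : ℤ) (t x x' : ℤ × ℤ × ℤ) :
    tauDet A B C t (x - x') = tauDet A B C t x - tauDet A B C t x' := by
  simp only [tauDet, Prod.fst_sub, Prod.snd_sub]; ring

theorem tauPolar_sub (A B C : ℤ) (t x x' : ℤ × ℤ × ℤ) :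
    tauPolar A B C t (x - x') = tauPolar A B C t x - tauPolar A B C t x' := by
  simp only [tauPolar, Prod.fst_sub, Prod.snd_sub]; ring

theorem tauForm_mul (A B C : ℤ) (x : ℤ × ℤ × ℤ) : 4 * A ^ 2 * tauForm A B C x =
    (2 * A * (C * x.1 - A * x.2.1) - B * (B * x.1 - A * x.2.2)) ^ 2 +
      (4 * A * C - B ^ 2) * (B * x.1 - A * x.2.2) ^ 2 := by
  simp only [tauForm]; ring

theorem tauForm_nonneg {A B C : ℤ} (hA : 0 < A) (hE : 0 < 4 * A * C - B ^ 2)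
    (x : ℤ × ℤ × ℤ) : 0 ≤ tauForm A B C x := by
  have h := tauForm_mul A B C x
  have : 0 ≤ 4 * A ^ 2 * tauForm A B C x := by rw [h]; positivity
  exact nonneg_of_mul_nonneg_right this (by positivity)

theorem eq_of_tauForm_eq_zero {A B C : ℤ} (hA : 0 < A) (hE : 0 < 4 * A * C - B ^ 2)
    {x : ℤ × ℤ × ℤ} (h : tauForm A B C x = 0) :
    C * x.1 = A * x.2.1 ∧ B * x.1 = A * x.2.2 := by
  have e := tauForm_mul A B C x
  rw [h, mul_zero] at e
  have h2 : B * x.1 - A * x.2.2 = 0 := by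
    by_contra hne
    have : 0 < (4 * A * C - B ^ 2) * (B * x.1 - A * x.2.2) ^ 2 := by positivity
    nlinarith [sq_nonneg (2 * A * (C * x.1 - A * x.2.1) - B * (B * x.1 - A * x.2.2))]
  rw [h2] at e
  have h1 : 2 * A * (C * x.1 - A * x.2.1) = 0 := by
    have : (2 * A * (C * x.1 - A * x.2.1)) ^ 2 = 0 := by linarith
    exact pow_eq_zero_iff (two_ne_zero) |>.1 this
  have h3 : C * x.1 - A * x.2.1 = 0 := by
    rcases mul_eq_zero.1 h1 with h | h
    · omega
    · exact h
  constructor <;> linarith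

theorem eq_zero_of_tauForm_eq_zero {A B C : ℤ} (hA : 0 < A) (hE : 0 < 4 * A * C - B ^ 2)
    (hprim : Int.gcd (Int.gcd A B) C = 1) {x : ℤ × ℤ × ℤ} (h : tauForm A B C x = 0)
    (hx : |x.1| < A) : x = 0 := by
  obtain ⟨h1, h2⟩ := eq_of_tauForm_eq_zero hA hE h
  have d : A ∣ ((Int.gcd (Int.gcd A B) C : ℕ) : ℤ) * x.1 := by
    have g1 := Int.gcd_eq_gcd_ab A B
    have g2 := Int.gcd_eq_gcd_ab (A.gcd B : ℤ) C
    refine int_dvd_of_eq (b := A * ((A.gcdA B * x.1 + x.2.2 * A.gcdB B) *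
        ((A.gcd B : ℕ) : ℤ).gcdA C + x.2.1 * ((A.gcd B : ℕ) : ℤ).gcdB C)) (dvd_mul_right _ _) ?_
    linear_combination (A.gcdB B * ((A.gcd B : ℕ) : ℤ).gcdA C) * h2 +
      (((A.gcd B : ℕ) : ℤ).gcdB C) * h1 + x.1 * g2 + x.1 * (((A.gcd B : ℕ) : ℤ).gcdA C) * g1
  rw [hprim, Nat.cast_one, one_mul] at d
  have h0 : x.1 = 0 := Int.eq_zero_of_abs_lt_dvd d hx
  rw [h0, mul_zero] at h1 h2
  have h3 : x.2.1 = 0 := by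
    rcases mul_eq_zero.1 h1.symm with h | h
    · omega
    · exact h
  have h4 : x.2.2 = 0 := by
    rcases mul_eq_zero.1 h2.symm with h | h
    · omega
    · exact h
  exact Prod.ext h0 (Prod.ext h3 h4)

theorem abs_sub_lt_of_ediv_eq {a b n : ℤ} (hn : 0 < n) (h : a / n = b / n) : |a - b| < n := by
  have h1 := Int.emod_add_mul_ediv a n
  have h2 := Int.emod_add_mul_ediv b n
  have h3 := Int.emod_nonneg a hn.ne'
  have h4 := Int.emod_nonneg b hn.ne'
  have h5 := Int.emod_lt_of_pos a hn
  have h6 := Int.emod_lt_of_pos b hn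
  rw [h] at h1
  rw [abs_lt]
  constructor <;> linarith

theorem abs_ediv_le {a n : ℤ} {x : ℝ} (hn : 0 < n) (h : |(a : ℝ)| ≤ x * n) :
    |((a / n : ℤ) : ℝ)| ≤ x + 1 := by
  have h1 : ((a / n : ℤ) : ℝ) * n ≤ a := by exact_mod_cast Int.ediv_mul_le a hn.ne'
  have h2 : (a : ℝ) < (((a / n : ℤ) : ℝ) + 1) * n := by
    exact_mod_cast Int.lt_ediv_add_one_mul_self a hn
  have hn' : (0 : ℝ) < n := by exact_mod_cast hn
  obtain ⟨h3, h4⟩ := abs_le.1 h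
  rw [abs_le]
  constructor
  · have : -x * n < (((a / n : ℤ) : ℝ) + 1) * n := by linarith
    have := lt_of_mul_lt_mul_right this hn'.le
    linarith
  · have : ((a / n : ℤ) : ℝ) * n ≤ x * n := by linarith
    have := le_of_mul_le_mul_right this hn'
    linarith

theorem card_Icc_floor_le {x : ℝ} (hx : 0 ≤ x) :
    ((Finset.Icc (-⌊x⌋) ⌊x⌋).card : ℝ) ≤ 2 * x + 1 := by
  have h0 : 0 ≤ ⌊x⌋ := Int.floor_nonneg.2 hx
  rw [Int.card_Icc]
  have : ((⌊x⌋ + 1 - -⌊x⌋).toNat : ℝ) = 2 * ⌊x⌋ + 1 := by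
    have : (((⌊x⌋ + 1 - -⌊x⌋).toNat : ℤ) : ℝ) = ((2 * ⌊x⌋ + 1 : ℤ) : ℝ) := by
      congr 1; omega
    rw [Int.cast_natCast] at this
    rw [this]; push_cast; ring
  rw [this]
  linarith [Int.floor_le x]

theorem mem_Icc_floor {x : ℝ} {k : ℤ} (h : |(k : ℝ)| ≤ x) : k ∈ Finset.Icc (-⌊x⌋) ⌊x⌋ := by
  obtain ⟨h1, h2⟩ := abs_le.1 h
  rw [Finset.mem_Icc]
  refine ⟨?_, Int.le_floor.2 h2⟩
  have : -k ≤ ⌊x⌋ := Int.le_floor.2 (by push_cast; linarith)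
  linarith

theorem ediv_mem_of_abs_le {A y : ℤ} (hA : 0 < A) (h : |y| ≤ 2 * A) :
    y / A ∈ Finset.Icc (-2 : ℤ) 2 := by
  obtain ⟨h1, h2⟩ := abs_le.1 h
  rw [Finset.mem_Icc]
  exact ⟨(Int.le_ediv_iff_mul_le hA).2 (by linarith), Int.ediv_le_of_le_mul hA h2⟩

/-- Lattice points with `tauForm` vanishing. -/
theorem card_tauForm_zero_le {A B C : ℤ} (hA : 0 < A) (hE : 0 < 4 * A * C - B ^ 2)
    (hprim : Int.gcd (Int.gcd A B) C = 1) (T : Finset (ℤ × ℤ × ℤ))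
    (hT : ∀ x ∈ T, |x.1| ≤ 2 * A) (hR : ∀ x ∈ T, tauForm A B C x = 0) : T.card ≤ 5 := by
  refine (Finset.card_le_card_of_injOn (t := Finset.Icc (-2 : ℤ) 2) (fun x => x.1 / A)
    (fun x hx => ediv_mem_of_abs_le hA (hT x hx)) ?_).trans (by decide)
  intro x hx y hy hxy
  refine sub_eq_zero.1 (eq_zero_of_tauForm_eq_zero hA hE hprim ?_ (abs_sub_lt_of_ediv_eq hA hxy))
  obtain ⟨h1, h2⟩ := eq_of_tauForm_eq_zero hA hE (hR x hx)
  obtain ⟨h3, h4⟩ := eq_of_tauForm_eq_zero hA hE (hR y hy)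
  have e1 : C * (x - y).1 - A * (x - y).2.1 = 0 := by
    simp only [Prod.fst_sub, Prod.snd_sub]; linarith
  have e2 : B * (x - y).1 - A * (x - y).2.2 = 0 := by
    simp only [Prod.fst_sub, Prod.snd_sub]; linarith
  rw [tauForm, e1, e2]; ring

/-- Number of lattice points in the relevant range. -/
theorem card_lattice_le {A B C : ℤ} (hA : 0 < A) (E : ℤ) (hEdef : E = 4 * A * C - B ^ 2)
    (hE : 0 < E) (hprim : Int.gcd (Int.gcd A B) C = 1) (Λ : AddSubgroup (ℤ × ℤ × ℤ))
    (g H : ℕ) (hg : 0 < g) (hH : 0 < H)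
    (hgΛ : ∀ x ∈ Λ, (g : ℤ) ^ 2 ∣ 4096 * tauForm A B C x)
    (hHΛ : ∀ x ∈ Λ, ∀ x' ∈ Λ, (H : ℤ) ∣ 128 * tauDet A B C x x') (T : Finset (ℤ × ℤ × ℤ))
    (hTΛ : ∀ x ∈ T, x ∈ Λ) (hT : ∀ x ∈ T, |x.1| ≤ 2 * A)
    (hR : ∀ x ∈ T, tauForm A B C x ≤ 4 * E ^ 2) :
    (T.card : ℝ) ≤ 100000 * (1 + E / g + E * √E / H) := by
  classical
  have hE' : 0 < 4 * A * C - B ^ 2 := hEdef ▸ hE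
  have hEr : (0 : ℝ) < E := by exact_mod_cast hE
  have hgr : (0 : ℝ) < g := by exact_mod_cast hg
  have hHr : (0 : ℝ) < H := by exact_mod_cast hH
  by_cases hzero : ∀ x ∈ T, tauForm A B C x = 0
  · have h5 : (T.card : ℝ) ≤ 5 := by
      exact_mod_cast card_tauForm_zero_le hA hE' hprim T hT hzero
    have : 0 ≤ (E : ℝ) / g + E * √E / H := by positivity
    linarith
  push Not at hzero
  obtain ⟨x₁, hx₁, hx₁0⟩ := hzero
  have hex : ∃ n : ℕ, 0 < n ∧ ∃ x ∈ Λ, tauForm A B C x = n :=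
    ⟨(tauForm A B C x₁).toNat, by have := tauForm_nonneg hA hE' x₁; omega, x₁, hTΛ _ hx₁,
      (Int.toNat_of_nonneg (tauForm_nonneg hA hE' x₁)).symm⟩
  obtain ⟨m, hm⟩ : ∃ m, m = Nat.find hex := ⟨_, rfl⟩
  obtain ⟨hm0, t, htΛ, ht⟩ := Nat.find_spec hex
  rw [← hm] at hm0 ht
  have hmin : ∀ x ∈ Λ, tauForm A B C x < m → tauForm A B C x = 0 := by
    intro x hx hlt
    by_contra hne
    have h0 := tauForm_nonneg hA hE' x
    have := Nat.find_min hex (m := (tauForm A B C x).toNat) (by omega)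
    exact this ⟨by omega, x, hx, (Int.toNat_of_nonneg h0).symm⟩
  have hmE : (m : ℤ) ≤ 4 * E ^ 2 := by
    by_contra! hlt
    exact hx₁0 (hmin x₁ (hTΛ _ hx₁) (lt_of_le_of_lt (hR _ hx₁) hlt))
  have hm0r : (0 : ℝ) < m := by exact_mod_cast hm0
  obtain ⟨s, hs⟩ : ∃ s, s = √(m : ℝ) := ⟨_, rfl⟩
  have hs2 : s ^ 2 = m := by rw [hs]; exact Real.sq_sqrt hm0r.le
  have hs0 : 0 < s := by rw [hs]; exact Real.sqrt_pos.2 hm0r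
  have hsE : s ≤ 2 * E := by
    refine abs_le_of_sq_le_sq' ?_ (by positivity) |>.2
    rw [hs2]
    have : (m : ℝ) ≤ 4 * E ^ 2 := by exact_mod_cast hmE
    linarith
  have hsg : (g : ℝ) ≤ 64 * s := by
    refine abs_le_of_sq_le_sq' ?_ (by positivity) |>.2
    have h1 := Int.le_of_dvd (by rw [ht]; positivity) (hgΛ t htΛ)
    rw [ht] at h1
    have : (g : ℝ) ^ 2 ≤ 4096 * m := by exact_mod_cast h1
    rw [mul_pow, hs2]; linarith
  obtain ⟨w, hw⟩ : ∃ w, w = √(E : ℝ) := ⟨_, rfl⟩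
  have hw2 : w ^ 2 = E := by rw [hw]; exact Real.sq_sqrt hEr.le
  have hw0 : 0 < w := by rw [hw]; exact Real.sqrt_pos.2 hEr
  -- the key
  have hH' : (0 : ℤ) < H := by exact_mod_cast hH
  have h2m : (0 : ℤ) < 2 * m := by positivity
  have hb1 : ∀ x ∈ T, |(((128 * tauDet A B C t x) / (H : ℤ) : ℤ) : ℝ)| ≤ 512 * s * w / H + 1 := by
    intro x hx
    refine abs_ediv_le hH' ?_
    have e1 := tauDet_sq A B C t x
    rw [← hEdef, ht] at e1
    have e2 : (E : ℝ) * (tauDet A B C t x : ℝ) ^ 2 ≤ 4 * m * (4 * E ^ 2) := by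
      have : E * tauDet A B C t x ^ 2 ≤ 4 * m * (4 * E ^ 2) := by
        have := hR x hx
        have : 4 * (m : ℤ) * tauForm A B C x ≤ 4 * m * (4 * E ^ 2) := by gcongr
        nlinarith [sq_nonneg (tauPolar A B C t x)]
      exact_mod_cast this
    have e3 : |(tauDet A B C t x : ℝ)| ≤ 4 * s * w := by
      refine abs_le_of_sq_le_sq ?_ (by positivity)
      have : (E : ℝ) * (tauDet A B C t x : ℝ) ^ 2 ≤ E * (16 * m * E) := by linarith
      have := le_of_mul_le_mul_left this hEr
      rw [mul_pow, mul_pow, hs2, hw2]; linarith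
    have e4 : 512 * s * w / H * ((H : ℤ) : ℝ) = 512 * s * w := by
      push_cast; field_simp
    rw [e4]; push_cast; rw [abs_mul, abs_of_pos (by norm_num : (0 : ℝ) < 128)]; linarith
  have hb2 : ∀ x ∈ T, |(((tauPolar A B C t x) / (2 * m : ℤ) : ℤ) : ℝ)| ≤ 2 * E / s + 1 := by
    intro x hx
    refine abs_ediv_le h2m ?_
    have e1 := tauDet_sq A B C t x
    rw [← hEdef, ht] at e1
    have e2 : (tauPolar A B C t x : ℝ) ^ 2 ≤ 4 * m * (4 * E ^ 2) := by
      have : tauPolar A B C t x ^ 2 ≤ 4 * m * (4 * E ^ 2) := by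
        have := hR x hx
        have : 4 * (m : ℤ) * tauForm A B C x ≤ 4 * m * (4 * E ^ 2) := by gcongr
        have : 0 ≤ E * tauDet A B C t x ^ 2 := by positivity
        linarith
      exact_mod_cast this
    have e4 : 2 * E / s * ((2 * m : ℤ) : ℝ) = 4 * E * s := by
      push_cast; rw [← hs2]; field_simp; ring
    rw [e4]
    refine abs_le_of_sq_le_sq ?_ (by positivity)
    rw [mul_pow, mul_pow, hs2]; linarith
  have hcard : T.card ≤ ((Finset.Icc (-⌊512 * s * w / H + 1⌋) ⌊512 * s * w / H + 1⌋) ×ˢ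
      ((Finset.Icc (-⌊2 * E / s + 1⌋) ⌊2 * E / s + 1⌋) ×ˢ Finset.Icc (-2 : ℤ) 2)).card := by
    refine Finset.card_le_card_of_injOn (fun x => ((128 * tauDet A B C t x) / (H : ℤ),
      (tauPolar A B C t x) / (2 * m : ℤ), x.1 / A)) ?_ ?_
    · intro x hx
      have hx' : x ∈ T := hx
      simp only [Finset.coe_product, Set.mem_prod, Finset.mem_coe]
      exact ⟨mem_Icc_floor (hb1 x hx'), mem_Icc_floor (hb2 x hx'), ediv_mem_of_abs_le hA (hT x hx')⟩
    · intro x hx y hy hxy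
      have hx' : x ∈ T := hx
      have hy' : y ∈ T := hy
      simp only [Prod.mk.injEq] at hxy
      obtain ⟨k1, k2, k3⟩ := hxy
      have d1 := hHΛ t htΛ x (hTΛ x hx')
      have d2 := hHΛ t htΛ y (hTΛ y hy')
      have d3 : tauDet A B C t (x - y) = 0 := by
        have := Int.ediv_mul_cancel d1
        have := Int.ediv_mul_cancel d2
        rw [tauDet_sub]
        rw [k1] at *
        linarith
      have d4 := abs_sub_lt_of_ediv_eq h2m k2
      rw [← tauPolar_sub] at d4
      have d5 := tauDet_sq A B C t (x - y)
      rw [d3, ht] at d5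
      have d6 : tauPolar A B C t (x - y) ^ 2 < (2 * m) ^ 2 := sq_lt_sq' (abs_lt.1 d4).1 (abs_lt.1 d4).2
      have d7 : tauForm A B C (x - y) < m := by
        have hm' : (0 : ℤ) < m := by exact_mod_cast hm0
        nlinarith
      have d8 := hmin _ (Λ.sub_mem (hTΛ x hx') (hTΛ y hy')) d7
      exact sub_eq_zero.1 (eq_zero_of_tauForm_eq_zero hA hE' hprim d8 (abs_sub_lt_of_ediv_eq hA k3))
  have hcard' : (T.card : ℝ) ≤ (2 * (512 * s * w / H + 1) + 1) * ((2 * (2 * E / s + 1) + 1) * 5) := by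
    refine (Nat.cast_le.2 hcard).trans ?_
    rw [Finset.card_product, Finset.card_product]
    push_cast
    have c5 : ((Finset.Icc (-2 : ℤ) 2).card : ℝ) = 5 := by
      have : (Finset.Icc (-2 : ℤ) 2).card = 5 := by decide
      rw [this]; norm_num
    rw [c5]
    gcongr
    · exact card_Icc_floor_le (by positivity)
    · exact card_Icc_floor_le (by positivity)
  refine hcard'.trans ?_
  rw [← hw]
  have f1 : (E : ℝ) / s ≤ 64 * (E / g) := by
    rw [div_le_iff₀ hs0, mul_assoc, div_mul_eq_mul_div, mul_div_assoc', le_div_iff₀ hgr]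
    nlinarith
  have f2 : s * w / H ≤ 2 * (E * w / H) := by
    rw [mul_div_assoc', div_le_div_iff_of_pos_right hHr]
    nlinarith
  have f3 : s * w / H * (E / s) = E * w / H := by field_simp
  have f4 : (2 * (512 * s * w / H + 1) + 1) * ((2 * (2 * E / s + 1) + 1) * 5) =
    20480 * (s * w / H * (E / s)) + 15360 * (s * w / H) + 60 * (E / s) + 45 := by
    field_simp; ring
  rw [f4, f3]
  have : 0 ≤ (E : ℝ) / g := by positivity
  have : 0 ≤ (E : ℝ) * w / H := by positivity
  linarith

/-- The value of the quadratic form `(y₁, y₄, σ)` at the vector orthogonal to `(s, t)`. -/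
def orthVal (A B C s t : ℤ) (x : ℤ × ℤ × ℤ) : ℤ :=
  x.1 * (B * s + 2 * C * t) ^ 2 - x.2.2 * (B * s + 2 * C * t) * (2 * A * s + B * t) +
    x.2.1 * (2 * A * s + B * t) ^ 2

/-- The mixed value of the quadratic form `(y₁, y₄, σ)` at `(s, t)` and the vector orthogonal
to it. -/
def orthMix (A B C s t : ℤ) (x : ℤ × ℤ × ℤ) : ℤ :=
  -2 * x.1 * s * (B * s + 2 * C * t) + x.2.2 * (s * (2 * A * s + B * t) - t * (B * s + 2 * C * t)) +
    2 * x.2.1 * t * (2 * A * s + B * t)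

theorem orth_identity (A B C s t : ℤ) (x : ℤ × ℤ × ℤ) :
    16 * (A * s ^ 2 + B * s * t + C * t ^ 2) ^ 2 * tauForm A B C x =
      ((4 * A * C - B ^ 2) * (x.1 * s ^ 2 + x.2.2 * s * t + x.2.1 * t ^ 2) -
        orthVal A B C s t x) ^ 2 + (4 * A * C - B ^ 2) * orthMix A B C s t x ^ 2 := by
  simp only [tauForm, orthVal, orthMix]; ring

theorem orth_identity' (A B C s t : ℤ) (x z : ℤ × ℤ × ℤ) :
    -8 * (A * s ^ 2 + B * s * t + C * t ^ 2) ^ 2 * tauDet A B C x z =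
      orthMix A B C s t x * orthVal A B C s t z - orthVal A B C s t x * orthMix A B C s t z +
      (4 * A * C - B ^ 2) * ((x.1 * s ^ 2 + x.2.2 * s * t + x.2.1 * t ^ 2) * orthMix A B C s t z -
        orthMix A B C s t x * (z.1 * s ^ 2 + z.2.2 * s * t + z.2.1 * t ^ 2)) := by
  simp only [tauDet, orthVal, orthMix]; ring

/-- The lattice of triples `(y₁, y₄, σ)` satisfying congruences modulo `P` and `h`. -/
def congrLattice (A B C s t : ℤ) (P h : ℕ) : AddSubgroup (ℤ × ℤ × ℤ) where
  carrier := {x | (P : ℤ) ∣ C * x.1 - A * x.2.1 ∧ (P : ℤ) ∣ B * x.1 - A * x.2.2 ∧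
    (P : ℤ) ∣ B * x.2.1 - C * x.2.2 ∧ (h : ℤ) ∣ orthMix A B C s t x ∧
    (h : ℤ) ^ 2 ∣ 16 * orthVal A B C s t x}
  zero_mem' := by simp [orthMix, orthVal]
  add_mem' := by
    rintro x y ⟨a1, a2, a3, a4, a5⟩ ⟨b1, b2, b3, b4, b5⟩
    refine ⟨int_dvd_of_eq (dvd_add a1 b1) ?_, int_dvd_of_eq (dvd_add a2 b2) ?_,
      int_dvd_of_eq (dvd_add a3 b3) ?_, int_dvd_of_eq (dvd_add a4 b4) ?_,
      int_dvd_of_eq (dvd_add a5 b5) ?_⟩ <;>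
    simp only [orthMix, orthVal, Prod.fst_add, Prod.snd_add] <;> ring
  neg_mem' := by
    rintro x ⟨a1, a2, a3, a4, a5⟩
    refine ⟨int_dvd_of_eq (dvd_neg.2 a1) ?_, int_dvd_of_eq (dvd_neg.2 a2) ?_,
      int_dvd_of_eq (dvd_neg.2 a3) ?_, int_dvd_of_eq (dvd_neg.2 a4) ?_,
      int_dvd_of_eq (dvd_neg.2 a5) ?_⟩ <;>
    simp only [orthMix, orthVal, Prod.fst_neg, Prod.snd_neg] <;> ring

theorem dvd_of_dvd_mul_prim {A B C d x : ℤ} (hprim : Int.gcd (Int.gcd A B) C = 1)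
    (h1 : d ∣ A * x) (h2 : d ∣ B * x) (h3 : d ∣ C * x) : d ∣ x := by
  have g1 := Int.gcd_eq_gcd_ab A B
  have g2 := Int.gcd_eq_gcd_ab (A.gcd B : ℤ) C
  rw [hprim] at g2
  refine int_dvd_of_eq (dvd_add (dvd_add (h1.mul_left (A.gcdA B * ((A.gcd B : ℕ) : ℤ).gcdA C))
    (h2.mul_left (A.gcdB B * ((A.gcd B : ℕ) : ℤ).gcdA C)))
    (h3.mul_left (((A.gcd B : ℕ) : ℤ).gcdB C))) ?_
  push_cast at g2
  linear_combination x * g2 + x * (((A.gcd B : ℕ) : ℤ).gcdA C) * g1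

section

variable {A B C s t : ℤ} {P h : ℕ}

theorem tauForm_dvd (hE : (h : ℤ) ^ 2 ∣ 4 * A * C - B ^ 2) (hPh : IsCoprime (P : ℤ) (h : ℤ))
    (hq : IsCoprime (A * s ^ 2 + B * s * t + C * t ^ 2) (h : ℤ)) {x : ℤ × ℤ × ℤ}
    (hx : x ∈ congrLattice A B C s t P h) :
    (((h ^ 2 * P : ℕ) : ℤ)) ^ 2 ∣ 4096 * tauForm A B C x := by
  obtain ⟨a1, a2, a3, a4, a5⟩ := hx
  have e1 : (P : ℤ) ^ 2 ∣ tauForm A B C x := by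
    have h1 : (P : ℤ) ^ 2 ∣ (C * x.1 - A * x.2.1) ^ 2 := pow_dvd_pow_of_dvd a1 2
    have h2 : (P : ℤ) ^ 2 ∣ (B * x.1 - A * x.2.2) * (B * x.2.1 - C * x.2.2) := by
      rw [pow_two]; exact mul_dvd_mul a2 a3
    exact dvd_add h1 h2
  have e2 : (h : ℤ) ^ 4 ∣ 4096 * tauForm A B C x := by
    have h1 : (h : ℤ) ^ 4 ∣ (16 * ((4 * A * C - B ^ 2) *
        (x.1 * s ^ 2 + x.2.2 * s * t + x.2.1 * t ^ 2) - orthVal A B C s t x)) ^ 2 := by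
      have : (h : ℤ) ^ 2 ∣ 16 * ((4 * A * C - B ^ 2) *
        (x.1 * s ^ 2 + x.2.2 * s * t + x.2.1 * t ^ 2) - orthVal A B C s t x) := by
        rw [mul_sub]
        exact dvd_sub ((hE.mul_right _).mul_left _) a5
      exact int_dvd_of_eq (pow_dvd_pow_of_dvd this 2) rfl |> fun h => by rwa [← pow_mul] at h
    have h2 : (h : ℤ) ^ 4 ∣ (4 * A * C - B ^ 2) * orthMix A B C s t x ^ 2 := by
      have := mul_dvd_mul hE (pow_dvd_pow_of_dvd a4 2)
      rwa [← pow_add] at this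
    have h3 : (h : ℤ) ^ 4 ∣ 4096 * tauForm A B C x * (A * s ^ 2 + B * s * t + C * t ^ 2) ^ 2 := by
      refine int_dvd_of_eq (dvd_add h1 (h2.mul_left 256)) ?_
      have := orth_identity A B C s t x
      linear_combination 256 * this
    exact (hq.pow (m := 2) (n := 4)).symm.dvd_of_dvd_mul_right h3
  have e3 : IsCoprime ((P : ℤ) ^ 2) ((h : ℤ) ^ 4) := hPh.pow
  refine int_dvd_of_eq (e3.symm.mul_dvd e2 (e1.mul_left 4096)) rfl |> fun h => ?_
  push_cast
  rw [mul_pow, ← pow_mul]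
  exact h

theorem tauDet_dvd (hprim : Int.gcd (Int.gcd A B) C = 1) (hE : (h : ℤ) ^ 2 ∣ 4 * A * C - B ^ 2)
    (hPh : IsCoprime (P : ℤ) (h : ℤ))
    (hq : IsCoprime (A * s ^ 2 + B * s * t + C * t ^ 2) (h : ℤ)) {x z : ℤ × ℤ × ℤ}
    (hx : x ∈ congrLattice A B C s t P h) (hz : z ∈ congrLattice A B C s t P h) :
    (((h ^ 3 * P ^ 2 : ℕ) : ℤ)) ∣ 128 * tauDet A B C x z := by
  obtain ⟨a1, a2, a3, a4, a5⟩ := hx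
  obtain ⟨b1, b2, b3, b4, b5⟩ := hz
  have e1 : (P : ℤ) ^ 2 ∣ tauDet A B C x z := by
    have c1 := dvd_sub (mul_dvd_mul a1 b2) (mul_dvd_mul a2 b1)
    have c2 := dvd_sub (mul_dvd_mul a1 b3) (mul_dvd_mul a3 b1)
    have c3 := dvd_sub (mul_dvd_mul a2 b3) (mul_dvd_mul a3 b2)
    rw [← pow_two] at c1 c2 c3
    refine dvd_of_dvd_mul_prim hprim (int_dvd_of_eq c1 ?_) (int_dvd_of_eq c3 ?_)
      (int_dvd_of_eq c2 ?_) <;> simp only [tauDet] <;> ring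
  have e2 : (h : ℤ) ^ 3 ∣ 128 * tauDet A B C x z := by
    have c1 : (h : ℤ) ^ 3 ∣ orthMix A B C s t x * (16 * orthVal A B C s t z) := by
      have := mul_dvd_mul a4 b5; rwa [← pow_succ'] at this
    have c2 : (h : ℤ) ^ 3 ∣ 16 * orthVal A B C s t x * orthMix A B C s t z := by
      have := mul_dvd_mul a5 b4; rwa [← pow_succ] at this
    have c3 : (h : ℤ) ^ 3 ∣ (4 * A * C - B ^ 2) *
        ((x.1 * s ^ 2 + x.2.2 * s * t + x.2.1 * t ^ 2) * orthMix A B C s t z -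
        orthMix A B C s t x * (z.1 * s ^ 2 + z.2.2 * s * t + z.2.1 * t ^ 2)) := by
      have := mul_dvd_mul hE (dvd_sub (b4.mul_left (x.1 * s ^ 2 + x.2.2 * s * t + x.2.1 * t ^ 2))
        (a4.mul_right (z.1 * s ^ 2 + z.2.2 * s * t + z.2.1 * t ^ 2)))
      rwa [← pow_succ] at this
    have c4 : (h : ℤ) ^ 3 ∣ 128 * tauDet A B C x z * (A * s ^ 2 + B * s * t + C * t ^ 2) ^ 2 := by
      refine int_dvd_of_eq (dvd_neg.2 (dvd_add (dvd_sub c1 c2) (c3.mul_left 16))) ?_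
      have := orth_identity' A B C s t x z
      linear_combination (-16) * this
    exact (hq.pow (m := 2) (n := 3)).symm.dvd_of_dvd_mul_right c4
  have e3 : IsCoprime ((P : ℤ) ^ 2) ((h : ℤ) ^ 3) := hPh.pow
  push_cast
  exact e3.symm.mul_dvd e2 (e1.mul_left 128)

end

/-- Congruences satisfied by two pairs of vectors spanning the same lattice modulo `h`. -/
theorem congr_of_pair {N : Matrix (Fin 4) (Fin 4) ℤ} (hN : IsPD N) {A B C : ℤ}
    {P : Fin 4 → Fin 4 → ℤ} (hP : IsRepPair N A B C P) (h : ℕ) (hh : 0 < h)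
    (hE : (h : ℤ) ^ 2 ∣ 4 * A * C - B ^ 2) (s t : ℤ)
    (hq : IsCoprime (A * s ^ 2 + B * s * t + C * t ^ 2) (h : ℤ)) (a b c d a' b' c' d' : ℤ)
    (z₁ z₂ z₃ z₄ : Fin 4 → ℤ) (e2 : P 2 = a • P 0 + b • P 1 + (h : ℤ) • z₁)
    (e3 : P 3 = c • P 0 + d • P 1 + (h : ℤ) • z₂) (e0 : P 0 = a' • P 2 + b' • P 3 + (h : ℤ) • z₃)
    (e1 : P 1 = c' • P 2 + d' • P 3 + (h : ℤ) • z₄) :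
    (h : ℤ) ∣ orthMix A B C s t (bl N (P 0) (P 2), bl N (P 1) (P 3),
        bl N (P 0) (P 3) + bl N (P 1) (P 2)) ∧
      (h : ℤ) ^ 2 ∣ 16 * orthVal A B C s t (bl N (P 0) (P 2), bl N (P 1) (P 3),
        bl N (P 0) (P 3) + bl N (P 1) (P 2)) ∧
      (h : ℤ) ^ 2 ∣ 64 * (bl N (P 0) (P 2) * bl N (P 1) (P 3) -
        bl N (P 0) (P 3) * bl N (P 1) (P 2)) := by
  obtain ⟨E, hEdef⟩ : ∃ E, E = 4 * A * C - B ^ 2 := ⟨_, rfl⟩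
  obtain ⟨Q, hQ⟩ : ∃ Q, Q = A * s ^ 2 + B * s * t + C * t ^ 2 := ⟨_, rfl⟩
  obtain ⟨u, hu⟩ : ∃ u, u = -(B * s + 2 * C * t) := ⟨_, rfl⟩
  obtain ⟨v, hv⟩ : ∃ v, v = 2 * A * s + B * t := ⟨_, rfl⟩
  have hh' : (h : ℤ) ≠ 0 := by exact_mod_cast hh.ne'
  obtain ⟨n, hn⟩ : ∃ n, n = u • P 0 + v • P 1 := ⟨_, rfl⟩
  obtain ⟨m, hm⟩ : ∃ m, m = u • P 2 + v • P 3 := ⟨_, rfl⟩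
  have hEh : (h : ℤ) ∣ E := by rw [hEdef]; exact (dvd_pow_self _ two_ne_zero).trans hE
  rw [← hEdef] at hE
  rw [← hQ] at hq
  have h10 : bl N (P 1) (P 0) = B := by rw [bl_comm hN, hP.h01]
  have h32 : bl N (P 3) (P 2) = B := by rw [bl_comm hN, hP.h23]
  have n0 : bl N n (P 0) = -(E * t) := by
    rw [hn, bl_add_left, bl_smul_left, bl_smul_left, hP.h00, h10, hu, hv, hEdef]; ring
  have n1 : bl N n (P 1) = E * s := by
    rw [hn, bl_add_left, bl_smul_left, bl_smul_left, hP.h01, hP.h11, hu, hv, hEdef]; ring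
  have m2 : bl N m (P 2) = -(E * t) := by
    rw [hm, bl_add_left, bl_smul_left, bl_smul_left, hP.h22, h32, hu, hv, hEdef]; ring
  have m3 : bl N m (P 3) = E * s := by
    rw [hm, bl_add_left, bl_smul_left, bl_smul_left, hP.h23, hP.h33, hu, hv, hEdef]; ring
  have nn : bl N n n = 2 * E * Q := by
    have e : bl N n n = u * bl N n (P 0) + v * bl N n (P 1) := by
      nth_rewrite 2 [hn]
      rw [bl_add_right, bl_smul_right, bl_smul_right]
    rw [e, n0, n1, hu, hv, hQ]
    ring
  have mm : bl N m m = 2 * E * Q := by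
    have e : bl N m m = u * bl N m (P 2) + v * bl N m (P 3) := by
      nth_rewrite 2 [hm]
      rw [bl_add_right, bl_smul_right, bl_smul_right]
    rw [e, m2, m3, hu, hv, hQ]
    ring
  have n2 : (h : ℤ) ∣ bl N n (P 2) := by
    rw [e2, bl_add_right, bl_add_right, bl_smul_right, bl_smul_right, bl_smul_right, n0, n1]
    exact dvd_add (dvd_add ((dvd_neg.2 (hEh.mul_right _)).mul_left _)
      ((hEh.mul_right _).mul_left _)) (dvd_mul_right _ _)
  have n3 : (h : ℤ) ∣ bl N n (P 3) := by
    rw [e3, bl_add_right, bl_add_right, bl_smul_right, bl_smul_right, bl_smul_right, n0, n1]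
    exact dvd_add (dvd_add ((dvd_neg.2 (hEh.mul_right _)).mul_left _)
      ((hEh.mul_right _).mul_left _)) (dvd_mul_right _ _)
  have m0 : (h : ℤ) ∣ bl N m (P 0) := by
    rw [e0, bl_add_right, bl_add_right, bl_smul_right, bl_smul_right, bl_smul_right, m2, m3]
    exact dvd_add (dvd_add ((dvd_neg.2 (hEh.mul_right _)).mul_left _)
      ((hEh.mul_right _).mul_left _)) (dvd_mul_right _ _)
  have m1 : (h : ℤ) ∣ bl N m (P 1) := by
    rw [e1, bl_add_right, bl_add_right, bl_smul_right, bl_smul_right, bl_smul_right, m2, m3]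
    exact dvd_add (dvd_add ((dvd_neg.2 (hEh.mul_right _)).mul_left _)
      ((hEh.mul_right _).mul_left _)) (dvd_mul_right _ _)
  have N2 : bl N n (P 2) = u * bl N (P 0) (P 2) + v * bl N (P 1) (P 2) := by
    rw [hn, bl_add_left, bl_smul_left, bl_smul_left]
  have N3 : bl N n (P 3) = u * bl N (P 0) (P 3) + v * bl N (P 1) (P 3) := by
    rw [hn, bl_add_left, bl_smul_left, bl_smul_left]
  have M0 : bl N m (P 0) = u * bl N (P 0) (P 2) + v * bl N (P 0) (P 3) := by
    rw [hm, bl_add_left, bl_smul_left, bl_smul_left, bl_comm hN (P 2), bl_comm hN (P 3)]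
  have M1 : bl N m (P 1) = u * bl N (P 1) (P 2) + v * bl N (P 1) (P 3) := by
    rw [hm, bl_add_left, bl_smul_left, bl_smul_left, bl_comm hN (P 2), bl_comm hN (P 3)]
  have nm : bl N n m = orthVal A B C s t (bl N (P 0) (P 2), bl N (P 1) (P 3),
        bl N (P 0) (P 3) + bl N (P 1) (P 2)) := by
    rw [hm, bl_add_right, bl_smul_right, bl_smul_right, N2, N3, orthVal, hu, hv]
    ring
  -- `m` and `n` are proportional modulo `h`
  have prop : ∀ (x y : Fin 4 → ℤ) (k l : ℤ) (z w : Fin 4 → ℤ), bl N x x = 2 * A →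
      bl N x y = B → bl N y y = 2 * C → w = k • x + l • y + (h : ℤ) • z →
      (h : ℤ) ∣ bl N w (s • x + t • y) →
      ∃ (δ : ℤ) (ζ : Fin 4 → ℤ), (2 * Q) • w = δ • (u • x + v • y) + (h : ℤ) • ζ := by
    intro x y k l z w hx hxy hy hw hd
    have hyx : bl N y x = B := by rw [bl_comm hN, hxy]
    have ee : bl N w (s • x + t • y) - h * bl N z (s • x + t • y) =
        s * (2 * A * k + B * l) + t * (B * k + 2 * C * l) := by
      rw [hw]
      simp only [bl_add_left, bl_smul_left, bl_add_right, bl_smul_right, hx, hxy, hyx, hy]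
      ring
    obtain ⟨r, hr⟩ := hd
    have er : h * (r - bl N z (s • x + t • y)) =
        s * (2 * A * k + B * l) + t * (B * k + 2 * C * l) := by rw [← ee, hr]; ring
    obtain ⟨r', hr'⟩ : ∃ r', r' = r - bl N z (s • x + t • y) := ⟨_, rfl⟩
    rw [← hr'] at er
    refine ⟨s * l - t * k, (r' * s) • x + (r' * t) • y + (2 * Q) • z, ?_⟩
    rw [hw]
    ext i
    simp only [Pi.add_apply, Pi.smul_apply, smul_eq_mul, hQ, hu, hv]
    linear_combination (-(s * x i + t * y i)) * er
  obtain ⟨δ, ζ, hδ⟩ := prop (P 0) (P 1) (u * a + v * c) (u * b + v * d) (u • z₁ + v • z₂) m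
    hP.h00 hP.h01 hP.h11 (by rw [hm]; conv_lhs => rw [e2, e3]
                             ext i; simp; ring) (by
      rw [bl_add_right, bl_smul_right, bl_smul_right]
      exact dvd_add (m0.mul_left _) (m1.mul_left _))
  obtain ⟨δ', ζ', hδ'⟩ := prop (P 2) (P 3) (u * a' + v * c') (u * b' + v * d')
    (u • z₃ + v • z₄) n
    hP.h22 hP.h23 hP.h33 (by rw [hn]; conv_lhs => rw [e0, e1]
                             ext i; simp; ring) (by
      rw [bl_add_right, bl_smul_right, bl_smul_right]
      exact dvd_add (n2.mul_left _) (n3.mul_left _))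
  rw [← hn] at hδ
  rw [← hm] at hδ'
  have k1 : (h : ℤ) ∣ 2 * δ * bl N n ζ := by
    have e : bl N ((2 * Q) • m) ((2 * Q) • m) = bl N (δ • n + (h : ℤ) • ζ) (δ • n + (h : ℤ) • ζ) := by
      rw [hδ]
    simp only [bl_add_left, bl_smul_left, bl_add_right, bl_smul_right, nn, mm, bl_comm hN ζ n] at e
    obtain ⟨g, hg⟩ := hE
    have : (h : ℤ) * h ∣ h * (2 * δ * bl N n ζ) := by
      refine ⟨8 * g * Q ^ 3 - 2 * δ ^ 2 * g * Q - bl N ζ ζ, ?_⟩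
      rw [hg] at e
      linear_combination (-1) * e
    exact (mul_dvd_mul_iff_left hh').1 this
  have k2 : (h : ℤ) ∣ 8 * bl N n ζ := by
    have e : bl N ((2 * Q) • n) ζ = bl N (δ' • m + (h : ℤ) • ζ') ζ := by rw [hδ']
    have e' : bl N ((2 * Q) • m) ζ = bl N (δ • n + (h : ℤ) • ζ) ζ := by rw [hδ]
    simp only [bl_add_left, bl_smul_left] at e e'
    have : (h : ℤ) ∣ 8 * bl N n ζ * Q ^ 2 := by
      obtain ⟨g, hg⟩ := k1
      refine ⟨δ' * g + 2 * δ' * bl N ζ ζ + 4 * Q * bl N ζ' ζ, ?_⟩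
      linear_combination 4 * Q * e + 2 * δ' * e' + δ' * hg
    exact (hq.pow_left (m := 2)).symm.dvd_of_dvd_mul_right this
  have k3 : (h : ℤ) ^ 2 ∣ 16 * bl N n m := by
    have e : bl N n ((2 * Q) • m) = bl N n (δ • n + (h : ℤ) • ζ) := by rw [hδ]
    simp only [bl_add_right, bl_smul_right, nn] at e
    have : (h : ℤ) ^ 2 ∣ 16 * bl N n m * Q := by
      obtain ⟨g, hg⟩ := k2
      obtain ⟨g', hg'⟩ := hE
      refine ⟨16 * δ * g' * Q + g, ?_⟩
      rw [hg'] at e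
      linear_combination 8 * e + h * hg
    exact (hq.pow_right (n := 2)).symm.dvd_of_dvd_mul_right this
  refine ⟨?_, nm ▸ k3, ?_⟩
  · refine int_dvd_of_eq (dvd_add (dvd_add (n2.mul_left s) (n3.mul_left t))
      (dvd_add (m0.mul_left s) (m1.mul_left t))) ?_
    rw [N2, N3, M0, M1, orthMix, hu, hv]; ring
  · have d1 : (h : ℤ) ^ 2 ∣ (s * bl N m (P 0) + t * bl N m (P 1)) *
        (s * bl N n (P 2) + t * bl N n (P 3)) := by
      rw [pow_two]
      exact mul_dvd_mul (dvd_add (m0.mul_left _) (m1.mul_left _))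
        (dvd_add (n2.mul_left _) (n3.mul_left _))
    have d2 := k3.mul_left (s ^ 2 * bl N (P 0) (P 2) + s * t * (bl N (P 0) (P 3) +
      bl N (P 1) (P 2)) + t ^ 2 * bl N (P 1) (P 3))
    have : (h : ℤ) ^ 2 ∣ 64 * (bl N (P 0) (P 2) * bl N (P 1) (P 3) -
        bl N (P 0) (P 3) * bl N (P 1) (P 2)) * Q ^ 2 := by
      refine int_dvd_of_eq (dvd_sub d2 (d1.mul_left 16)) ?_
      rw [nm, N2, N3, M0, M1, orthVal, hQ, hu, hv]; ring
    exact (hq.pow (m := 2) (n := 2)).symm.dvd_of_dvd_mul_right this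

theorem pell_class_unique {Δ d m u₁ v₁ u₂ v₂ : ℤ} (hΔ : 0 < Δ) (hd : 0 < d)
    (hm : m = d ∨ m = -d) (h1 : u₁ ^ 2 - Δ * v₁ ^ 2 = m) (h2 : u₂ ^ 2 - Δ * v₂ ^ 2 = m)
    (hu₁ : 0 ≤ u₁) (hv₁ : 0 ≤ v₁) (hu₂ : 0 ≤ u₂) (hv₂ : 0 ≤ v₂) (hc₁ : IsCoprime u₁ v₁)
    (hc₂ : IsCoprime u₂ v₂) (hd1 : d ∣ u₁ * v₂ - u₂ * v₁) (hd2 : d ∣ u₁ * u₂ - Δ * (v₁ * v₂)) :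
    (u₁ = u₂ ∧ v₁ = v₂) ∨ (2 * u₁ ≤ u₂ ∧ 0 < u₂) ∨ (2 * u₂ ≤ u₁ ∧ 0 < u₁) := by
  obtain ⟨b, hb⟩ := hd1
  obtain ⟨a, ha⟩ := hd2
  have hm2 : m ^ 2 = d ^ 2 := by rcases hm with rfl | rfl <;> ring
  have hab : a ^ 2 - Δ * b ^ 2 = 1 := by
    have : d ^ 2 * (a ^ 2 - Δ * b ^ 2) = d ^ 2 * 1 := by
      have e : (u₁ ^ 2 - Δ * v₁ ^ 2) * (u₂ ^ 2 - Δ * v₂ ^ 2) = m ^ 2 := by rw [h1, h2]; ring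
      have e1 : d ^ 2 * a ^ 2 = (u₁ * u₂ - Δ * (v₁ * v₂)) ^ 2 := by rw [ha]; ring
      have e2 : d ^ 2 * b ^ 2 = (u₁ * v₂ - u₂ * v₁) ^ 2 := by rw [hb]; ring
      linear_combination e1 - Δ * e2 + e + hm2
    exact mul_left_cancel₀ (by positivity) this
  by_cases hb0 : b = 0
  · left
    rw [hb0, mul_zero, sub_eq_zero] at hb
    have d1 : u₁ ∣ u₂ := hc₁.dvd_of_dvd_mul_right ⟨v₂, hb.symm⟩
    have d2 : u₂ ∣ u₁ := hc₂.dvd_of_dvd_mul_right ⟨v₁, hb⟩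
    have d3 : v₁ ∣ v₂ := hc₁.symm.dvd_of_dvd_mul_left ⟨u₂, by rw [hb]; ring⟩
    have d4 : v₂ ∣ v₁ := hc₂.symm.dvd_of_dvd_mul_left ⟨u₁, by rw [← hb]; ring⟩
    exact ⟨Int.dvd_antisymm hu₁ hu₂ d1 d2, Int.dvd_antisymm hv₁ hv₂ d3 d4⟩
  · right
    have hb1 : 1 ≤ b ^ 2 := by
      have : 0 < b ^ 2 := by positivity
      omega
    have ha2 : 2 ≤ |a| := by
      have : 1 < a ^ 2 := by nlinarith
      have := (one_lt_sq_iff_one_lt_abs a).1 this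
      omega
    have hb1' : 1 ≤ |b| := Int.one_le_abs hb0
    have k1 : |u₂| = |a * u₁ + Δ * b * v₁| := by
      have : d * (a * u₁ + Δ * b * v₁) = m * u₂ := by
        have : m * u₂ = u₁ * (u₁ * u₂ - Δ * (v₁ * v₂)) + Δ * v₁ * (u₁ * v₂ - u₂ * v₁) := by
          rw [← h1]; ring
        rw [this, ha, hb]; ring
      rcases hm with rfl | rfl
      · rw [mul_left_cancel₀ hd.ne' this]
      · have : d * (a * u₁ + Δ * b * v₁) = d * (-u₂) := by rw [this]; ring
        rw [mul_left_cancel₀ hd.ne' this, abs_neg]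
    have k2 : |u₁| = |a * u₂ - Δ * b * v₂| := by
      have : d * (a * u₂ - Δ * b * v₂) = m * u₁ := by
        have : m * u₁ = u₂ * (u₁ * u₂ - Δ * (v₁ * v₂)) - Δ * v₂ * (u₁ * v₂ - u₂ * v₁) := by
          rw [← h2]; ring
        rw [this, ha, hb]; ring
      rcases hm with rfl | rfl
      · rw [mul_left_cancel₀ hd.ne' this]
      · have : d * (a * u₂ - Δ * b * v₂) = d * (-u₁) := by rw [this]; ring
        rw [mul_left_cancel₀ hd.ne' this, abs_neg]
    have hsum : ∀ (x y c e : ℤ), 0 ≤ x → 0 ≤ y → IsCoprime x y → 2 ≤ c → 1 ≤ e →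
        2 * x ≤ c * x + Δ * e * y ∧ 0 < c * x + Δ * e * y := by
      intro x y c e hx hy hxy hc he
      have p1 : 2 * x ≤ c * x := by gcongr
      have p2 : y ≤ Δ * e * y := by
        have : 1 ≤ Δ * e := by nlinarith
        nlinarith
      refine ⟨by linarith, ?_⟩
      by_contra hle
      have hx0 : x = 0 := by linarith
      have hy0 : y = 0 := by linarith
      rw [hx0, hy0, isCoprime_zero_left] at hxy
      exact not_isUnit_zero hxy
    rw [abs_of_nonneg hu₂] at k1
    rw [abs_of_nonneg hu₁] at k2
    have hΔb : ∀ z, Δ * -b * z = -(Δ * b * z) := fun z => by ring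
    rcases abs_cases a with ⟨ea, -⟩ | ⟨ea, -⟩ <;> rcases abs_cases b with ⟨eb, -⟩ | ⟨eb, -⟩
    · left
      rw [ea] at ha2; rw [eb] at hb1'
      have := hsum u₁ v₁ a b hu₁ hv₁ hc₁ ha2 hb1'
      rw [abs_of_pos this.2] at k1
      rwa [k1]
    · right
      rw [ea] at ha2; rw [eb] at hb1'
      have := hsum u₂ v₂ a (-b) hu₂ hv₂ hc₂ ha2 hb1'
      rw [hΔb, ← sub_eq_add_neg] at this
      rw [abs_of_pos this.2] at k2
      rwa [k2]
    · right
      rw [ea] at ha2; rw [eb] at hb1'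
      have := hsum u₂ v₂ (-a) b hu₂ hv₂ hc₂ ha2 hb1'
      rw [← abs_neg] at k2
      have e : -(a * u₂ - Δ * b * v₂) = -a * u₂ + Δ * b * v₂ := by ring
      rw [e, abs_of_pos this.2] at k2
      rwa [k2]
    · left
      rw [ea] at ha2; rw [eb] at hb1'
      have := hsum u₁ v₁ (-a) (-b) hu₁ hv₁ hc₁ ha2 hb1'
      rw [← abs_neg] at k1
      have e : -(a * u₁ + Δ * b * v₁) = -a * u₁ + Δ * -b * v₁ := by ring
      rw [e, abs_of_pos this.2] at k1
      rwa [k1]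

theorem size_lt_size {a b : ℕ} (h : 2 * a ≤ b) (hb : 0 < b) : a.size < b.size := by
  rw [Nat.lt_size]
  rcases Nat.eq_zero_or_pos a with rfl | ha
  · rw [Nat.size_zero, pow_zero]; exact hb
  · have h1 : 0 < a.size := Nat.size_pos.2 ha
    have h2 : 2 ^ (a.size - 1) ≤ a := Nat.lt_size.1 (by omega)
    calc 2 ^ a.size = 2 * 2 ^ (a.size - 1) := by
          rw [← pow_succ']; congr 1; omega
      _ ≤ b := by omega

/-- Bounded solutions of a Pell-type equation. -/
theorem card_pell_le (Δ : ℕ) (hΔ : 0 < Δ) (m : ℤ) (hm : m ≠ 0) (t X : ℕ)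
    (ht : ∀ n : ℕ, (n : ℤ) ∣ m → n.divisors.card ≤ t) (F : Finset (ℤ × ℤ))
    (hF : ∀ x ∈ F, x.1 ^ 2 - Δ * x.2 ^ 2 = m) (hX : ∀ x ∈ F, |x.1| ≤ X) :
    F.card ≤ (4 * (t * (X.size + 1))) * (t * (4 * Δ)) := by
  classical
  have hkey := card_le_of_cover F ((Finset.univ : Finset (Bool × Bool)) ×ˢ
      (m.natAbs.divisors ×ˢ Finset.range (X.size + 1)))
    (fun x k => k.1 = (decide (0 ≤ x.1), decide (0 ≤ x.2)) ∧ k.2.1 = Int.gcd x.1 x.2 ∧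
      k.2.2 = x.1.natAbs.size) (t * (4 * Δ)) ?_ ?_
  · refine hkey.trans (Nat.mul_le_mul_right _ ?_)
    rw [Finset.card_product, Finset.card_product, Finset.card_range]
    have : (Finset.univ : Finset (Bool × Bool)).card = 4 := by decide
    rw [this]
    gcongr
    exact ht _ (Int.natAbs_dvd.2 dvd_rfl)
  · intro x hx
    refine ⟨((decide (0 ≤ x.1), decide (0 ≤ x.2)), (Int.gcd x.1 x.2, x.1.natAbs.size)), ?_,
      rfl, rfl, rfl⟩
    simp only [Finset.mem_product, Finset.mem_univ, Nat.mem_divisors, Finset.mem_range, true_and]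
    refine ⟨⟨?_, by simpa using hm⟩, ?_⟩
    · rw [← Int.natCast_dvd, ← hF x hx]
      exact dvd_sub ((dvd_pow_self _ two_ne_zero).trans (pow_dvd_pow_of_dvd (Int.gcd_dvd_left _ _) 2))
        (((dvd_pow_self _ two_ne_zero).trans (pow_dvd_pow_of_dvd (Int.gcd_dvd_right _ _) 2)).mul_left _)
    · have := hX x hx
      rw [Int.abs_eq_natAbs] at this
      exact Nat.lt_succ_of_le (Nat.size_le_size (by omega))
  · rintro ⟨⟨b₁, b₂⟩, k, s⟩ hk G hGF hG
    simp only [Prod.mk.injEq] at hG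
    simp only [Finset.mem_product, Nat.mem_divisors] at hk
    have hk0 : 0 < k := Nat.pos_of_dvd_of_pos hk.2.1.1 (Int.natAbs_pos.2 hm)
    have hk0' : (k : ℤ) ≠ 0 := by exact_mod_cast hk0.ne'
    rcases G.eq_empty_or_nonempty with rfl | ⟨y, hy⟩
    · simp
    have hdec : ∀ x ∈ G, ∃ u v : ℤ, 0 ≤ u ∧ 0 ≤ v ∧ |x.1| = k * u ∧ |x.2| = k * v ∧
        IsCoprime u v := by
      intro x hx
      obtain ⟨-, hg, -⟩ := hG x hx
      have hg' : Int.gcd |x.1| |x.2| = k := by rw [hg]; simp [Int.gcd, Int.natAbs_abs]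
      obtain ⟨u, hu⟩ : (k : ℤ) ∣ |x.1| := hg' ▸ Int.gcd_dvd_left _ _
      obtain ⟨v, hv⟩ : (k : ℤ) ∣ |x.2| := hg' ▸ Int.gcd_dvd_right _ _
      have hkp : (0 : ℤ) < k := by exact_mod_cast hk0
      refine ⟨u, v, nonneg_of_mul_nonneg_right (hu ▸ abs_nonneg _) hkp,
        nonneg_of_mul_nonneg_right (hv ▸ abs_nonneg _) hkp, hu, hv, ?_⟩
      rw [Int.isCoprime_iff_gcd_eq_one]
      rw [hu, hv, Int.gcd_mul_left, Int.natAbs_natCast] at hg'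
      exact Nat.eq_of_mul_eq_mul_left hk0 (by rw [hg', mul_one])
    obtain ⟨m', hm'⟩ : ∃ m', m = k ^ 2 * m' := by
      obtain ⟨u, v, -, -, hu, hv, -⟩ := hdec y hy
      refine ⟨u ^ 2 - Δ * v ^ 2, ?_⟩
      rw [← hF y (hGF hy), ← sq_abs y.1, ← sq_abs y.2, hu, hv]; ring
    have heq : ∀ x ∈ G, ∀ u v : ℤ, |x.1| = k * u → |x.2| = k * v → u ^ 2 - Δ * v ^ 2 = m' := by
      intro x hx u v hu hv
      have e := hF x (hGF hx)
      rw [← sq_abs x.1, ← sq_abs x.2, hu, hv, hm'] at e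
      have : (k : ℤ) ^ 2 * (u ^ 2 - Δ * v ^ 2) = k ^ 2 * m' := by rw [← e]; ring
      exact mul_left_cancel₀ (by positivity) this
    have hm'0 : m' ≠ 0 := by rintro rfl; rw [mul_zero] at hm'; exact hm hm'
    obtain ⟨d, hd⟩ : ∃ d, d = m'.natAbs := ⟨_, rfl⟩
    have hd0 : 0 < d := by rw [hd]; exact Int.natAbs_pos.2 hm'0
    have hdm' : (d : ℤ) ∣ m' := by rw [hd]; exact Int.natAbs_dvd.2 dvd_rfl
    have hz : ∀ x ∈ G, ∃ (z : ℕ) (u v : ℤ), 0 ≤ u ∧ 0 ≤ v ∧ |x.1| = k * u ∧ |x.2| = k * v ∧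
        IsCoprime u v ∧ z < d ∧ (d : ℤ) ∣ (z : ℤ) ^ 2 - Δ ∧ (d : ℤ) ∣ u - z * v := by
      intro x hx
      obtain ⟨u, v, hu0, hv0, hu, hv, hcop⟩ := hdec x hx
      have e := heq x hx u v hu hv
      have hvm : IsCoprime v m' := by
        rw [← e]
        have : IsCoprime v (u ^ 2) := hcop.symm.pow_right
        have e2 : u ^ 2 - Δ * v ^ 2 = u ^ 2 + v * (-(Δ * v)) := by ring
        rw [e2]
        exact this.add_mul_left_right _
      obtain ⟨a, b, hab⟩ : IsCoprime v (d : ℤ) := hvm.of_isCoprime_of_dvd_right hdm'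
      have hdz : (0 : ℤ) < d := by exact_mod_cast hd0
      have hz0 := Int.emod_nonneg (u * a) hdz.ne'
      refine ⟨((u * a) % d).toNat, u, v, hu0, hv0, hu, hv, hcop, ?_, ?_, ?_⟩
      · have := Int.emod_lt_of_pos (u * a) hdz
        omega
      all_goals
        rw [Int.toNat_of_nonneg hz0]
        have e3 := Int.emod_add_mul_ediv (u * a) d
        obtain ⟨w, hw⟩ : ∃ w, w = (u * a) / (d : ℤ) := ⟨_, rfl⟩
        rw [← hw] at e3
        obtain ⟨g, hg⟩ := hdm'
      · refine ⟨(u * a) % d * (-w) - u * a * w + a ^ 2 * g - Δ * b * (1 + a * v), ?_⟩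
        rw [hg] at e
        linear_combination ((u * a) % d + u * a) * e3 + a ^ 2 * e + Δ * (1 + a * v) * hab
      · refine ⟨u * b + w * v, ?_⟩
        linear_combination (-v) * e3 - u * hab
    choose! z hz using hz
    have hinj : Set.InjOn z G := by
      intro x hx y hy hxy
      obtain ⟨u₁, v₁, a1, a2, a3, a4, a5, a6, a7, a8⟩ := hz x hx
      obtain ⟨u₂, v₂, b1, b2, b3, b4, b5, b6, b7, b8⟩ := hz y hy
      rw [← hxy] at b8
      have sx := hG x hx
      have sy := hG y hy
      have hu := pell_class_unique (Δ := Δ) (d := d) (m := m') (by exact_mod_cast hΔ)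
        (by exact_mod_cast hd0) (by omega) (heq x hx u₁ v₁ a3 a4) (heq y hy u₂ v₂ b3 b4) a1 a2 b1 b2
        a5 b5 (by
          refine int_dvd_of_eq (dvd_sub (a8.mul_left v₂) (b8.mul_left v₁)) ?_
          ring) (by
          refine int_dvd_of_eq (dvd_add (dvd_add (a8.mul_left u₂) (b8.mul_left (z x * v₁)))
            (a7.mul_left (v₁ * v₂))) ?_
          ring)
      have lem : ∀ (x y : ℤ × ℤ) (u₁ u₂ : ℤ), 0 ≤ u₁ → 0 ≤ u₂ → |x.1| = k * u₁ → |y.1| = k * u₂ →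
          x.1.natAbs.size = y.1.natAbs.size → ¬ (2 * u₁ ≤ u₂ ∧ 0 < u₂) := by
        rintro x y u₁ u₂ h1 h2 h3 h4 h5 ⟨h6, h7⟩
        have hkp : (0 : ℤ) < k := by exact_mod_cast hk0
        have e1 : 2 * (k * u₁) ≤ k * u₂ := by nlinarith
        have e2 : 0 < k * u₂ := by positivity
        rw [← h3, ← h4] at e1
        rw [← h4] at e2
        simp only [Int.abs_eq_natAbs] at e1 e2
        exact absurd h5 (size_lt_size (by omega) (by omega)).ne
      rcases hu with ⟨e1, e2⟩ | h | h
      · have f1 : |x.1| = |y.1| := by rw [a3, b3, e1]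
        have f2 : |x.2| = |y.2| := by rw [a4, b4, e2]
        have g1 : decide (0 ≤ x.1) = decide (0 ≤ y.1) := sx.1.1.symm.trans sy.1.1
        have g2 : decide (0 ≤ x.2) = decide (0 ≤ y.2) := sx.1.2.symm.trans sy.1.2
        simp only [decide_eq_decide] at g1 g2
        simp only [Int.abs_eq_natAbs] at f1 f2
        exact Prod.ext (by omega) (by omega)
      · exact absurd h (lem x y u₁ u₂ a1 b1 a3 b3 (sx.2.2.symm.trans sy.2.2))
      · exact absurd h (lem y x u₂ u₁ b1 a1 b3 a3 (sy.2.2.symm.trans sx.2.2))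
    rw [← Finset.card_image_of_injOn hinj]
    refine (card_sqrt_mod_le d hd0 Δ hΔ _ ?_ ?_).trans (Nat.mul_le_mul_right _ (ht d ?_))
    · intro w hw
      obtain ⟨x, hx, rfl⟩ := Finset.mem_image.1 hw
      obtain ⟨u, v, -, -, -, -, -, h, -⟩ := hz x hx
      exact h
    · intro w hw
      obtain ⟨x, hx, rfl⟩ := Finset.mem_image.1 hw
      obtain ⟨u, v, -, -, -, -, -, -, h, -⟩ := hz x hx
      exact h
    · rw [hm']; exact hdm'.mul_left _

/-- The triple `(y₁, y₄, y₂ + y₃)` attached to `(x₀, y₁, y₂, y₃, y₄)`. -/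
def toTriple (x : ℤ × ℤ × ℤ × ℤ × ℤ) : ℤ × ℤ × ℤ := (x.2.1, x.2.2.2.2, x.2.2.1 + x.2.2.2.1)

/-- The defect `y₁y₄ - y₂y₃ - E`. -/
def defect (E : ℤ) (x : ℤ × ℤ × ℤ × ℤ × ℤ) : ℤ :=
  x.2.1 * x.2.2.2.2 - x.2.2.1 * x.2.2.2.1 - E

theorem eq_of_toTriple_eq {E : ℤ} {x z : ℤ × ℤ × ℤ × ℤ × ℤ} (h : toTriple x = toTriple z)
    (hd : defect E x = defect E z) (h0 : x.1 = z.1)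
    (hs : x.2.2.2.1 ≤ x.2.2.1 ↔ z.2.2.2.1 ≤ z.2.2.1) : x = z := by
  obtain ⟨a, b, c, d, e⟩ := x
  obtain ⟨a', b', c', d', e'⟩ := z
  simp only [toTriple, defect, Prod.mk.injEq] at *
  obtain ⟨rfl, rfl, h3⟩ := h
  have hp : c * d = c' * d' := by linarith
  have hsq : (c - d) ^ 2 = (c' - d') ^ 2 := by
    have : (c + d) ^ 2 = (c' + d') ^ 2 := by rw [h3]
    linear_combination this - 4 * hp
  rcases sq_eq_sq_iff_eq_or_eq_neg.1 hsq with h | h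
  · exact ⟨h0, rfl, by omega, by omega, rfl⟩
  · by_cases hcd : d ≤ c
    · have := hs.1 hcd
      exact ⟨h0, rfl, by omega, by omega, rfl⟩
    · have : ¬ d' ≤ c' := fun h' => hcd (hs.2 h')
      omega

theorem card_tuples_le {A B C : ℤ} (hA : 0 < A) (hBA : |B| ≤ A) (hAC : A ≤ C)
    (hprim : Int.gcd (Int.gcd A B) C = 1) (E : ℤ) (hEdef : E = 4 * A * C - B ^ 2) (Δ : ℕ)
    (hΔ : 0 < Δ) (P h : ℕ) (hP : 0 < P) (hh : 0 < h) (hPh : IsCoprime (P : ℤ) (h : ℤ))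
    (hhE : (h : ℤ) ^ 2 ∣ E) (t : ℕ)
    (ht : ∀ n : ℕ, 0 < n → (n : ℤ) ≤ 384 * E ^ 5 → n.divisors.card ≤ t) (α β : ℤ)
    (hq : IsCoprime (A * α ^ 2 + B * α * β + C * β ^ 2) (h : ℤ))
    (S : Finset (ℤ × ℤ × ℤ × ℤ × ℤ))
    (hSE : ∀ x ∈ S, Δ * x.1 ^ 2 = defect E x ^ 2 - 4 * tauForm A B C (toTriple x))
    (hS1 : ∀ x ∈ S, |x.2.1| ≤ 2 * A ∧ |x.2.2.2.2| ≤ 2 * C ∧ x.2.2.1 ^ 2 ≤ 4 * A * C ∧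
      x.2.2.2.1 ^ 2 ≤ 4 * A * C)
    (hSΛ : ∀ x ∈ S, toTriple x ∈ congrLattice A B C α β P h)
    (hSP : ∀ x ∈ S, (P : ℤ) ∣ defect E x)
    (hSh : ∀ x ∈ S, (h : ℤ) ^ 2 ∣ 64 * (defect E x + E)) :
    (S.card : ℝ) ≤ 10000000 * Δ * t ^ 3 *
      (1 + E / ((h : ℝ) ^ 2 * P) + E * √E / ((h : ℝ) ^ 3 * (P : ℝ) ^ 2)) := by
  classical
  have hB2 : B ^ 2 ≤ A ^ 2 := sq_le_sq' (by linarith [(abs_le.1 hBA).1]) (abs_le.1 hBA).2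
  have hC : 0 < C := by linarith
  have hEAC : 3 * (A * C) ≤ E := by nlinarith
  have hE0 : 0 < E := by nlinarith
  have hE1 : 1 ≤ E := hE0
  have hEr : (0 : ℝ) < E := by exact_mod_cast hE0
  have hE0' : 0 < 4 * A * C - B ^ 2 := hEdef ▸ hE0
  have hE5 : E ≤ E ^ 5 := le_self_pow₀ hE1 (by norm_num)
  have hE25 : E ^ 2 ≤ E ^ 5 := pow_le_pow_right₀ hE1 (by norm_num)
  have hdef : ∀ x ∈ S, |defect E x| ≤ 4 * E := by
    intro x hx
    obtain ⟨h1, h2, h3, h4⟩ := hS1 x hx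
    have e1 : |x.2.1 * x.2.2.2.2| ≤ 4 * (A * C) := by
      rw [abs_mul]
      calc |x.2.1| * |x.2.2.2.2| ≤ (2 * A) * (2 * C) := by gcongr
        _ = 4 * (A * C) := by ring
    have e2 : |x.2.2.1 * x.2.2.2.1| ≤ 4 * (A * C) := by
      refine abs_le_of_sq_le_sq ?_ (by positivity)
      calc (x.2.2.1 * x.2.2.2.1) ^ 2 = x.2.2.1 ^ 2 * x.2.2.2.1 ^ 2 := by ring
        _ ≤ (4 * A * C) * (4 * A * C) := by gcongr
        _ = (4 * (A * C)) ^ 2 := by ring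
    obtain ⟨f1, f2⟩ := abs_le.1 e1
    obtain ⟨g1, g2⟩ := abs_le.1 e2
    rw [abs_le, defect]
    constructor <;> linarith
  have hR0 : ∀ x, 0 ≤ tauForm A B C x := tauForm_nonneg hA hE0'
  have hR : ∀ x ∈ S, tauForm A B C (toTriple x) ≤ 4 * E ^ 2 := by
    intro x hx
    have e1 := hSE x hx
    have e2 : defect E x ^ 2 ≤ (4 * E) ^ 2 := by
      rw [← sq_abs]; exact pow_le_pow_left₀ (abs_nonneg _) (hdef x hx) 2
    have : 0 ≤ (Δ : ℤ) * x.1 ^ 2 := by positivity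
    nlinarith
  have ht1 : 1 ≤ t := by
    have := ht 1 one_pos (by push_cast; linarith)
    simpa using this
  obtain ⟨T, hT⟩ : ∃ T, T = S.image toTriple := ⟨_, rfl⟩
  have hTcard : (T.card : ℝ) ≤ 100000 * (1 + E / ((h : ℝ) ^ 2 * P) +
      E * √E / ((h : ℝ) ^ 3 * (P : ℝ) ^ 2)) := by
    have := card_lattice_le hA E hEdef hE0 hprim (congrLattice A B C α β P h) (h ^ 2 * P)
      (h ^ 3 * P ^ 2) (by positivity) (by positivity)
      (fun x hx => tauForm_dvd (hEdef ▸ hhE) hPh hq hx)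
      (fun x hx z hz => tauDet_dvd hprim (hEdef ▸ hhE) hPh hq hx hz) T ?_ ?_ ?_
    · push_cast at this; exact this
    all_goals
      intro x hx
      rw [hT] at hx
      obtain ⟨z, hz, rfl⟩ := Finset.mem_image.1 hx
    · exact hSΛ z hz
    · exact (hS1 z hz).1
    · exact hR z hz
  -- nondegenerate part
  have hcard1 : (S.filter fun x => tauForm A B C (toTriple x) ≠ 0).card ≤
      T.card * (2 * ((4 * (t * t)) * (t * (4 * Δ)))) := by
    refine card_le_of_cover _ T (fun x k => toTriple x = k) _ ?_ ?_
    · intro x hx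
      rw [Finset.mem_filter] at hx
      exact ⟨toTriple x, by rw [hT]; exact Finset.mem_image_of_mem _ hx.1, rfl⟩
    · intro k _ G hG hGk
      rcases G.eq_empty_or_nonempty with rfl | ⟨z, hz⟩
      · simp
      have hGS : ∀ x ∈ G, x ∈ S := fun x hx => (Finset.mem_filter.1 (hG hx)).1
      have hk0 : tauForm A B C k ≠ 0 := hGk z hz ▸ (Finset.mem_filter.1 (hG hz)).2
      have hkE : tauForm A B C k ≤ 4 * E ^ 2 := hGk z hz ▸ hR z (hGS z hz)
      have hk0' := hR0 k
      have hsize : (4 * E).toNat.size + 1 ≤ t := by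
        obtain ⟨s, hs⟩ : ∃ s, s = (4 * E).toNat.size := ⟨_, rfl⟩
        have h1 : 0 < s := by rw [hs]; exact Nat.size_pos.2 (by omega)
        have h2 : 2 ^ (s - 1) ≤ (4 * E).toNat := Nat.lt_size.1 (by omega)
        have h3 : 2 ^ s ≤ 2 * (4 * E).toNat := by
          have : 2 ^ s = 2 * 2 ^ (s - 1) := by rw [← pow_succ']; congr 1; omega
          omega
        have h4 := ht (2 ^ s) (by positivity) (by
          have : ((2 ^ s : ℕ) : ℤ) ≤ ((2 * (4 * E).toNat : ℕ) : ℤ) := by exact_mod_cast h3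
          refine this.trans ?_
          push_cast
          rw [Int.toNat_of_nonneg (by linarith)]
          linarith)
        rw [Nat.divisors_prime_pow Nat.prime_two, Finset.card_map, Finset.card_range, hs] at h4
        exact h4
      have hpell : (G.image fun x => (defect E x, x.1)).card ≤
          (4 * (t * t)) * (t * (4 * Δ)) := by
        refine (card_pell_le Δ hΔ (4 * tauForm A B C k) (by positivity) t (4 * E).toNat ?_ _ ?_ ?_).trans ?_
        · intro n hn
          have hpos : 0 < 4 * tauForm A B C k := by positivity
          have hle := Int.le_of_dvd hpos hn
          refine ht n ?_ (by linarith)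
          rcases Nat.eq_zero_or_pos n with rfl | h'
          · rw [Nat.cast_zero, zero_dvd_iff] at hn; omega
          · exact h'
        · intro w hw
          obtain ⟨x, hx, rfl⟩ := Finset.mem_image.1 hw
          have := hSE x (hGS x hx)
          rw [hGk x hx] at this
          simp only
          linarith
        · intro w hw
          obtain ⟨x, hx, rfl⟩ := Finset.mem_image.1 hw
          rw [Int.toNat_of_nonneg (by linarith)]
          exact hdef x (hGS x hx)
        · gcongr
      have hinj : G.card ≤ ((Finset.univ : Finset Bool) ×ˢ
          (G.image fun x => (defect E x, x.1))).card := by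
        refine Finset.card_le_card_of_injOn
          (fun x => (decide (x.2.2.2.1 ≤ x.2.2.1), (defect E x, x.1))) ?_ ?_
        · intro x hx
          simp only [Finset.coe_product, Set.mem_prod, Finset.mem_coe]
          exact ⟨Finset.mem_univ _, Finset.mem_image_of_mem _ hx⟩
        · intro x hx z hz hxz
          simp only [Prod.mk.injEq, decide_eq_decide] at hxz
          exact eq_of_toTriple_eq ((hGk x hx).trans (hGk z hz).symm) hxz.2.1 hxz.2.2 hxz.1
      rw [Finset.card_product, Finset.card_univ, Fintype.card_bool] at hinj
      exact hinj.trans (Nat.mul_le_mul_left _ hpell)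
  -- degenerate part
  obtain ⟨T₀, hT₀⟩ : ∃ T₀, T₀ = (S.filter fun x => tauForm A B C (toTriple x) = 0).image toTriple :=
    ⟨_, rfl⟩
  have hT₀card : T₀.card ≤ 5 := by
    refine card_tauForm_zero_le hA hE0' hprim T₀ ?_ ?_
    all_goals
      intro x hx
      rw [hT₀] at hx
      obtain ⟨z, hz, rfl⟩ := Finset.mem_image.1 hx
      rw [Finset.mem_filter] at hz
    · exact (hS1 z hz.1).1
    · exact hz.2
  obtain ⟨g, hg⟩ : ∃ g : ℤ, g = h ^ 2 * P := ⟨_, rfl⟩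
  have hg0 : 0 < g := by rw [hg]; positivity
  have hgr : (g : ℝ) = (h : ℝ) ^ 2 * P := by rw [hg]; push_cast; rfl
  have hgr0 : (0 : ℝ) < g := by exact_mod_cast hg0
  have hgd : ∀ x ∈ S, g ∣ 64 * defect E x := by
    intro x hx
    have e1 : (h : ℤ) ^ 2 ∣ 64 * defect E x := by
      refine int_dvd_of_eq (dvd_sub (hSh x hx) (hhE.mul_left 64)) ?_
      ring
    rw [hg]
    exact (hPh.symm.pow_left (m := 2)).mul_dvd e1 ((hSP x hx).mul_left 64)
  have hb : ∀ x ∈ S, |(((64 * defect E x) / g : ℤ) : ℝ)| ≤ 256 * E / g + 1 := by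
    intro x hx
    refine abs_ediv_le hg0 ?_
    have e4 : 256 * E / g * (g : ℝ) = 256 * E := by field_simp
    have : |(defect E x : ℝ)| ≤ 4 * E := by exact_mod_cast hdef x hx
    rw [e4]; push_cast; rw [abs_mul, abs_of_pos (by norm_num : (0 : ℝ) < 64)]; linarith
  have hcard0 : (S.filter fun x => tauForm A B C (toTriple x) = 0).card ≤
      (T₀ ×ˢ (Finset.Icc (-⌊(256 * E / g + 1 : ℝ)⌋) ⌊(256 * E / g + 1 : ℝ)⌋ ×ˢ
        (Finset.univ : Finset (Bool × Bool)))).card := by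
    refine Finset.card_le_card_of_injOn (fun x => (toTriple x, ((64 * defect E x) / g,
      (decide (0 ≤ x.1), decide (x.2.2.2.1 ≤ x.2.2.1))))) ?_ ?_
    · intro x hx
      simp only [Finset.coe_product, Set.mem_prod, Finset.mem_coe] at hx ⊢
      have hxS := (Finset.mem_filter.1 hx).1
      exact ⟨by rw [hT₀]; exact Finset.mem_image_of_mem _ hx, mem_Icc_floor (hb x hxS),
        Finset.mem_univ _⟩
    · intro x hx z hz hxz
      obtain ⟨hxS, hx0⟩ := Finset.mem_filter.1 (Finset.mem_coe.1 hx)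
      obtain ⟨hzS, hz0⟩ := Finset.mem_filter.1 (Finset.mem_coe.1 hz)
      simp only [Prod.mk.injEq, decide_eq_decide] at hxz
      obtain ⟨k1, k2, k3, k4⟩ := hxz
      have e1 : defect E x = defect E z := by
        have h1 := Int.ediv_mul_cancel (hgd x hxS)
        have h2 := Int.ediv_mul_cancel (hgd z hzS)
        rw [k2, h2] at h1
        linarith
      have e2 : (Δ : ℤ) * x.1 ^ 2 = Δ * z.1 ^ 2 := by
        rw [hSE x hxS, hSE z hzS, e1, hx0, hz0]
      have e3 : x.1 ^ 2 = z.1 ^ 2 := mul_left_cancel₀ (by positivity) e2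
      have e4 : x.1 = z.1 := by
        rcases sq_eq_sq_iff_eq_or_eq_neg.1 e3 with h | h <;> omega
      exact eq_of_toTriple_eq k1 e1 e4 k4
  have hc0 : ((S.filter fun x => tauForm A B C (toTriple x) = 0).card : ℝ) ≤
      5 * ((2 * (256 * E / g + 1) + 1) * 4) := by
    refine (Nat.cast_le.2 hcard0).trans ?_
    rw [Finset.card_product, Finset.card_product]
    have c4 : (Finset.univ : Finset (Bool × Bool)).card = 4 := by decide
    rw [c4]
    push_cast
    have : (T₀.card : ℝ) ≤ 5 := by exact_mod_cast hT₀card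
    gcongr
    exact card_Icc_floor_le (by positivity)
  have hc1 : ((S.filter fun x => tauForm A B C (toTriple x) ≠ 0).card : ℝ) ≤
      T.card * (32 * Δ * t ^ 3) := by
    refine (Nat.cast_le.2 hcard1).trans (le_of_eq ?_)
    push_cast; ring
  have hsplit : (S.card : ℝ) = ((S.filter fun x => tauForm A B C (toTriple x) = 0).card : ℝ) +
      ((S.filter fun x => tauForm A B C (toTriple x) ≠ 0).card : ℝ) := by
    rw [← Finset.card_filter_add_card_filter_not (s := S) (fun x => tauForm A B C (toTriple x) = 0)]
    push_cast; rfl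
  rw [hsplit]
  rw [← hgr] at hTcard ⊢
  obtain ⟨W, hW⟩ : ∃ W : ℝ, W = 1 + E / (g : ℝ) + E * √E / ((h : ℝ) ^ 3 * (P : ℝ) ^ 2) := ⟨_, rfl⟩
  rw [← hW] at hTcard ⊢
  have hD1 : (1 : ℝ) ≤ Δ * t ^ 3 := by
    have h1 : (1 : ℝ) ≤ Δ := by exact_mod_cast hΔ
    have h2 : (1 : ℝ) ≤ (t : ℝ) ^ 3 := one_le_pow₀ (by exact_mod_cast ht1)
    nlinarith
  have hEW : E / (g : ℝ) ≤ W := by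
    rw [hW]; have : 0 ≤ E * √E / ((h : ℝ) ^ 3 * (P : ℝ) ^ 2) := by positivity
    linarith
  have h1W : 1 ≤ W := by
    rw [hW]; have : 0 ≤ E * √E / ((h : ℝ) ^ 3 * (P : ℝ) ^ 2) := by positivity
    have : 0 ≤ E / (g : ℝ) := by positivity
    linarith
  have f1 : 5 * ((2 * (256 * E / g + 1) + 1) * 4) ≤ 10300 * W := by
    have : 256 * E / (g : ℝ) = 256 * (E / g) := by ring
    rw [this]; linarith
  have f2 : (T.card : ℝ) * (32 * Δ * t ^ 3) ≤ 100000 * W * (32 * Δ * t ^ 3) := by gcongr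
  have f3 : 10300 * W ≤ 10300 * W * (Δ * t ^ 3) := le_mul_of_one_le_right (by linarith) hD1
  have f4 : 0 ≤ W * (Δ * (t : ℝ) ^ 3) := by positivity
  nlinarith

/-- Two linearly independent vectors spanning a saturated sublattice of `ℤ⁴`. -/
structure IsPrimPair (v w : Fin 4 → ℤ) : Prop where
  indep : ∀ a b : ℤ, a • v + b • w = 0 → a = 0 ∧ b = 0
  sat : ∀ (m a b : ℤ) (u : Fin 4 → ℤ), m ≠ 0 → m • u = a • v + b • w →
    ∃ a' b' : ℤ, u = a' • v + b' • w

theorem IsPrimPair.exists_completion {v w : Fin 4 → ℤ} (hp : IsPrimPair v w) :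
    ∃ y z : Fin 4 → ℤ, (Matrix.of ![v, w, y, z]).det = 1 := by
  have hli : LinearIndependent ℤ ![v, w] := LinearIndependent.pair_iff.2 hp.indep
  let S : Submodule ℤ (Fin 4 → ℤ) := Submodule.span ℤ (Set.range ![v, w])
  let bS : Module.Basis (Fin 2) ℤ S := Module.Basis.span hli
  have hmem : ∀ u, u ∈ S ↔ ∃ a b : ℤ, a • v + b • w = u := by
    intro u
    have : Set.range ![v, w] = {v, w} := by simp [Matrix.range_cons, Matrix.range_empty, Set.pair_comm]
    simp only [S, this, Submodule.mem_span_pair]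
  have htf : Module.IsTorsionFree ℤ ((Fin 4 → ℤ) ⧸ S) := by
    refine Module.isTorsionFree_iff_smul_eq_zero.2 ?_
    intro m u
    induction u using Submodule.Quotient.induction_on with
    | _ u =>
      rw [← Submodule.Quotient.mk_smul, Submodule.Quotient.mk_eq_zero,
        Submodule.Quotient.mk_eq_zero, hmem, hmem]
      rintro ⟨a, b, hab⟩
      by_cases hm : m = 0
      · exact Or.inl hm
      · obtain ⟨a', b', h⟩ := hp.sat m a b u hm hab.symm
        exact Or.inr ⟨a', b', h.symm⟩
  have hfree : Module.Free ℤ ((Fin 4 → ℤ) ⧸ S) := inferInstance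
  let bQ := Module.Free.chooseBasis ℤ ((Fin 4 → ℤ) ⧸ S)
  let b := Module.Basis.sumQuot bS bQ
  have hcard : Fintype.card (Module.Free.ChooseBasisIndex ℤ ((Fin 4 → ℤ) ⧸ S)) = 2 := by
    have h1 := Module.finrank_eq_card_basis b
    simp at h1
    omega
  let e : Fin 2 ⊕ Module.Free.ChooseBasisIndex ℤ ((Fin 4 → ℤ) ⧸ S) ≃ Fin 4 :=
    (Equiv.sumCongr (Equiv.refl _) (Fintype.equivFinOfCardEq hcard)).trans finSumFinEquiv
  let b' := b.reindex e
  have e0 : e.symm 0 = Sum.inl 0 := by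
    rw [Equiv.symm_apply_eq]; rfl
  have e1 : e.symm 1 = Sum.inl 1 := by
    rw [Equiv.symm_apply_eq]; rfl
  have h0 : b' 0 = v := by
    simp [b', b, e0, bS]; exact congrArg Subtype.val (Module.Basis.span_apply hli 0)
  have h1 : b' 1 = w := by
    simp [b', b, e1, bS]; exact congrArg Subtype.val (Module.Basis.span_apply hli 1)
  have hu : IsUnit ((Pi.basisFun ℤ (Fin 4)).det b') :=
    (Pi.basisFun ℤ (Fin 4)).isUnit_det b'
  rw [Pi.basisFun_det] at hu
  have hb : (b' : Fin 4 → Fin 4 → ℤ) = ![v, w, b' 2, b' 3] := by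
    funext i; fin_cases i <;> simp [h0, h1]
  rw [hb] at hu
  generalize b' 2 = y, b' 3 = z at hu
  have hu' : IsUnit (Matrix.of ![v, w, y, z]).det := hu
  rcases Int.isUnit_iff.1 hu' with h | h
  · exact ⟨_, _, h⟩
  · refine ⟨y, -z, ?_⟩
    have h3 : (Matrix.of ![v, w, y, z]).updateRow 3 z = Matrix.of ![v, w, y, z] := by
      ext i j; fin_cases i <;> simp [updateRow_apply]
    have : (Matrix.of ![v, w, y, -z]) = (Matrix.of ![v, w, y, z]).updateRow 3 ((-1 : ℤ) • z) := by
      ext i j; fin_cases i <;> simp [updateRow_apply]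
    rw [this, det_updateRow_smul, h3, h]; norm_num

theorem det_change_basis (v w y z : Fin 4 → ℤ) (a b c d e g : ℤ) :
    (Matrix.of ![v, w, a • v + b • w + c • y + d • z, e • y + g • z]).det =
      (c * g - d * e) * (Matrix.of ![v, w, y, z]).det := by
  have h : Matrix.of ![v, w, a • v + b • w + c • y + d • z, e • y + g • z] =
      !![1, 0, 0, 0; 0, 1, 0, 0; a, b, c, d; 0, 0, e, g] * Matrix.of ![v, w, y, z] := by
    ext i j
    fin_cases i <;> simp [Matrix.mul_apply, Fin.sum_univ_succ] <;> ring
  rw [h, det_mul]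
  congr 1
  simp [det_succ_row_zero, Fin.sum_univ_succ, Fin.succAbove]
  ring

theorem exists_coordinates {v w y z : Fin 4 → ℤ} (h : (Matrix.of ![v, w, y, z]).det = 1)
    (u : Fin 4 → ℤ) : ∃ a b c d : ℤ, u = a • v + b • w + c • y + d • z := by
  have hM : IsUnit (Matrix.of ![v, w, y, z]).det := by rw [h]; exact isUnit_one
  let x := u ᵥ* (Matrix.of ![v, w, y, z])⁻¹
  have hx : x ᵥ* Matrix.of ![v, w, y, z] = u := by
    rw [vecMul_vecMul, nonsing_inv_mul _ hM, vecMul_one]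
  refine ⟨x 0, x 1, x 2, x 3, ?_⟩
  ext j
  rw [← congrFun hx j]
  simp [vecMul, dotProduct, Fin.sum_univ_succ]
  ring

theorem exists_primitive_combination {v w u₁ u₂ : Fin 4 → ℤ} (hp : IsPrimPair v w)
    (hne : ¬ ((∃ a b : ℤ, u₁ = a • v + b • w) ∧ ∃ a b : ℤ, u₂ = a • v + b • w)) (f : ℕ)
    (hf : 0 < f) :
    ∃ h : ℕ, h ∣ f ∧ (∃ a b : ℤ, ∃ z : Fin 4 → ℤ, u₁ = a • v + b • w + (h : ℤ) • z) ∧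
      (∃ a b : ℤ, ∃ z : Fin 4 → ℤ, u₂ = a • v + b • w + (h : ℤ) • z) ∧
      ∃ i j c : ℕ, ∃ α₁ α₂ : ℤ, ∃ z y : Fin 4 → ℤ, i ∣ 2 * f ∧ j ∣ 2 * f ∧ 0 < c ∧
      Nat.gcd c f = h ∧ 0 ≤ α₁ ∧ α₁ < c ∧ 0 ≤ α₂ ∧ α₂ < c ∧
      (i : ℤ) • u₁ + (j : ℤ) • u₂ = α₁ • v + α₂ • w + (c : ℤ) • z ∧
      (Matrix.of ![v, w, z, y]).det = 1 := by
  obtain ⟨y₀, z₀, hdet⟩ := hp.exists_completion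
  obtain ⟨a₁, b₁, c₁, d₁, e₁⟩ := exists_coordinates hdet u₁
  obtain ⟨a₂, b₂, c₂, d₂, e₂⟩ := exists_coordinates hdet u₂
  obtain ⟨i, j, h, hi, hj, hhf, ⟨k1, k2, k3, k4⟩, hnz, hg⟩ :=
    exists_combination_gcd f hf c₁ d₁ c₂ d₂ (by
      rintro ⟨rfl, rfl, rfl, rfl⟩
      exact hne ⟨⟨a₁, b₁, by simp [e₁]⟩, ⟨a₂, b₂, by simp [e₂]⟩⟩)
  refine ⟨h, hhf, ?_, ?_, ?_⟩
  · obtain ⟨k, hk⟩ := k1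
    obtain ⟨l, hl⟩ := k2
    exact ⟨a₁, b₁, k • y₀ + l • z₀, by rw [e₁, hk, hl]; module⟩
  · obtain ⟨k, hk⟩ := k3
    obtain ⟨l, hl⟩ := k4
    exact ⟨a₂, b₂, k • y₀ + l • z₀, by rw [e₂, hk, hl]; module⟩
  obtain ⟨r, hr⟩ : ∃ r, r = i * c₁ + j * c₂ := ⟨_, rfl⟩
  obtain ⟨s, hs⟩ : ∃ s, s = i * d₁ + j * d₂ := ⟨_, rfl⟩
  rw [← hr, ← hs] at hnz hg
  have hgpos : 0 < Int.gcd r s := Nat.pos_of_ne_zero fun h0 => hnz (Int.gcd_eq_zero_iff.1 h0)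
  obtain ⟨r', s', hco, hr', hs'⟩ := Int.exists_gcd_one hgpos
  obtain ⟨c, hc⟩ : ∃ c, c = Int.gcd r s := ⟨_, rfl⟩
  rw [← hc] at hg hgpos hr' hs'
  obtain ⟨k, l, hkl⟩ := Int.isCoprime_iff_gcd_eq_one.2 hco
  obtain ⟨a, ha⟩ : ∃ a, a = i * a₁ + j * a₂ := ⟨_, rfl⟩
  obtain ⟨b, hb⟩ : ∃ b, b = i * b₁ + j * b₂ := ⟨_, rfl⟩
  have hcz : (0 : ℤ) < c := by exact_mod_cast hgpos
  refine ⟨i, j, c, a % c, b % c, (a / c) • v + (b / c) • w + r' • y₀ + s' • z₀,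
    (-l) • y₀ + k • z₀, hi, hj, hgpos, by simpa using hg, Int.emod_nonneg _ hcz.ne',
    Int.emod_lt_of_pos _ hcz, Int.emod_nonneg _ hcz.ne', Int.emod_lt_of_pos _ hcz, ?_, ?_⟩
  · have h1 : a % c + c * (a / c) = a := Int.emod_add_mul_ediv a c
    have h2 : b % c + c * (b / c) = b := Int.emod_add_mul_ediv b c
    have : (a % c) • v + (b % c) • w +
        (c : ℤ) • ((a / c) • v + (b / c) • w + r' • y₀ + s' • z₀) =
        (a % c + c * (a / c)) • v + (b % c + c * (b / c)) • w + (r' * c) • y₀ + (s' * c) • z₀ := by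
      module
    rw [this, h1, h2, ← hr', ← hs', ha, hb, hr, hs, e₁, e₂]
    module
  · rw [det_change_basis, hdet]; linarith

/-- If a primitive pair is congruent to combinations of another pair, then this relation can be
inverted. -/
theorem IsPrimPair.exists_inverse_mod {v w u₁ u₂ : Fin 4 → ℤ} (hp : IsPrimPair u₁ u₂) (h : ℤ)
    {a b c d : ℤ} {z₁ z₂ : Fin 4 → ℤ} (e₁ : u₁ = a • v + b • w + h • z₁)
    (e₂ : u₂ = c • v + d • w + h • z₂) :
    (∃ a' b' : ℤ, ∃ z : Fin 4 → ℤ, v = a' • u₁ + b' • u₂ + h • z) ∧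
      ∃ a' b' : ℤ, ∃ z : Fin 4 → ℤ, w = a' • u₁ + b' • u₂ + h • z := by
  obtain ⟨y, z, hdet⟩ := hp.exists_completion
  obtain ⟨p₁, q₁, r₁, s₁, hv⟩ := exists_coordinates hdet v
  obtain ⟨p₂, q₂, r₂, s₂, hw⟩ := exists_coordinates hdet w
  obtain ⟨p₃, q₃, r₃, s₃, h3⟩ := exists_coordinates hdet z₁
  obtain ⟨p₄, q₄, r₄, s₄, h4⟩ := exists_coordinates hdet z₂
  have hind := indep_of_det_ne_zero u₁ u₂ y z (by rw [hdet]; norm_num)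
  obtain ⟨i1, i2, i3, i4⟩ := hind (a * p₁ + b * p₂ + h * p₃ - 1) (a * q₁ + b * q₂ + h * q₃)
    (a * r₁ + b * r₂ + h * r₃) (a * s₁ + b * s₂ + h * s₃) (by
      have : a • v + b • w + h • z₁ - u₁ = 0 := by rw [← e₁, sub_self]
      rw [← this]; rw [hv, hw, h3]; module)
  obtain ⟨j1, j2, j3, j4⟩ := hind (c * p₁ + d * p₂ + h * p₄) (c * q₁ + d * q₂ + h * q₄ - 1)
    (c * r₁ + d * r₂ + h * r₄) (c * s₁ + d * s₂ + h * s₄) (by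
      have : c • v + d • w + h • z₂ - u₂ = 0 := by rw [← e₂, sub_self]
      rw [← this]; rw [hv, hw, h4]; module)
  have hu : h ∣ 1 - (a * d - b * c) * (p₁ * q₂ - p₂ * q₁) :=
    ⟨p₃ + q₄ - h * p₃ * q₄ + h * q₃ * p₄, by
      linear_combination (-(c * q₁ + d * q₂)) * i1 - (1 - h * p₃) * j2 +
        (c * p₁ + d * p₂) * i2 - h * q₃ * j1⟩
  have hdvd : ∀ r r' x x', a * r + b * r' + h * x = 0 → c * r + d * r' + h * x' = 0 →
      h ∣ r ∧ h ∣ r' := by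
    intro r r' x x' k1 k2
    obtain ⟨m, hm⟩ := hu
    constructor
    · exact ⟨m * r + (p₁ * q₂ - p₂ * q₁) * (b * x' - d * x), by
        linear_combination r * hm + (p₁ * q₂ - p₂ * q₁) * (d * k1 - b * k2)⟩
    · exact ⟨m * r' + (p₁ * q₂ - p₂ * q₁) * (c * x - a * x'), by
        linear_combination r' * hm + (p₁ * q₂ - p₂ * q₁) * (a * k2 - c * k1)⟩
  obtain ⟨⟨k1, hk1⟩, ⟨k2, hk2⟩⟩ := hdvd _ _ _ _ i3 j3
  obtain ⟨⟨l1, hl1⟩, ⟨l2, hl2⟩⟩ := hdvd _ _ _ _ i4 j4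
  exact ⟨⟨p₁, q₁, k1 • y + l1 • z, by rw [hv, hk1, hl1]; module⟩,
    ⟨p₂, q₂, k2 • y + l2 • z, by rw [hw, hk2, hl2]; module⟩⟩

theorem IsIntegralPosDefForm.exists_isPD {MQ : Matrix (Fin 4) (Fin 4) ℚ}
    (hQ : IsIntegralPosDefForm MQ) :
    ∃ N : Matrix (Fin 4) (Fin 4) ℤ, (∀ i j, 2 * MQ i j = N i j) ∧ IsPD N ∧
      ∀ v, (2 : ℤ) ∣ bl N v v := by
  obtain ⟨hs, hd, ho, hp⟩ := hQ
  choose N hN using ho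
  choose z hz using hd
  have hsym : ∀ i j, N i j = N j i := fun i j => by
    have := hs.apply i j
    have h1 := hN i j
    have h2 := hN j i
    rw [this] at h2
    exact_mod_cast h1.symm.trans h2
  refine ⟨Matrix.of N, hN, ⟨?_, ?_⟩, ?_⟩
  · ext i j; exact hsym j i
  · intro v hv
    have h1 := hp (fun i => (v i : ℚ)) (fun h => hv (by
      ext i; exact Int.cast_injective (α := ℚ) (congrFun h i)))
    have : (bl (Matrix.of N) v v : ℚ) =
        2 * ((fun i => (v i : ℚ)) ⬝ᵥ MQ *ᵥ fun i => (v i : ℚ)) := by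
      simp only [bl, dotProduct, mulVec, Finset.mul_sum, Int.cast_sum, Int.cast_mul, of_apply]
      refine Finset.sum_congr rfl fun i _ => Finset.sum_congr rfl fun j _ => ?_
      rw [← hN]; ring
    have h2 : (0 : ℚ) < bl (Matrix.of N) v v := by rw [this]; linarith
    exact_mod_cast h2
  · intro v
    have hdiag : ∀ i, N i i = 2 * z i := fun i => by
      have := hN i i
      rw [hz] at this
      exact_mod_cast this.symm
    have : bl (Matrix.of N) v v = 2 * (z 0 * v 0 ^ 2 + z 1 * v 1 ^ 2 + z 2 * v 2 ^ 2 +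
        z 3 * v 3 ^ 2 + N 0 1 * v 0 * v 1 + N 0 2 * v 0 * v 2 + N 0 3 * v 0 * v 3 +
        N 1 2 * v 1 * v 2 + N 1 3 * v 1 * v 3 + N 2 3 * v 2 * v 3) := by
      simp only [bl, dotProduct, mulVec, Fin.sum_univ_four, of_apply]
      rw [hdiag 0, hdiag 1, hdiag 2, hdiag 3, hsym 1 0, hsym 2 0, hsym 2 1, hsym 3 0, hsym 3 1,
        hsym 3 2]
      ring
    exact ⟨_, this⟩

theorem cast_bl {MQ : Matrix (Fin 4) (Fin 4) ℚ} {N : Matrix (Fin 4) (Fin 4) ℤ}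
    (hMN : ∀ i j, 2 * MQ i j = N i j) (v w : Fin 4 → ℤ) :
    (bl N v w : ℚ) = 2 * (intCastVec v ⬝ᵥ MQ *ᵥ intCastVec w) := by
  simp only [bl, dotProduct, mulVec, Finset.mul_sum, Int.cast_sum, Int.cast_mul, intCastVec]
  refine Finset.sum_congr rfl fun i _ => Finset.sum_congr rfl fun j _ => ?_
  rw [← hMN]; ring

theorem cast_det_eq {MQ : Matrix (Fin 4) (Fin 4) ℚ} {N : Matrix (Fin 4) (Fin 4) ℤ}
    (hMN : ∀ i j, 2 * MQ i j = N i j): (N.det : ℚ) = 16 * MQ.det := by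
  have : N.map (Int.cast : ℤ → ℚ) = (2 : ℚ) • MQ := by
    ext i j; simp [hMN]
  have h := (Int.castRingHom ℚ).map_det N
  simp only [eq_intCast, RingHom.mapMatrix_apply, Int.coe_castRingHom] at h
  rw [h, this, det_smul]; norm_num

theorem IsRep.bl_eq {MQ : Matrix (Fin 4) (Fin 4) ℚ} {N : Matrix (Fin 4) (Fin 4) ℤ}
    (hMN : ∀ i j, 2 * MQ i j = N i j) {A B C : ℤ} {ι : Matrix (Fin 4) (Fin 2) ℤ} (h : IsRep MQ A B C ι) :
    bl N (ιᵀ 0) (ιᵀ 0) = 2 * A ∧ bl N (ιᵀ 0) (ιᵀ 1) = B ∧ bl N (ιᵀ 1) (ιᵀ 1) = 2 * C := by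
  have key : ∀ i j : Fin 2, (bl N (ιᵀ i) (ιᵀ j) : ℚ) =
      2 * !![(A : ℚ), (B : ℚ) / 2; (B : ℚ) / 2, (C : ℚ)] i j := by
    intro i j
    rw [cast_bl hMN, ← h, Matrix.mul_assoc, Matrix.mul_apply]
    rfl
  have h0 := key 0 0
  have h1 := key 0 1
  have h2 := key 1 1
  simp at h0 h1 h2
  refine ⟨by exact_mod_cast h0, ?_, by exact_mod_cast h2⟩
  rw [mul_div_cancel₀ _ two_ne_zero] at h1
  exact_mod_cast h1

theorem IsPrimitiveRep.isPrimPair {MQ : Matrix (Fin 4) (Fin 4) ℚ} {N : Matrix (Fin 4) (Fin 4) ℤ}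
    (hMN : ∀ i j, 2 * MQ i j = N i j) (hN : IsPD N) {A B C : ℤ} (hE : 0 < 4 * A * C - B ^ 2)
    {ι : Matrix (Fin 4) (Fin 2) ℤ}
    (h : IsPrimitiveRep MQ A B C ι) : IsPrimPair (ιᵀ 0) (ιᵀ 1) := by
  obtain ⟨h00, h01, h11⟩ := h.1.bl_eq hMN
  refine ⟨fun a b hab => ?_, fun m a b u hm hu => ?_⟩
  · have e1 : bl N (ιᵀ 0) (a • ιᵀ 0 + b • ιᵀ 1) = 0 := by rw [hab, bl_zero_right]
    have e2 : bl N (ιᵀ 1) (a • ιᵀ 0 + b • ιᵀ 1) = 0 := by rw [hab, bl_zero_right]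
    rw [bl_add_right, bl_smul_right, bl_smul_right] at e1 e2
    rw [bl_comm hN (ιᵀ 1) (ιᵀ 0)] at e2
    rw [h00, h01] at e1
    rw [h01, h11] at e2
    constructor
    · have : (4 * A * C - B ^ 2) * a = 0 := by linear_combination 2 * C * e1 - B * e2
      exact (mul_eq_zero.1 this).resolve_left hE.ne'
    · have : (4 * A * C - B ^ 2) * b = 0 := by linear_combination 2 * A * e2 - B * e1
      exact (mul_eq_zero.1 this).resolve_left hE.ne'
  · obtain ⟨w, hw⟩ := h.2 u (by
      have : intCastVec u = ((a : ℚ) / m) • (intCastVec fun i => ι i 0) +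
          ((b : ℚ) / m) • (intCastVec fun i => ι i 1) := by
        ext i
        have h1 := congrFun hu i
        have hm' : (m : ℚ) ≠ 0 := by exact_mod_cast hm
        simp only [Pi.smul_apply, Pi.add_apply, smul_eq_mul, transpose_apply] at h1
        simp only [Pi.smul_apply, Pi.add_apply, smul_eq_mul, intCastVec]
        field_simp
        rw [mul_comm]
        exact_mod_cast h1
      rw [this]
      exact add_mem (Submodule.smul_mem _ _ (Submodule.subset_span ⟨0, rfl⟩))
        (Submodule.smul_mem _ _ (Submodule.subset_span ⟨1, rfl⟩)))
    refine ⟨w 0, w 1, ?_⟩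
    rw [← hw]
    ext i
    simp [mulVec, dotProduct, Fin.sum_univ_two, mul_comm]

theorem pcong_of_dvd {p : ℕ} [Fact p.Prime] {k m : ℕ} {a b : ℚ} {z : ℤ} (hpm : ¬ p ∣ m)
    (h : m * (a - b) = z) (hz : (p : ℤ) ^ k ∣ z) : PCong p k a b := by
  by_cases hab : a = b
  · exact Or.inl hab
  right
  have hm0 : (m : ℚ) ≠ 0 := by
    rintro h0
    exact hpm (by rw [Nat.cast_eq_zero.1 h0]; exact dvd_zero p)
  have hz0 : z ≠ 0 := by
    rintro rfl
    rw [Int.cast_zero, mul_eq_zero] at h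
    exact h.elim hm0 (sub_ne_zero.2 hab)
  have h1 : padicValRat p (m * (a - b)) = padicValRat p (a - b) := by
    rw [padicValRat.mul hm0 (sub_ne_zero.2 hab), padicValRat.of_nat,
      padicValNat.eq_zero_of_not_dvd hpm]
    simp
  rw [← h1, h, padicValRat.of_int]
  have := (padicValInt_dvd_iff k z).1 (by exact_mod_cast hz)
  exact_mod_cast this.resolve_left hz0

/-- The determinant and the four mixed inner products of a pair of pairs of vectors. -/
def repTuple (N : Matrix (Fin 4) (Fin 4) ℤ) (P : Fin 4 → Fin 4 → ℤ) : ℤ × ℤ × ℤ × ℤ × ℤ :=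
  ((Matrix.of ![P 0, P 1, P 2, P 3]).det, bl N (P 0) (P 2), bl N (P 0) (P 3), bl N (P 1) (P 2),
    bl N (P 1) (P 3))

theorem IsRepPair.gram_eq {N : Matrix (Fin 4) (Fin 4) ℤ} (hN : IsPD N) {A B C : ℤ}
    {P : Fin 4 → Fin 4 → ℤ} (hP : IsRepPair N A B C P) :
    N.det * (repTuple N P).1 ^ 2 = defect (4 * A * C - B ^ 2) (repTuple N P) ^ 2 -
      4 * tauForm A B C (toTriple (repTuple N P)) := by
  have h := gram_det (N := N) (Matrix.of ![P 0, P 1, P 2, P 3])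
  rw [mul_comm] at h
  simp only [repTuple]
  rw [← h, gram_of_vec hN, hP.h00, hP.h01, hP.h11, hP.h22, hP.h23, hP.h33]
  simp [defect, toTriple, tauForm, det_succ_row_zero, Fin.sum_univ_succ, Fin.succAbove]
  ring

theorem IsRepPair.bounds {N : Matrix (Fin 4) (Fin 4) ℤ} (hN : IsPD N) {A B C : ℤ} (hA : 0 < A)
    (hC : 0 < C) {P : Fin 4 → Fin 4 → ℤ} (hP : IsRepPair N A B C P) :
    |bl N (P 0) (P 2)| ≤ 2 * A ∧ |bl N (P 1) (P 3)| ≤ 2 * C ∧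
      bl N (P 0) (P 3) ^ 2 ≤ 4 * A * C ∧ bl N (P 1) (P 2) ^ 2 ≤ 4 * A * C := by
  have h1 := bl_sq_le hN (P 0) (P 2)
  have h2 := bl_sq_le hN (P 1) (P 3)
  have h3 := bl_sq_le hN (P 0) (P 3)
  have h4 := bl_sq_le hN (P 1) (P 2)
  rw [hP.h00, hP.h22] at h1
  rw [hP.h11, hP.h33] at h2
  rw [hP.h00, hP.h33] at h3
  rw [hP.h11, hP.h22] at h4
  refine ⟨abs_le_of_sq_le_sq (by linarith) (by linarith),
    abs_le_of_sq_le_sq (by linarith) (by linarith), by linarith, by linarith⟩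

theorem IsRepPair.eq_of_eq {N : Matrix (Fin 4) (Fin 4) ℤ} (hN : IsPD N) {A B C : ℤ}
    {P : Fin 4 → Fin 4 → ℤ} (hP : IsRepPair N A B C P)
    (h : bl N (P 0) (P 2) = 2 * A ∨ bl N (P 1) (P 3) = 2 * C) :
    (repTuple N P).1 = 0 ∧ bl N (P 0) (P 3) = B ∧ bl N (P 1) (P 2) = B := by
  rcases h with h | h
  · have e : P 0 = P 2 := by
      rw [← sub_eq_zero]
      refine eq_zero_of_bl_self hN ?_
      rw [bl_sub_left, bl_sub_right, bl_sub_right, bl_comm hN (P 2) (P 0), hP.h00, hP.h22, h]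
      ring
    refine ⟨det_zero_of_row_eq (i := 0) (j := 2) (by decide) (by simp only [e]; rfl), ?_, ?_⟩
    · rw [e, hP.h23]
    · rw [← e, bl_comm hN, hP.h01]
  · have e : P 1 = P 3 := by
      rw [← sub_eq_zero]
      refine eq_zero_of_bl_self hN ?_
      rw [bl_sub_left, bl_sub_right, bl_sub_right, bl_comm hN (P 3) (P 1), hP.h11, hP.h33, h]
      ring
    refine ⟨det_zero_of_row_eq (i := 1) (j := 3) (by decide) (by simp only [e]; rfl), ?_, ?_⟩
    · rw [← e, hP.h01]
    · rw [e, bl_comm hN, hP.h23]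

theorem IsRepPair.eq_of_eq_neg {N : Matrix (Fin 4) (Fin 4) ℤ} (hN : IsPD N) {A B C : ℤ}
    {P : Fin 4 → Fin 4 → ℤ} (hP : IsRepPair N A B C P)
    (h : bl N (P 0) (P 2) = -(2 * A) ∨ bl N (P 1) (P 3) = -(2 * C)) :
    (repTuple N P).1 = 0 ∧ bl N (P 0) (P 3) = -B ∧ bl N (P 1) (P 2) = -B := by
  have hP' : IsRepPair N A B C ![P 0, P 1, -P 2, -P 3] := by
    refine ⟨hP.h00, hP.h01, hP.h11, ?_, ?_, ?_⟩ <;>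
      simp [bl_neg_left, bl_neg_right, hP.h22, hP.h23, hP.h33]
  obtain ⟨h0, h1, h2⟩ := hP'.eq_of_eq hN (by
    simp only [cons_val_zero, cons_val_one, cons_val, bl_neg_right]
    omega)
  simp only [cons_val_zero, cons_val_one, cons_val, bl_neg_right] at h1 h2
  refine ⟨?_, by omega, by omega⟩
  rw [← h0]
  simp [repTuple, det_succ_row_zero, Fin.sum_univ_succ, Fin.succAbove]

/-- The half-integral tuple attached to an integral tuple. -/
def halfTuple (x : ℤ × ℤ × ℤ × ℤ × ℤ) : Fin 5 → ℚ :=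
  ![(x.1 : ℚ), x.2.1 / 2, x.2.2.1 / 2, x.2.2.2.1 / 2, x.2.2.2.2 / 2]

theorem halfTuple_injective : Function.Injective halfTuple := by
  rintro ⟨a, b, c, d, e⟩ ⟨a', b', c', d', e'⟩ h
  have h0 := congrFun h 0
  have h1 := congrFun h 1
  have h2 := congrFun h 2
  have h3 := congrFun h 3
  have h4 := congrFun h 4
  simp [halfTuple] at h0 h1 h2 h3 h4
  simp [h0, h1, h2, h3, h4]

theorem IsRepPair.halfTuple_mem {MQ : Matrix (Fin 4) (Fin 4) ℚ} {N : Matrix (Fin 4) (Fin 4) ℤ}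
    (hMN : ∀ i j, 2 * MQ i j = N i j) (hN : IsPD N) {A B C : ℤ} (hA : 0 < A) (hC : 0 < C)
    {P : Fin 4 → Fin 4 → ℤ} (hP : IsRepPair N A B C P) {p n : ℕ} [hp : Fact p.Prime] (hp2 : p ≠ 2)
    (hd : (p : ℤ) ^ (4 * n) ∣ defect (4 * A * C - B ^ 2) (repTuple N P))
    (h1 : (p : ℤ) ^ (4 * n) ∣ C * (toTriple (repTuple N P)).1 - A * (toTriple (repTuple N P)).2.1)
    (h2 : (p : ℤ) ^ (4 * n) ∣ B * (toTriple (repTuple N P)).1 - A * (toTriple (repTuple N P)).2.2)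
    (h3 : (p : ℤ) ^ (4 * n) ∣ B * (toTriple (repTuple N P)).2.1 -
      C * (toTriple (repTuple N P)).2.2) :
    halfTuple (repTuple N P) ∈ SSetQ MQ A B C p n := by
  have hE := hP.gram_eq hN
  have hb := hP.bounds hN hA hC
  have hs := hP.eq_of_eq hN
  have hs' := hP.eq_of_eq_neg hN
  have hdet := cast_det_eq hMN
  have hp2' : ¬ p ∣ 2 := fun h => hp2 ((Nat.prime_dvd_prime_iff_eq hp.out Nat.prime_two).1 h)
  have hp4 : ¬ p ∣ 4 := fun h => hp2' (hp.out.dvd_of_dvd_pow (n := 2) (by simpa using h))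
  obtain ⟨x₀, hx₀⟩ : ∃ x₀, x₀ = (repTuple N P).1 := ⟨_, rfl⟩
  simp only [defect, toTriple, tauForm] at hE hd h1 h2 h3
  rw [← hx₀] at hE hs hs'
  have e0 : halfTuple (repTuple N P) = ![(x₀ : ℚ), (bl N (P 0) (P 2) : ℚ) / 2,
    (bl N (P 0) (P 3) : ℚ) / 2, (bl N (P 1) (P 2) : ℚ) / 2, (bl N (P 1) (P 3) : ℚ) / 2] := by
    rw [hx₀]; rfl
  simp only [repTuple] at hE hd h1 h2 h3
  rw [e0]
  generalize bl N (P 0) (P 2) = y₁ at *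
  generalize bl N (P 0) (P 3) = y₂ at *
  generalize bl N (P 1) (P 2) = y₃ at *
  generalize bl N (P 1) (P 3) = y₄ at *
  obtain ⟨b1, b4, b2, b3⟩ := hb
  have b1' : |(y₁ : ℚ)| ≤ 2 * A := by exact_mod_cast b1
  have b4' : |(y₄ : ℚ)| ≤ 2 * C := by exact_mod_cast b4
  have b2' : (y₂ : ℚ) ^ 2 ≤ 4 * A * C := by exact_mod_cast b2
  have b3' : (y₃ : ℚ) ^ 2 ≤ 4 * A * C := by exact_mod_cast b3
  have hE' : (N.det : ℚ) * x₀ ^ 2 = (y₁ * y₄ - y₂ * y₃ - (4 * A * C - B ^ 2)) ^ 2 -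
    4 * ((C * y₁ - A * y₄) ^ 2 + (B * y₁ - A * (y₂ + y₃)) * (B * y₄ - C * (y₂ + y₃))) := by
    exact_mod_cast hE
  simp only [SSetQ, Set.mem_ofPred_eq, SMem, cons_val_zero, cons_val_one, cons_val]
  refine ⟨⟨2 * x₀, by push_cast; ring⟩, ⟨y₁, by ring⟩, ⟨y₂, by ring⟩, ⟨y₃, by ring⟩, ⟨y₄, by ring⟩,
    ?_, ?_, ?_, by linarith, by linarith, ?_, ?_, ?_, ?_, ?_, ?_⟩
  · rw [hdet] at hE'; linear_combination hE' / 16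
  · rw [abs_div, abs_two]; linarith
  · rw [abs_div, abs_two]; linarith
  · exact pcong_of_dvd hp4 (m := 4) (by push_cast; ring) hd
  · exact pcong_of_dvd hp2' (m := 2) (by push_cast; ring) h1
  · exact pcong_of_dvd hp2' (m := 2) (by push_cast; ring) ((dvd_neg).2 h3)
  · exact pcong_of_dvd hp2' (m := 2) (by push_cast; ring) ((dvd_neg).2 h2)
  · intro h
    obtain ⟨k0, k2, k3⟩ := hs (by
      refine h.imp (fun h => ?_) (fun h => ?_)
      · have : (y₁ : ℚ) = 2 * A := by linarith
        exact_mod_cast this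
      · have : (y₄ : ℚ) = 2 * C := by linarith
        exact_mod_cast this)
    simp [k0, k2, k3]
  · intro h
    obtain ⟨k0, k2, k3⟩ := hs' (by
      refine h.imp (fun h => ?_) (fun h => ?_)
      · have : (y₁ : ℚ) = -(2 * A) := by linarith
        exact_mod_cast this
      · have : (y₄ : ℚ) = -(2 * C) := by linarith
        exact_mod_cast this)
    simp [k0, k2, k3, neg_div]

/-- An isometry fixing the orthogonal complement of a unimodular-up-to-units sublattice preserves
that sublattice. -/
theorem exists_restriction {R : Type*} [CommRing R] [IsDomain R] {N k : Matrix (Fin 4) (Fin 4) R}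
    {i₁ : Matrix (Fin 4) (Fin 2) R} {q a : Matrix (Fin 2) (Fin 2) R} {E : R} (hE : IsUnit E)
    (hN : Nᵀ = N) (hdet : N.det ≠ 0) (hq : i₁ᵀ * N * i₁ = q) (ha : a * q = E • 1)
    (ha' : q * a = E • 1) (hsymm : aᵀ = a) (hk : kᵀ * N * k = N)
    (hkdet : k.det = 1) (hkS : ∀ S : Matrix (Fin 4) (Fin 4) R, i₁ᵀ * N * S = 0 → k * S = S) :
    ∃ K : Matrix (Fin 2) (Fin 2) R, k * i₁ = i₁ * K ∧ Kᵀ * q * K = q ∧ K.det = 1 := by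
  obtain ⟨u, rfl⟩ := hE
  obtain ⟨S, hS⟩ : ∃ S, S = (u : R) • (1 : Matrix (Fin 4) (Fin 4) R) - i₁ * a * (i₁ᵀ * N) :=
    ⟨_, rfl⟩
  have h1 : i₁ᵀ * N * S = 0 := by
    have : i₁ᵀ * N * (i₁ * a * (i₁ᵀ * N)) = (i₁ᵀ * N * i₁) * a * (i₁ᵀ * N) := by
      simp only [Matrix.mul_assoc]
    rw [hS, Matrix.mul_sub, this, hq, ha']
    simp
  have h2 : k * S = S := hkS S h1
  have h3 : Sᵀ * N = N * S := by
    rw [hS]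
    simp only [transpose_sub, transpose_smul, transpose_one, transpose_mul, hN, hsymm,
      transpose_transpose, Matrix.sub_mul, Matrix.mul_sub, Matrix.smul_mul, Matrix.mul_smul,
      Matrix.one_mul, Matrix.mul_one, Matrix.mul_assoc]
  have h4 : N * (S * (k * i₁)) = 0 := by
    have e1 : Sᵀ * N * k = Sᵀ * N := by
      conv_lhs => rw [← h2, transpose_mul]
      rw [Matrix.mul_assoc, Matrix.mul_assoc, ← Matrix.mul_assoc kᵀ, hk]
    calc N * (S * (k * i₁)) = (N * S) * k * i₁ := by simp only [Matrix.mul_assoc]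
      _ = Sᵀ * N * i₁ := by rw [← h3, e1]
      _ = (i₁ᵀ * N * S)ᵀ := by
        rw [transpose_mul, transpose_mul, hN, transpose_transpose, Matrix.mul_assoc]
      _ = 0 := by rw [h1, transpose_zero]
  have h5 : S * (k * i₁) = 0 := by
    have e1 : N.adjugate * (N * (S * (k * i₁))) = N.det • (S * (k * i₁)) := by
      rw [← Matrix.mul_assoc, adjugate_mul, Matrix.smul_mul, Matrix.one_mul]
    rw [h4, Matrix.mul_zero] at e1
    exact (smul_eq_zero.1 e1.symm).resolve_left hdet
  have h6 : (u : R) • (k * i₁) = i₁ * (a * (i₁ᵀ * N) * (k * i₁)) := by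
    rw [hS, Matrix.sub_mul, sub_eq_zero, Matrix.smul_mul, Matrix.one_mul] at h5
    rw [h5]; simp only [Matrix.mul_assoc]
  obtain ⟨K, hK⟩ : ∃ K, K = ((u⁻¹ : Rˣ) : R) • (a * (i₁ᵀ * N) * (k * i₁)) := ⟨_, rfl⟩
  have h7 : k * i₁ = i₁ * K := by
    rw [hK, Matrix.mul_smul, ← h6, smul_smul, Units.inv_mul, one_smul]
  refine ⟨K, h7, ?_, ?_⟩
  · calc Kᵀ * q * K = (i₁ * K)ᵀ * N * (i₁ * K) := by
          rw [← hq, transpose_mul]; simp only [Matrix.mul_assoc]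
      _ = i₁ᵀ * (kᵀ * N * k) * i₁ := by
          rw [← h7, transpose_mul]; simp only [Matrix.mul_assoc]
      _ = q := by rw [hk, hq]
  · obtain ⟨M, hM⟩ : ∃ M, M = ((u⁻¹ : Rˣ) : R) • ((K - 1) * a * (i₁ᵀ * N)) := ⟨_, rfl⟩
    have e1 : k = 1 + i₁ * M := by
      have e2 : (u : R) • k = (u : R) • (1 + i₁ * M) := by
        have e3 : (u : R) • k - (i₁ * K) * a * (i₁ᵀ * N) =
            (u : R) • 1 - i₁ * a * (i₁ᵀ * N) := by
          rw [← hS, ← h2, ← h7, hS, Matrix.mul_sub, Matrix.mul_smul, Matrix.mul_one]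
          simp only [Matrix.mul_assoc]
        rw [smul_add, hM, Matrix.mul_smul, smul_smul, Units.mul_inv, one_smul, Matrix.sub_mul,
          Matrix.sub_mul, Matrix.mul_sub, Matrix.one_mul]
        rw [sub_eq_iff_eq_add] at e3
        rw [e3]
        simp only [Matrix.mul_assoc]
        abel
      have := congrArg (fun X => ((u⁻¹ : Rˣ) : R) • X) e2
      simpa [smul_smul] using this
    have e4 : M * i₁ = K - 1 := by
      rw [hM, Matrix.smul_mul, Matrix.mul_assoc, hq, Matrix.mul_assoc, ha, Matrix.mul_smul,
        smul_smul, Units.inv_mul, one_smul, Matrix.mul_one]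
    rw [← hkdet, e1, det_one_add_mul_comm, e4, add_sub_cancel]

theorem congr_of_restriction {R : Type*} [CommRing R] {N : Matrix (Fin 4) (Fin 4) R}
    {i₁ i₂ Z : Matrix (Fin 4) (Fin 2) R} {K : Matrix (Fin 2) (Fin 2) R} {A B C π : R}
    (hN : Nᵀ = N) (h2 : IsUnit (2 : R)) (hπ : IsLeftRegular π)
    (hq₁ : i₁ᵀ * N * i₁ = !![2 * A, B; B, 2 * C]) (hq₂ : i₂ᵀ * N * i₂ = !![2 * A, B; B, 2 * C])
    (hK : Kᵀ * !![2 * A, B; B, 2 * C] * K = !![2 * A, B; B, 2 * C]) (hdet : K.det = 1)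
    (hi : i₂ = i₁ * K + π • Z) {Y : Matrix (Fin 2) (Fin 2) R} (hY : Y = i₁ᵀ * N * i₂) :
    π ^ 2 ∣ Y 0 0 * Y 1 1 - Y 0 1 * Y 1 0 - (4 * A * C - B ^ 2) ∧
      π ^ 2 ∣ C * Y 0 0 - A * Y 1 1 ∧ π ^ 2 ∣ B * Y 0 0 - A * (Y 0 1 + Y 1 0) ∧
      π ^ 2 ∣ B * Y 1 1 - C * (Y 0 1 + Y 1 0) := by
  obtain ⟨W, hW⟩ : ∃ W, W = Kᵀ * (i₁ᵀ * N * Z) := ⟨_, rfl⟩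
  obtain ⟨G, hG⟩ : ∃ G, G = Zᵀ * N * Z := ⟨_, rfl⟩
  have hYq : Kᵀ * Y = !![2 * A, B; B, 2 * C] + π • W := by
    rw [hY, hi, Matrix.mul_add, Matrix.mul_smul, Matrix.mul_add, Matrix.mul_smul, ← hW,
      ← Matrix.mul_assoc (i₁ᵀ * N), hq₁, ← Matrix.mul_assoc, hK]
  have hWW : W + Wᵀ = -(π • G) := by
    have e1 : i₂ᵀ * N * i₂ = Kᵀ * (i₁ᵀ * N * i₁) * K + π • (W + Wᵀ + π • G) := by
      rw [hi, hW, hG]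
      simp only [transpose_add, transpose_smul, transpose_mul, hN, transpose_transpose,
        Matrix.add_mul, Matrix.mul_add, Matrix.smul_mul, Matrix.mul_smul, smul_add, smul_smul,
        Matrix.mul_assoc]
      abel
    rw [hq₂, hq₁, hK] at e1
    have e2 : π • (W + Wᵀ + π • G) = 0 := by simpa using e1.symm
    have e3 : W + Wᵀ + π • G = 0 := by
      ext i j
      have := congrFun (congrFun e2 i) j
      simp only [Matrix.smul_apply, smul_eq_mul, Matrix.zero_apply] at this
      exact hπ (by simpa using this)
    exact eq_neg_of_add_eq_zero_left e3
  have w00 := congrFun (congrFun hWW 0) 0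
  have w01 := congrFun (congrFun hWW 0) 1
  have w11 := congrFun (congrFun hWW 1) 1
  have y00 := congrFun (congrFun hYq 0) 0
  have y01 := congrFun (congrFun hYq 0) 1
  have y10 := congrFun (congrFun hYq 1) 0
  have y11 := congrFun (congrFun hYq 1) 1
  have k00 := congrFun (congrFun hK 0) 0
  have k01 := congrFun (congrFun hK 0) 1
  have k10 := congrFun (congrFun hK 1) 0
  have k11 := congrFun (congrFun hK 1) 1
  rw [det_fin_two] at hdet
  simp [Matrix.mul_apply, Fin.sum_univ_two] at w00 w01 w11 y00 y01 y10 y11 k00 k01 k10 k11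
  generalize Y 0 0 = y₁ at *
  generalize Y 0 1 = y₂ at *
  generalize Y 1 0 = y₃ at *
  generalize Y 1 1 = y₄ at *
  generalize K 0 0 = k₁ at *
  generalize K 0 1 = k₂ at *
  generalize K 1 0 = k₃ at *
  generalize K 1 1 = k₄ at *
  generalize W 0 0 = w₁ at *
  generalize W 0 1 = w₂ at *
  generalize W 1 0 = w₃ at *
  generalize W 1 1 = w₄ at *
  generalize G 0 0 = g₁ at *
  generalize G 0 1 = g at *
  generalize G 1 1 = g₄ at *
  have hc : ∀ {x y : R}, 2 * x = 2 * y → x = y := fun h => h2.mul_left_cancel h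
  have n1 : A * (k₁ - k₄) = -(B * k₃) := hc (by
    linear_combination k₄ * k00 - k₃ * k01 - (2 * A * k₁ + B * k₃) * hdet)
  have n2 : A * k₂ = -(C * k₃) := hc (by
    linear_combination -k₂ * k00 + k₁ * k01 - (B * k₁ + 2 * C * k₃) * hdet)
  have n3 : C * (k₄ - k₁) = -(B * k₂) := hc (by
    linear_combination -k₂ * k10 + k₁ * k11 - (B * k₂ + 2 * C * k₄) * hdet)
  obtain ⟨r, hr⟩ := h2
  obtain ⟨v₁, hv₁⟩ : ∃ v, v = -((r⁻¹ : Rˣ) : R) * g₁ := ⟨_, rfl⟩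
  obtain ⟨v₄, hv₄⟩ : ∃ v, v = -((r⁻¹ : Rˣ) : R) * g₄ := ⟨_, rfl⟩
  have hr' : (2 : R) * ((r⁻¹ : Rˣ) : R) = 1 := by rw [← hr, Units.mul_inv]
  have x1 : w₁ = π * v₁ := hc (by rw [hv₁]; linear_combination w00 + π * g₁ * hr')
  have x4 : w₄ = π * v₄ := hc (by rw [hv₄]; linear_combination w11 + π * g₄ * hr')
  have x3 : w₃ = -w₂ - π * g := by linear_combination w01
  subst x1 x4 x3
  have z1 : y₁ = k₄ * (2 * A + π * (π * v₁)) - k₃ * (B + π * (-w₂ - π * g)) := by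
    linear_combination k₄ * y00 - k₃ * y10 - y₁ * hdet
  have z3 : y₃ = -k₂ * (2 * A + π * (π * v₁)) + k₁ * (B + π * (-w₂ - π * g)) := by
    linear_combination -k₂ * y00 + k₁ * y10 - y₃ * hdet
  have z2 : y₂ = k₄ * (B + π * w₂) - k₃ * (2 * C + π * (π * v₄)) := by
    linear_combination k₄ * y01 - k₃ * y11 - y₂ * hdet
  have z4 : y₄ = -k₂ * (B + π * w₂) + k₁ * (2 * C + π * (π * v₄)) := by
    linear_combination -k₂ * y01 + k₁ * y11 - y₄ * hdet
  clear y00 y01 y10 y11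
  subst z1 z2 z3 z4
  refine ⟨⟨2 * A * v₄ + 2 * C * v₁ + π ^ 2 * v₁ * v₄ + B * g + w₂ ^ 2 + π * w₂ * g, ?_⟩,
    ⟨C * k₄ * v₁ + C * k₃ * g - A * k₁ * v₄, ?_⟩,
    ⟨B * k₄ * v₁ + B * k₃ * g + A * k₃ * v₄ + A * k₂ * v₁ + A * k₁ * g, ?_⟩,
    ⟨B * k₁ * v₄ + C * k₃ * v₄ + C * k₂ * v₁ + C * k₁ * g, ?_⟩⟩
  · linear_combination ((2 * A + π * (π * v₁)) * (2 * C + π * (π * v₄)) -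
      (B + π * w₂) * (B + π * (-w₂ - π * g))) * hdet
  · linear_combination -2 * C * n1 + (B + π * w₂) * n2
  · linear_combination (-B + π * w₂) * n1 + 2 * A * n2
  · linear_combination (-B - π * w₂) * n3 + 2 * C * n2

/-- The columns of a pair of `4 × 2` matrices. -/
def repVec (X : Matrix (Fin 4) (Fin 2) ℤ × Matrix (Fin 4) (Fin 2) ℤ) : Fin 4 → Fin 4 → ℤ :=
  ![X.1ᵀ 0, X.1ᵀ 1, X.2ᵀ 0, X.2ᵀ 1]

theorem repVec_injective : Function.Injective repVec := by
  rintro ⟨a, b⟩ ⟨a', b'⟩ h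
  have h0 := congrFun h 0
  have h1 := congrFun h 1
  have h2 := congrFun h 2
  have h3 := congrFun h 3
  simp [repVec] at h0 h1 h2 h3
  refine Prod.ext ?_ ?_
  · ext i j
    fin_cases j
    · exact congrFun h0 i
    · exact congrFun h1 i
  · ext i j
    fin_cases j
    · exact congrFun h2 i
    · exact congrFun h3 i

theorem mul_mul_apply_eq_bl (N : Matrix (Fin 4) (Fin 4) ℤ) (X Y : Matrix (Fin 4) (Fin 2) ℤ)
    (i j : Fin 2) : (Xᵀ * N * Y) i j = bl N (Xᵀ i) (Yᵀ j) := by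
  rw [Matrix.mul_assoc, Matrix.mul_apply, bl, dotProduct]
  refine Finset.sum_congr rfl fun k _ => ?_
  rw [Matrix.mul_apply, mulVec, dotProduct]
  rfl

theorem isRepPair_repVec {MQ : Matrix (Fin 4) (Fin 4) ℚ} {N : Matrix (Fin 4) (Fin 4) ℤ}
    (hMN : ∀ i j, 2 * MQ i j = N i j) {A B C : ℤ}
    {X : Matrix (Fin 4) (Fin 2) ℤ × Matrix (Fin 4) (Fin 2) ℤ} (h1 : IsRep MQ A B C X.1)
    (h2 : IsRep MQ A B C X.2) : IsRepPair N A B C (repVec X) := by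
  obtain ⟨a0, a1, a2⟩ := h1.bl_eq hMN
  obtain ⟨b0, b1, b2⟩ := h2.bl_eq hMN
  exact ⟨a0, a1, a2, b0, b1, b2⟩

theorem congr_of_mem_XSet {MQ : Matrix (Fin 4) (Fin 4) ℚ} {N : Matrix (Fin 4) (Fin 4) ℤ}
    (hMN : ∀ i j, 2 * MQ i j = N i j) (hN : IsPD N) {A B C : ℤ} {p m : ℕ} [hp : Fact p.Prime]
    (hp2 : p ≠ 2) (hpE : ¬ (p : ℤ) ∣ 4 * A * C - B ^ 2)
    {X : Matrix (Fin 4) (Fin 2) ℤ × Matrix (Fin 4) (Fin 2) ℤ} (hX : X ∈ XSet MQ A B C p m) :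
    (p : ℤ) ^ (2 * m) ∣ defect (4 * A * C - B ^ 2) (repTuple N (repVec X)) ∧
    (p : ℤ) ^ (2 * m) ∣ C * (toTriple (repTuple N (repVec X))).1 -
      A * (toTriple (repTuple N (repVec X))).2.1 ∧
    (p : ℤ) ^ (2 * m) ∣ B * (toTriple (repTuple N (repVec X))).1 -
      A * (toTriple (repTuple N (repVec X))).2.2 ∧
    (p : ℤ) ^ (2 * m) ∣ B * (toTriple (repTuple N (repVec X))).2.1 -
      C * (toTriple (repTuple N (repVec X))).2.2 := by
  obtain ⟨⟨hr1, -⟩, ⟨hr2, -⟩, -, k, hk, hkdet, hkfix, hcong⟩ := hX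
  have hP := isRepPair_repVec hMN hr1 hr2
  let φ := Int.castRingHom ℤ_[p]
  let ψ := PadicInt.Coe.ringHom (p := p)
  have hψ : Function.Injective ψ := fun x y h => PadicInt.ext h
  have hMN' : ∀ i j, ((MQ i j : ℚ) : ℚ_[p]) = 2⁻¹ * ((N i j : ℤ) : ℚ_[p]) := by
    intro i j
    have : MQ i j = 2⁻¹ * (N i j : ℚ) := by rw [← hMN]; ring
    rw [this]; push_cast; ring
  have hk' : kᵀ * N.map φ * k = N.map φ := by
    have e0 : MQ.map (fun x : ℚ => (x : ℚ_[p])) = (2⁻¹ : ℚ_[p]) • (N.map φ).map ψ := by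
      ext i j
      simp only [map_apply, Matrix.smul_apply, smul_eq_mul, hMN']
      congr 1
    rw [e0] at hk
    rw [Matrix.mul_smul, Matrix.smul_mul] at hk
    have e1 := smul_right_injective _ (inv_ne_zero (two_ne_zero' ℚ_[p])) hk
    have e2 : (kᵀ * N.map φ * k).map ψ = (N.map φ).map ψ := by
      rw [Matrix.map_mul, Matrix.map_mul]; exact e1
    exact Matrix.map_injective hψ e2
  have hkS : ∀ S : Matrix (Fin 4) (Fin 4) ℤ_[p], (X.1.map φ)ᵀ * N.map φ * S = 0 → k * S = S := by
    intro S hS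
    have hS' : Sᵀ * N.map φ * X.1.map φ = 0 := by
      have : Sᵀ * N.map φ * X.1.map φ = ((X.1.map φ)ᵀ * N.map φ * S)ᵀ := by
        rw [transpose_mul, transpose_mul, transpose_transpose, ← transpose_map, hN.symm.eq,
          Matrix.mul_assoc]
      rw [this, hS, transpose_zero]
    ext i j
    have h := congrFun (hkfix (fun i => (S i j : ℚ_[p])) (by
      intro v
      have e1 : (fun i => S i j) ⬝ᵥ N.map φ *ᵥ (X.1.map φ *ᵥ fun l => φ (v l)) = 0 := by
        have : (fun i => S i j) ⬝ᵥ N.map φ *ᵥ (X.1.map φ *ᵥ fun l => φ (v l)) =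
            ((Sᵀ * N.map φ * X.1.map φ) *ᵥ fun l => φ (v l)) j := by
          rw [← mulVec_mulVec, ← mulVec_mulVec]; rfl
        rw [this, hS', zero_mulVec]; rfl
      have e2 := congrArg ψ e1
      have e3 : ∀ i, φ ((X.1 *ᵥ v) i) = (X.1.map φ *ᵥ fun l => φ (v l)) i := by
        intro i
        simp only [mulVec, dotProduct, map_sum, map_mul, map_apply]
      have e4 : ∀ i, (((X.1 *ᵥ v) i : ℤ) : ℚ_[p]) = ψ ((X.1.map φ *ᵥ fun l => φ (v l)) i) := by
        intro i; rw [← e3]; simp [φ, ψ]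
      simp only [e4]
      rw [map_zero] at e2
      rw [← mul_zero (2⁻¹ : ℚ_[p]), ← e2]
      generalize (X.1.map φ *ᵥ fun l => φ (v l)) = u
      simp only [dotProduct, mulVec, map_sum, map_mul, map_apply, Finset.mul_sum, hMN']
      refine Finset.sum_congr rfl fun i _ => Finset.sum_congr rfl fun l _ => ?_
      have : ψ (φ (N i l)) = ((N i l : ℤ) : ℚ_[p]) := by simp [φ, ψ]
      rw [this]
      change (ψ (S i j)) * _ = _
      ring)) i
    refine hψ ?_
    have : (k * S) i j = (k *ᵥ fun i => S i j) i := rfl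
    rw [this]
    simp only [mulVec, dotProduct, map_sum, map_mul]
    exact h
  have hEu : IsUnit (φ (4 * A * C - B ^ 2)) := by
    by_contra h
    exact hpE ((PadicInt.norm_int_lt_one_iff_dvd _).1 (PadicInt.not_isUnit_iff.1 h))
  have h2u : IsUnit (2 : ℤ_[p]) := by
    by_contra h
    have h2 : ‖((2 : ℤ) : ℤ_[p])‖ < 1 := by exact_mod_cast PadicInt.not_isUnit_iff.1 h
    have h3 := (PadicInt.norm_int_lt_one_iff_dvd _).1 h2
    exact hp2 ((Nat.prime_dvd_prime_iff_eq hp.out Nat.prime_two).1 (by exact_mod_cast h3))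
  have hgram : ∀ Y Y' : Matrix (Fin 4) (Fin 2) ℤ, (Y.map φ)ᵀ * N.map φ * Y'.map φ =
      (Yᵀ * N * Y').map φ := by
    intro Y Y'; rw [Matrix.map_mul, Matrix.map_mul, transpose_map]
  have hq : ∀ Y : Matrix (Fin 4) (Fin 2) ℤ, IsRep MQ A B C Y →
      (Y.map φ)ᵀ * N.map φ * Y.map φ = !![2 * φ A, φ B; φ B, 2 * φ C] := by
    intro Y hY
    obtain ⟨a0, a1, a2⟩ := hY.bl_eq hMN
    rw [hgram]
    ext i j
    rw [map_apply, mul_mul_apply_eq_bl]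
    fin_cases i <;> fin_cases j <;> simp [a0, a1, a2, bl_comm hN (Yᵀ 1) (Yᵀ 0)]
  obtain ⟨K, hK1, hK2, hK3⟩ := exists_restriction (i₁ := X.1.map φ) (N := N.map φ) (k := k)
    (q := !![2 * φ A, φ B; φ B, 2 * φ C]) (a := !![2 * φ C, -φ B; -φ B, 2 * φ A]) hEu
    (by rw [← transpose_map, hN.symm.eq])
    (by
      have : (N.map φ).det = φ N.det := (RingHom.map_det φ N).symm
      rw [this]
      simpa [φ] using det_ne_zero_of_isPD hN)
    (hq X.1 hr1)
    (by ext i j; fin_cases i <;> fin_cases j <;> simp [Matrix.mul_apply] <;> ring)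
    (by ext i j; fin_cases i <;> fin_cases j <;> simp [Matrix.mul_apply] <;> ring)
    (by ext i j; fin_cases i <;> fin_cases j <;> simp)
    hk' hkdet hkS
  have hZ : ∀ i j, ∃ z, (X.2.map φ) i j = (X.1.map φ * K) i j + (p : ℤ_[p]) ^ m * z := by
    intro i j
    obtain ⟨z, hz⟩ := hcong (Pi.single j 1) i
    refine ⟨z, ?_⟩
    rw [← hz, ← hK1]
    have e1 : k.mulVec (fun i' => (((X.1 *ᵥ Pi.single j 1) i' : ℤ) : ℤ_[p])) i =
        (k * X.1.map φ) i j := by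
      rw [mulVec, dotProduct, Matrix.mul_apply]
      refine Finset.sum_congr rfl fun l _ => ?_
      simp [φ]
    rw [e1]
    simp [φ]
  choose Z hZ using hZ
  obtain ⟨d0, d1, d2, d3⟩ := congr_of_restriction (N := N.map φ) (i₁ := X.1.map φ)
    (i₂ := X.2.map φ) (Z := Matrix.of Z) (K := K) (A := φ A) (B := φ B) (C := φ C)
    (π := (p : ℤ_[p]) ^ m) (by rw [← transpose_map, hN.symm.eq]) h2u
    (fun x y h => mul_left_cancel₀ (pow_ne_zero m (Nat.cast_ne_zero.2 hp.out.ne_zero)) h)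
    (hq X.1 hr1) (hq X.2 hr2) hK2 hK3 (by ext i j; exact hZ i j) rfl
  rw [hgram] at d0 d1 d2 d3
  simp only [map_apply, mul_mul_apply_eq_bl] at d0 d1 d2 d3
  have hdvd : ∀ z : ℤ, ((p : ℤ_[p]) ^ m) ^ 2 ∣ φ z → (p : ℤ) ^ (2 * m) ∣ z := by
    intro z hz
    rw [← pow_mul, mul_comm] at hz
    exact (PadicInt.pow_p_dvd_int_iff (2 * m) z).1 hz
  refine ⟨hdvd _ ?_, hdvd _ ?_, hdvd _ ?_, hdvd _ ?_⟩
  · simpa [defect, repTuple, repVec, φ] using d0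
  · simpa [toTriple, repTuple, repVec, φ] using d1
  · simpa [toTriple, repTuple, repVec, φ] using d2
  · simpa [toTriple, repTuple, repVec, φ] using d3

theorem int_abs_le_sq (z : ℤ) : |z| ≤ z ^ 2 := by
  rw [← sq_abs]
  exact Int.le_self_sq |z|

theorem finite_SSetQ {MQ : Matrix (Fin 4) (Fin 4) ℚ} {N : Matrix (Fin 4) (Fin 4) ℤ}
    (hMN : ∀ i j, 2 * MQ i j = N i j) (hdet : 0 < N.det) (A B C : ℤ) (p n : ℕ) :
    (SSetQ MQ A B C p n).Finite := by
  let G : ℤ × ℤ × ℤ × ℤ → ℤ := fun z =>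
    4 * (z.1 * z.2.2.2 - z.2.1 * z.2.2.1 - (4 * A * C - B ^ 2)) ^ 2 -
      16 * ((C * z.1 - A * z.2.2.2) ^ 2 +
        (B * z.1 - A * (z.2.1 + z.2.2.1)) * (B * z.2.2.2 - C * (z.2.1 + z.2.2.1)))
  let I := Finset.Icc (-(2 * A)) (2 * A) ×ˢ Finset.Icc (-(4 * A * C)) (4 * A * C) ×ˢ
    Finset.Icc (-(4 * A * C)) (4 * A * C) ×ˢ Finset.Icc (-(2 * C)) (2 * C)
  refine (I.biUnion fun z => (Finset.Icc (-(G z)) (G z)).image fun z₀ : ℤ =>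
    (![(z₀ : ℚ) / 2, (z.1 : ℚ) / 2, (z.2.1 : ℚ) / 2, (z.2.2.1 : ℚ) / 2, (z.2.2.2 : ℚ) / 2] :
      Fin 5 → ℚ)).finite_toSet.subset ?_
  rintro x ⟨⟨z₀, h0⟩, ⟨z₁, h1⟩, ⟨z₂, h2⟩, ⟨z₃, h3⟩, ⟨z₄, h4⟩, hE, b1, b4, b2, b3, -⟩
  have e0 : x 0 = z₀ / 2 := by rw [← h0]; ring
  have e1 : x 1 = z₁ / 2 := by rw [← h1]; ring
  have e2 : x 2 = z₂ / 2 := by rw [← h2]; ring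
  have e3 : x 3 = z₃ / 2 := by rw [← h3]; ring
  have e4 : x 4 = z₄ / 2 := by rw [← h4]; ring
  rw [e0, e1, e2, e3, e4] at hE
  rw [e1, abs_div, abs_two] at b1
  rw [e4, abs_div, abs_two] at b4
  rw [e2] at b2
  rw [e3] at b3
  have b1' : |z₁| ≤ 2 * A := by
    have : |(z₁ : ℚ)| ≤ 2 * A := by linarith
    exact_mod_cast this
  have b4' : |z₄| ≤ 2 * C := by
    have : |(z₄ : ℚ)| ≤ 2 * C := by linarith
    exact_mod_cast this
  have b2' : z₂ ^ 2 ≤ 4 * A * C := by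
    have : (z₂ : ℚ) ^ 2 ≤ 4 * A * C := by linarith
    exact_mod_cast this
  have b3' : z₃ ^ 2 ≤ 4 * A * C := by
    have : (z₃ : ℚ) ^ 2 ≤ 4 * A * C := by linarith
    exact_mod_cast this
  have hE' : N.det * z₀ ^ 2 = G (z₁, z₂, z₃, z₄) := by
    have hd := cast_det_eq hMN
    have : (N.det : ℚ) * z₀ ^ 2 = ((G (z₁, z₂, z₃, z₄) : ℤ) : ℚ) := by
      rw [hd]; simp only [G]; push_cast; linear_combination 64 * hE
    exact_mod_cast this
  have hz : |z₀| ≤ G (z₁, z₂, z₃, z₄) := by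
    rw [← hE']
    have := int_abs_le_sq z₀
    nlinarith [sq_nonneg z₀]
  have hsq : ∀ {z : ℤ}, z ^ 2 ≤ 4 * A * C → |z| ≤ 4 * A * C := fun {z} h =>
    (int_abs_le_sq z).trans h
  simp only [Finset.coe_biUnion, Set.mem_iUnion, Finset.coe_image, Set.mem_image,
    Finset.mem_coe, I, Finset.mem_product, Finset.mem_Icc, exists_prop]
  refine ⟨(z₁, z₂, z₃, z₄), ⟨abs_le.1 b1', abs_le.1 (hsq b2'), abs_le.1 (hsq b3'), abs_le.1 b4'⟩,
    z₀, abs_le.1 hz, ?_⟩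
  ext i
  fin_cases i <;> simp [e0, e1, e2, e3, e4]

theorem IsPD.det_pos {N : Matrix (Fin 4) (Fin 4) ℤ} (hN : IsPD N) : 0 < N.det := by
  refine lt_of_le_of_ne ?_ (det_ne_zero_of_isPD hN).symm
  have hq : ∀ v : Fin 4 → ℚ, 0 ≤ v ⬝ᵥ N.map (Int.cast : ℤ → ℚ) *ᵥ v := by
    intro v
    obtain ⟨⟨d, hd⟩, hv⟩ := IsLocalization.exist_integer_multiples_of_finite
      (nonZeroDivisors ℤ) v
    choose w hw using hv
    have hd0 : (d : ℚ) ≠ 0 := by exact_mod_cast nonZeroDivisors.ne_zero hd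
    have hvw : v = (d : ℚ)⁻¹ • fun i => (w i : ℚ) := by
      ext i
      have := hw i
      simp only [algebraMap_int_eq, eq_intCast, zsmul_eq_mul] at this
      simp [this, hd0]
    have h1 := bl_self_nonneg hN w
    have h2 : ((bl N w w : ℤ) : ℚ) =
        (fun i => (w i : ℚ)) ⬝ᵥ N.map (Int.cast : ℤ → ℚ) *ᵥ fun i => (w i : ℚ) := by
      simp [bl, dotProduct, mulVec]
    rw [hvw, mulVec_smul, smul_dotProduct, dotProduct_smul, ← h2, smul_smul, smul_eq_mul]
    have : (0 : ℚ) ≤ bl N w w := by exact_mod_cast h1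
    exact mul_nonneg (mul_self_nonneg _) this
  have hr : ∀ v : Fin 4 → ℝ, 0 ≤ v ⬝ᵥ N.map (Int.cast : ℤ → ℝ) *ᵥ v := by
    have hd : DenseRange (fun (v : Fin 4 → ℚ) i => (v i : ℝ)) :=
      DenseRange.piMap fun _ => Rat.denseRange_cast
    intro v
    refine hd.induction_on v ?_ ?_
    · exact isClosed_le continuous_const (by
        simp only [dotProduct, mulVec]
        fun_prop)
    · intro w
      have := hq w
      have e : ((w ⬝ᵥ N.map (Int.cast : ℤ → ℚ) *ᵥ w : ℚ) : ℝ) =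
          (fun i => (w i : ℝ)) ⬝ᵥ N.map (Int.cast : ℤ → ℝ) *ᵥ fun i => (w i : ℝ) := by
        simp [dotProduct, mulVec]
      rw [← e]
      exact_mod_cast this
  have hs : (N.map (Int.cast : ℤ → ℝ)).PosSemidef := by
    refine Matrix.PosSemidef.of_dotProduct_mulVec_nonneg ?_ hr
    ext i j
    simp [hN.symm.apply i j]
  have h := hs.det_nonneg
  have e : (N.map (Int.cast : ℤ → ℝ)).det = (N.det : ℝ) :=
    ((Int.castRingHom ℝ).map_det N).symm
  rw [e] at h
  exact_mod_cast h

/-- The common divisor of the coordinates of the second pair transversal to the first one. -/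
theorem exists_level {MQ : Matrix (Fin 4) (Fin 4) ℚ} {N : Matrix (Fin 4) (Fin 4) ℤ}
    (hMN : ∀ i j, 2 * MQ i j = N i j) (hN : IsPD N) {A B C : ℤ} (hE : 0 < 4 * A * C - B ^ 2)
    {p m : ℕ} [Fact p.Prime]
    {X : Matrix (Fin 4) (Fin 2) ℤ × Matrix (Fin 4) (Fin 2) ℤ} (hX : X ∈ XSet MQ A B C p m)
    (f : ℕ) (hf : 0 < f) (hfE : (f : ℤ) * f ∣ 4 * A * C - B ^ 2) :
    ∃ h : ℕ, h ∣ f ∧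
      (∃ i j c : ℕ, ∃ α₁ α₂ : ℤ, ∃ z y : Fin 4 → ℤ, i ∣ 2 * f ∧ j ∣ 2 * f ∧ 0 < c ∧
        Nat.gcd c f = h ∧ 0 ≤ α₁ ∧ α₁ < c ∧ 0 ≤ α₂ ∧ α₂ < c ∧
        (i : ℤ) • repVec X 2 + (j : ℤ) • repVec X 3 =
          α₁ • repVec X 0 + α₂ • repVec X 1 + (c : ℤ) • z ∧
        (Matrix.of ![repVec X 0, repVec X 1, z, y]).det = 1) ∧
      ∀ s t : ℤ, IsCoprime (A * s ^ 2 + B * s * t + C * t ^ 2) (h : ℤ) →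
        (h : ℤ) ∣ orthMix A B C s t (toTriple (repTuple N (repVec X))) ∧
        (h : ℤ) ^ 2 ∣ 16 * orthVal A B C s t (toTriple (repTuple N (repVec X))) ∧
        (h : ℤ) ^ 2 ∣ 64 * (defect (4 * A * C - B ^ 2) (repTuple N (repVec X)) +
          (4 * A * C - B ^ 2)) := by
  obtain ⟨hr1, hr2, hne, -⟩ := hX
  have hP := isRepPair_repVec hMN hr1.1 hr2.1
  have hv : IsPrimPair (repVec X 0) (repVec X 1) := hr1.isPrimPair hMN hN hE
  have hw : IsPrimPair (repVec X 2) (repVec X 3) := hr2.isPrimPair hMN hN hE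
  have hmul : ∀ (Y : Matrix (Fin 4) (Fin 2) ℤ) (x : Fin 2 → ℤ),
      Y *ᵥ x = x 0 • Yᵀ 0 + x 1 • Yᵀ 1 := by
    intro Y x
    ext i
    simp [mulVec, dotProduct, Fin.sum_univ_two, mul_comm]
  have hsub : ∀ Y Y' : Matrix (Fin 4) (Fin 2) ℤ, (∃ a b : ℤ, Y'ᵀ 0 = a • Yᵀ 0 + b • Yᵀ 1) →
      (∃ a b : ℤ, Y'ᵀ 1 = a • Yᵀ 0 + b • Yᵀ 1) →
      {v : Fin 4 → ℤ | ∃ w, Y' *ᵥ w = v} ⊆ {v : Fin 4 → ℤ | ∃ w, Y *ᵥ w = v} := by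
    rintro Y Y' ⟨a, b, h0⟩ ⟨c, d, h1⟩ v ⟨x, rfl⟩
    refine ⟨![x 0 * a + x 1 * c, x 0 * b + x 1 * d], ?_⟩
    rw [hmul, hmul, h0, h1]
    simp only [cons_val_zero, cons_val_one]
    module
  obtain ⟨h, hhf, ⟨a, b, z₁, e2⟩, ⟨c, d, z₂, e3⟩, hex⟩ := exists_primitive_combination hv
    (u₁ := repVec X 2) (u₂ := repVec X 3) (by
      rintro ⟨⟨a, b, h2⟩, ⟨c, d, h3⟩⟩
      obtain ⟨⟨a', b', z, h0⟩, ⟨c', d', z', h1⟩⟩ := hw.exists_inverse_mod 0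
        (v := repVec X 0) (w := repVec X 1) (z₁ := 0) (z₂ := 0) (by simpa using h2)
        (by simpa using h3)
      rw [zero_smul, add_zero] at h0 h1
      exact hne (Set.Subset.antisymm (hsub _ _ ⟨_, _, h0⟩ ⟨_, _, h1⟩)
        (hsub _ _ ⟨_, _, h2⟩ ⟨_, _, h3⟩))) f hf
  refine ⟨h, hhf, hex, fun s t hq => ?_⟩
  obtain ⟨⟨a', b', z₃, e0⟩, ⟨c', d', z₄, e1⟩⟩ := hw.exists_inverse_mod (h : ℤ) e2 e3
  have hh2 : (h : ℤ) ^ 2 ∣ 4 * A * C - B ^ 2 := by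
    refine Dvd.dvd.trans ?_ hfE
    rw [pow_two]
    exact mul_dvd_mul (Int.natCast_dvd_natCast.2 hhf) (Int.natCast_dvd_natCast.2 hhf)
  obtain ⟨k1, k2, k3⟩ := congr_of_pair hN hP h (Nat.pos_of_dvd_of_pos hhf hf) hh2 s t hq
    a b c d a' b' c' d' z₁ z₂ z₃ z₄ e2 e3 e0 e1
  refine ⟨k1, k2, int_dvd_of_eq k3 ?_⟩
  simp only [defect, repTuple]; ring

theorem exists_max_sq_dvd {E : ℤ} (hE : 0 < E) :
    ∃ f : ℕ, 0 < f ∧ (f : ℤ) * f ∣ E ∧ ∀ s : ℕ, (s : ℤ) * s ∣ E → s ∣ f := by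
  obtain ⟨n, rfl⟩ := Int.eq_ofNat_of_zero_le hE.le
  have hn : 0 < n := by exact_mod_cast hE
  obtain ⟨a, b, ha, hb, hab, hsq⟩ := Nat.sq_mul_squarefree_of_pos hn
  refine ⟨b, hb, ⟨a, by rw [← hab]; push_cast; ring⟩, fun s hs => ?_⟩
  have hs' : s * s ∣ b ^ 2 * a := by rw [hab]; exact_mod_cast hs
  obtain ⟨g, s', b', hg, hco, rfl, rfl⟩ := Nat.exists_coprime' (m := s) (n := b)
    (Nat.gcd_pos_of_pos_right s hb)
  have h1 : s' * s' ∣ b' ^ 2 * a := by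
    refine Nat.dvd_of_mul_dvd_mul_left (Nat.pow_pos (n := 2) hg) ?_
    rwa [show g ^ 2 * (s' * s') = s' * g * (s' * g) by ring,
      show g ^ 2 * (b' ^ 2 * a) = (b' * g) ^ 2 * a by ring]
  have h2 : s' * s' ∣ a :=
    Nat.Coprime.dvd_of_dvd_mul_left (((hco.mul_left hco).pow_right 2)) h1
  have h3 := Nat.isUnit_iff.1 (hsq s' h2)
  rw [h3, one_mul]
  exact Dvd.intro_left b' rfl

theorem FundDisc.le_two {A B C : ℤ} (h : FundDisc A B C) {f : ℕ}
    (hf : (f : ℤ) * f ∣ 4 * A * C - B ^ 2) : f ≤ 2 := by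
  rcases h with ⟨-, h⟩ | ⟨hB, h, -⟩
  · have := h f (int_dvd_of_eq (dvd_neg.2 hf) (by ring))
    have := Int.isUnit_iff_natAbs_eq.1 this
    rw [Int.natAbs_natCast] at this
    omega
  · obtain ⟨b, rfl⟩ := hB
    have e : 4 * A * C - (b + b) ^ 2 = 4 * (A * C - b ^ 2) := by ring
    rw [e] at hf h
    rw [Int.mul_ediv_cancel_left _ (by norm_num)] at h
    rcases Nat.even_or_odd f with ⟨g, rfl⟩ | hodd
    · have hg : (g : ℤ) * g ∣ A * C - b ^ 2 := by
        refine Int.dvd_of_mul_dvd_mul_left (a := 4) (by norm_num) ?_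
        convert hf using 1
        push_cast; ring
      have := Int.isUnit_iff_natAbs_eq.1 (h g hg)
      rw [Int.natAbs_natCast] at this
      omega
    · have hco : IsCoprime ((f : ℤ) * f) 4 := by
        have : IsCoprime (f : ℤ) 2 := by
          exact_mod_cast Nat.isCoprime_iff_coprime.2 (Nat.coprime_two_right.2 hodd)
        have e4 : (4 : ℤ) = 2 * 2 := by norm_num
        rw [e4]
        exact (this.mul_left this).mul_right (this.mul_left this)
      have := Int.isUnit_iff_natAbs_eq.1 (h f (hco.dvd_of_dvd_mul_left hf))
      rw [Int.natAbs_natCast] at this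
      omega

/-- `X` is a pair of representations whose second member has level `h` over the first one: `h` is
the part dividing `f` of the common divisor of the transversal coordinates. -/
def HasLevel (N : Matrix (Fin 4) (Fin 4) ℤ) (A B C : ℤ) (f : ℕ)
    (X : Matrix (Fin 4) (Fin 2) ℤ × Matrix (Fin 4) (Fin 2) ℤ) (h : ℕ) : Prop :=
  h ∣ f ∧
  (∃ i j c : ℕ, ∃ α₁ α₂ : ℤ, ∃ z y : Fin 4 → ℤ, i ∣ 2 * f ∧ j ∣ 2 * f ∧ 0 < c ∧
    Nat.gcd c f = h ∧ 0 ≤ α₁ ∧ α₁ < c ∧ 0 ≤ α₂ ∧ α₂ < c ∧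
    (i : ℤ) • repVec X 2 + (j : ℤ) • repVec X 3 =
      α₁ • repVec X 0 + α₂ • repVec X 1 + (c : ℤ) • z ∧
    (Matrix.of ![repVec X 0, repVec X 1, z, y]).det = 1) ∧
  ∀ s t : ℤ, IsCoprime (A * s ^ 2 + B * s * t + C * t ^ 2) (h : ℤ) →
    (h : ℤ) ∣ orthMix A B C s t (toTriple (repTuple N (repVec X))) ∧
    (h : ℤ) ^ 2 ∣ 16 * orthVal A B C s t (toTriple (repTuple N (repVec X))) ∧
    (h : ℤ) ^ 2 ∣ 64 * (defect (4 * A * C - B ^ 2) (repTuple N (repVec X)) +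
      (4 * A * C - B ^ 2))

theorem card_level_le {MQ : Matrix (Fin 4) (Fin 4) ℚ} {N : Matrix (Fin 4) (Fin 4) ℤ}
    (hMN : ∀ i j, 2 * MQ i j = N i j) (hN : IsPD N) (heven : ∀ v, (2 : ℤ) ∣ bl N v v) (m : ℕ)
    (hm : ∀ F : Finset (Matrix (Fin 4) (Fin 4) ℤ), (∀ g ∈ F, g * N * gᵀ = N) → F.card ≤ m)
    {A B C : ℤ} (hA : 0 < A) (hBA : |B| ≤ A) (hAC : A ≤ C)
    (hprim : Int.gcd (Int.gcd A B) C = 1) {p n : ℕ} [hp : Fact p.Prime] (hp2 : p ≠ 2)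
    (hpE : ¬ (p : ℤ) ∣ 4 * A * C - B ^ 2) (f h t : ℕ) (hf : 0 < f)
    (hfE : (f : ℤ) * f ∣ 4 * A * C - B ^ 2)
    (hfmax : ∀ s : ℕ, (s : ℤ) * s ∣ 4 * A * C - B ^ 2 → s ∣ f)
    (ht : ∀ n : ℕ, 0 < n → (n : ℤ) ≤ 384 * (4 * A * C - B ^ 2) ^ 5 → n.divisors.card ≤ t)
    (F : Finset (Matrix (Fin 4) (Fin 2) ℤ × Matrix (Fin 4) (Fin 2) ℤ))
    (hF : ∀ X ∈ F, X ∈ XSet MQ A B C p (2 * n)) (hh : h ∣ f)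
    (hlev : ∀ X ∈ F, HasLevel N A B C f X h) :
    (F.card : ℝ) ≤ t ^ 5 * h * (16 * N.det.natAbs ^ 5 * m) * (SSetQ MQ A B C p n).ncard ∧
    (F.card : ℝ) ≤ t ^ 5 * h * (16 * N.det.natAbs ^ 5 * m) *
      (10000000 * N.det.natAbs * t ^ 3 *
        (1 + ((4 * A * C - B ^ 2 : ℤ) : ℝ) / ((h : ℝ) ^ 2 * (p : ℝ) ^ (4 * n)) +
          ((4 * A * C - B ^ 2 : ℤ) : ℝ) * √((4 * A * C - B ^ 2 : ℤ) : ℝ) /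
            ((h : ℝ) ^ 3 * (p : ℝ) ^ (8 * n)))) := by
  classical
  have hC : 0 < C := hA.trans_le hAC
  have hdet := hN.det_pos
  have hh0 : 0 < h := Nat.pos_of_dvd_of_pos hh hf
  have hhE : (h : ℤ) ^ 2 ∣ 4 * A * C - B ^ 2 := by
    refine Dvd.dvd.trans ?_ hfE
    rw [pow_two]
    exact mul_dvd_mul (Int.natCast_dvd_natCast.2 hh) (Int.natCast_dvd_natCast.2 hh)
  have hP : ∀ X ∈ F, IsRepPair N A B C (repVec X) := fun X hX =>
    isRepPair_repVec hMN (hF X hX).1.1 (hF X hX).2.1.1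
  have hcongr := fun X hX => congr_of_mem_XSet hMN hN hp2 hpE (hF X hX)
  rw [show 2 * (2 * n) = 4 * n by ring] at hcongr
  set S := F.image fun X => repTuple N (repVec X) with hS
  have hfib : F.card ≤ t ^ 5 * h * (16 * N.det.natAbs ^ 5 * m) * S.card := by
    refine Finset.card_le_mul_card_image F _ fun x hx => ?_
    rw [← Finset.card_image_of_injective _ repVec_injective]
    have key : ∀ P ∈ (F.filter fun X => repTuple N (repVec X) = x).image repVec,
        ∃ X ∈ F, repTuple N P = x ∧ repVec X = P := by
      intro P hP
      obtain ⟨X, hX, rfl⟩ := Finset.mem_image.1 hP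
      exact ⟨X, (Finset.mem_filter.1 hX).1, (Finset.mem_filter.1 hX).2, rfl⟩
    refine card_fibre_le hN heven m hm A B C hA hBA hAC hprim f h t hf hfE hfmax ht x.2.1 x.2.2.1
      x.2.2.2.1 x.2.2.2.2 x.1 _ ?_ ?_ ?_ ?_ ?_ ?_ ?_ <;>
    · intro P hP'
      obtain ⟨X, hX, rfl, rfl⟩ := key P hP'
      first
        | rfl
        | exact hP X hX
        | exact (hlev X hX).2.1
  have hfib' : (F.card : ℝ) ≤ t ^ 5 * h * (16 * N.det.natAbs ^ 5 * m) * S.card := by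
    exact_mod_cast hfib
  have hS0 : S.card ≤ (SSetQ MQ A B C p n).ncard := by
    rw [← Finset.card_image_of_injective S halfTuple_injective, ← Set.ncard_coe_finset]
    refine Set.ncard_le_ncard ?_ (finite_SSetQ hMN hdet A B C p n)
    intro y hy
    obtain ⟨x, hx, rfl⟩ := Finset.mem_image.1 (Finset.mem_coe.1 hy)
    obtain ⟨X, hX, rfl⟩ := Finset.mem_image.1 hx
    obtain ⟨k1, k2, k3, k4⟩ := hcongr X hX
    exact (hP X hX).halfTuple_mem hMN hN hA hC hp2 k1 k2 k3 k4
  refine ⟨hfib'.trans (by gcongr), hfib'.trans (mul_le_mul_of_nonneg_left ?_ (by positivity))⟩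
  obtain ⟨α, β, hq⟩ := exists_coprime_value A B C hprim h hh0
  have hPh : IsCoprime ((p ^ (4 * n) : ℕ) : ℤ) (h : ℤ) := by
    rw [Nat.isCoprime_iff_coprime]
    refine Nat.Coprime.pow_left _ ((Nat.Prime.coprime_iff_not_dvd hp.out).2 fun hd => hpE ?_)
    exact (Int.natCast_dvd_natCast.2 hd).trans ((dvd_pow_self _ two_ne_zero).trans hhE)
  have := card_tuples_le hA hBA hAC hprim (4 * A * C - B ^ 2) rfl N.det.natAbs
    (Int.natAbs_pos.2 hdet.ne') (p ^ (4 * n)) h (pow_pos hp.out.pos _) hh0 hPh hhE t ht α β hq S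
    ?_ ?_ ?_ ?_ ?_
  · refine this.trans_eq ?_
    push_cast
    rw [← pow_mul, show 4 * n * 2 = 8 * n by ring]
  all_goals
    intro x hx
    obtain ⟨X, hX, rfl⟩ := Finset.mem_image.1 hx
  · rw [Int.natCast_natAbs, abs_of_pos hdet]
    exact (hP X hX).gram_eq hN
  · obtain ⟨b1, b2, b3, b4⟩ := (hP X hX).bounds hN hA hC
    exact ⟨b1, b2, b3, b4⟩
  · obtain ⟨-, k2, k3, k4⟩ := hcongr X hX
    obtain ⟨l1, l2, -⟩ := (hlev X hX).2.2 α β hq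
    exact ⟨by exact_mod_cast k2, by exact_mod_cast k3, by exact_mod_cast k4, l1, l2⟩
  · exact_mod_cast (hcongr X hX).1
  · exact ((hlev X hX).2.2 α β hq).2.2

theorem card_XSet_le {MQ : Matrix (Fin 4) (Fin 4) ℚ} {N : Matrix (Fin 4) (Fin 4) ℤ}
    (hMN : ∀ i j, 2 * MQ i j = N i j) (hN : IsPD N) (heven : ∀ v, (2 : ℤ) ∣ bl N v v) (m : ℕ)
    (hm : ∀ F : Finset (Matrix (Fin 4) (Fin 4) ℤ), (∀ g ∈ F, g * N * gᵀ = N) → F.card ≤ m)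
    {A B C : ℤ} (hA : 0 < A) (hBA : |B| ≤ A) (hAC : A ≤ C) (hE : 0 < 4 * A * C - B ^ 2)
    (hprim : Int.gcd (Int.gcd A B) C = 1) {p : ℕ} (n : ℕ) [hp : Fact p.Prime] (hp2 : p ≠ 2)
    (hpE : ¬ (p : ℤ) ∣ 4 * A * C - B ^ 2) (t : ℕ)
    (ht : ∀ n : ℕ, 0 < n → (n : ℤ) ≤ 384 * (4 * A * C - B ^ 2) ^ 5 → n.divisors.card ≤ t) :
    (FundDisc A B C → ((XSet MQ A B C p (2 * n)).ncard : ℝ) ≤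
      32 * N.det.natAbs ^ 5 * m * t ^ 6 * (SSetQ MQ A B C p n).ncard) ∧
    ∀ T : ℝ, 0 < T → ((XSet MQ A B C p (2 * n)).ncard : ℝ) ≤
      160000000 * N.det.natAbs ^ 6 * m * t ^ 9 * (T * (SSetQ MQ A B C p n).ncard +
        √((4 * A * C - B ^ 2 : ℤ) : ℝ) +
        ((4 * A * C - B ^ 2 : ℤ) : ℝ) / (T * (p : ℝ) ^ (4 * n)) +
        ((4 * A * C - B ^ 2 : ℤ) : ℝ) * √((4 * A * C - B ^ 2 : ℤ) : ℝ) /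
          (T * (p : ℝ) ^ (8 * n))) := by
  classical
  set E : ℤ := 4 * A * C - B ^ 2 with hEdef
  have hER : (0 : ℝ) < E := by exact_mod_cast hE
  have hpR : (0 : ℝ) < p := by exact_mod_cast hp.out.pos
  by_cases hfin : (XSet MQ A B C p (2 * n)).Finite
  swap
  · rw [Set.Infinite.ncard hfin]
    exact ⟨fun _ => by push_cast; positivity, fun T hT => by push_cast; positivity⟩
  obtain ⟨f, hf, hfE, hfmax⟩ := exists_max_sq_dvd hE
  rw [Set.ncard_eq_toFinset_card _ hfin]
  set F := hfin.toFinset with hFdef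
  have hF : ∀ X ∈ F, X ∈ XSet MQ A B C p (2 * n) := fun X hX => by simpa [hFdef] using hX
  have hex : ∀ X, ∃ h, X ∈ F → HasLevel N A B C f X h := by
    intro X
    by_cases hX : X ∈ F
    · obtain ⟨h, hh⟩ := exists_level hMN hN hE (hF X hX) f hf hfE
      exact ⟨h, fun _ => hh⟩
    · exact ⟨0, fun h => absurd h hX⟩
  choose H hH using hex
  have hft : f.divisors.card ≤ t := by
    refine ht f hf ?_
    have h1 : (f : ℤ) ≤ f * f := by exact_mod_cast Nat.le_mul_self f
    have h2 := Int.le_of_dvd hE hfE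
    have h3 : E ≤ E ^ 5 := le_self_pow₀ (by omega) (by norm_num)
    omega
  have ht1 : 1 ≤ t := (Finset.card_pos.2 ⟨1, Nat.one_mem_divisors.2 hf.ne'⟩).trans_le hft
  have ht1R : (1 : ℝ) ≤ t := by exact_mod_cast ht1
  have hΔ1 : 1 ≤ N.det.natAbs := Int.natAbs_pos.2 hN.det_pos.ne'
  have hΔ1R : (1 : ℝ) ≤ N.det.natAbs := by exact_mod_cast hΔ1
  have hsum : ∀ U : ℝ, 0 ≤ U → (∀ h ∈ f.divisors, ((F.filter fun X => H X = h).card : ℝ) ≤ U) →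
      (F.card : ℝ) ≤ t * U := by
    intro U hU h
    rw [Finset.card_eq_sum_card_fiberwise (f := H) (t := f.divisors) fun X hX =>
      Nat.mem_divisors.2 ⟨(hH X hX).1, hf.ne'⟩]
    push_cast
    refine (Finset.sum_le_sum h).trans ?_
    rw [Finset.sum_const, nsmul_eq_mul]
    gcongr
  have hlev : ∀ h ∈ f.divisors, _ := fun h hh =>
    card_level_le hMN hN heven m hm hA hBA hAC hprim hp2 hpE f h t hf hfE hfmax ht
      (F.filter fun X => H X = h) (fun X hX => hF X (Finset.mem_filter.1 hX).1)
      (Nat.dvd_of_mem_divisors hh) (fun X hX => by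
        obtain ⟨h1, rfl⟩ := Finset.mem_filter.1 hX
        exact hH X h1)
  rw [← hEdef] at hlev
  constructor
  · intro hD
    refine (hsum _ ?_ fun h hh => (hlev h hh).1.trans (?_ : _ ≤
      (t : ℝ) ^ 5 * 2 * (16 * N.det.natAbs ^ 5 * m) * (SSetQ MQ A B C p n).ncard)).trans_eq ?_
    · positivity
    · have : h ≤ 2 := (Nat.le_of_dvd hf (Nat.dvd_of_mem_divisors hh)).trans (hD.le_two hfE)
      have : (h : ℝ) ≤ 2 := by exact_mod_cast this
      gcongr
    · ring
  · intro T hT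
    set P : ℝ := (p : ℝ) ^ (4 * n) with hP
    have hP8 : (p : ℝ) ^ (8 * n) = P ^ 2 := by rw [hP, ← pow_mul]; congr 1; ring
    rw [hP8] at hlev ⊢
    have hP0 : 0 < P := by positivity
    set S : ℝ := ((SSetQ MQ A B C p n).ncard : ℝ)
    have hS0 : 0 ≤ S := by positivity
    refine (hsum ((t : ℝ) ^ 8 * (160000000 * N.det.natAbs ^ 6 * m) *
      (T * S + √(E : ℝ) + E / (T * P) + E * √(E : ℝ) / (T * P ^ 2))) ?_ ?_).trans_eq (by ring)
    · positivity
    intro h hh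
    have hhf := Nat.dvd_of_mem_divisors hh
    have hh0 : 0 < h := Nat.pos_of_dvd_of_pos hhf hf
    have hh1 : (1 : ℝ) ≤ h := by exact_mod_cast hh0
    obtain ⟨k1, k2⟩ := hlev h hh
    have ha : 0 ≤ √(E : ℝ) := Real.sqrt_nonneg _
    have hb : 0 ≤ E / (T * P) := by positivity
    have hc : 0 ≤ E * √(E : ℝ) / (T * P ^ 2) := by positivity
    rcases le_or_gt (h : ℝ) T with hle | hlt
    · calc _ ≤ _ := k1
        _ = (t : ℝ) ^ 5 * (16 * N.det.natAbs ^ 5 * m) * (h * S) := by ring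
        _ ≤ _ := by
          gcongr
          · norm_num
          · norm_num
          · norm_num
          · have := mul_le_mul_of_nonneg_right hle hS0
            linarith
    · have hhE : (h : ℝ) ≤ √(E : ℝ) := by
        refine Real.le_sqrt_of_sq_le ?_
        have h2 : (h : ℤ) * h ≤ E := by
          refine Int.le_of_dvd hE (Dvd.dvd.trans ?_ hfE)
          exact mul_dvd_mul (Int.natCast_dvd_natCast.2 hhf) (Int.natCast_dvd_natCast.2 hhf)
        rw [pow_two]
        exact_mod_cast h2
      have hh2 : T ≤ (h : ℝ) ^ 2 := by nlinarith
      have e1 : (E : ℝ) / (h * P) ≤ E / (T * P) := by gcongr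
      have e2 : E * √(E : ℝ) / (h ^ 2 * P ^ 2) ≤ E * √(E : ℝ) / (T * P ^ 2) := by gcongr
      calc _ ≤ _ := k2
        _ = (t : ℝ) ^ 8 * (160000000 * N.det.natAbs ^ 6 * m) *
            (h + E / (h * P) + E * √(E : ℝ) / (h ^ 2 * P ^ 2)) := by
          field_simp
          ring
        _ ≤ _ := by
          gcongr
          nlinarith [mul_nonneg hT.le hS0]

/-- A uniform divisor bound in the range needed for a binary form of discriminant `E / 4`. -/
theorem exists_divisor_bound {ε : ℝ} (hε : 0 < ε) :
    ∃ R : ℝ, 0 < R ∧ ∀ (E : ℤ) (D : ℝ), 0 < E → (E : ℝ) = 4 * D → ∃ t : ℕ,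
      (∀ n : ℕ, 0 < n → (n : ℤ) ≤ 384 * E ^ 5 → n.divisors.card ≤ t) ∧
      (t : ℝ) ^ 6 ≤ R * D ^ ε ∧ (t : ℝ) ^ 9 ≤ R * D ^ ε := by
  obtain ⟨K, hK, hdiv⟩ := card_divisors_le_rpow (ε / 45) (by positivity)
  refine ⟨(K * 384 ^ (ε / 45)) ^ 9 * 4 ^ ε, by positivity, fun E D hE hED => ?_⟩
  have hER : (0 : ℝ) < E := by exact_mod_cast hE
  have hD : 0 < D := by linarith
  have ht : ∀ n : ℕ, 0 < n → (n : ℤ) ≤ 384 * E ^ 5 →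
      n.divisors.card ≤ ⌊K * (384 * (E : ℝ) ^ 5) ^ (ε / 45)⌋₊ := by
    intro n hn hnE
    refine Nat.le_floor ((hdiv n hn).trans ?_)
    have : (n : ℝ) ≤ 384 * (E : ℝ) ^ 5 := by exact_mod_cast hnE
    gcongr
  have h9 : (⌊K * (384 * (E : ℝ) ^ 5) ^ (ε / 45)⌋₊ : ℝ) ^ 9 ≤
      (K * 384 ^ (ε / 45)) ^ 9 * 4 ^ ε * D ^ ε := by
    calc _ ≤ (K * (384 * (E : ℝ) ^ 5) ^ (ε / 45)) ^ 9 := by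
          gcongr
          exact Nat.floor_le (by positivity)
      _ = (K * 384 ^ (ε / 45)) ^ 9 * (E : ℝ) ^ ε := by
          rw [Real.mul_rpow (by norm_num) (by positivity), ← mul_assoc, mul_pow]
          congr 1
          rw [← Real.rpow_natCast, ← Real.rpow_natCast, ← Real.rpow_mul hER.le,
            ← Real.rpow_mul hER.le]
          congr 1
          push_cast
          ring
      _ = _ := by rw [hED, Real.mul_rpow (by norm_num) hD.le, mul_assoc]
  refine ⟨_, ht, le_trans ?_ h9, h9⟩
  have h1 := ht 1 one_pos (by have : 0 < E ^ 5 := pow_pos hE 5; push_cast; omega)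
  exact pow_le_pow_right₀ (by exact_mod_cast h1) (by norm_num)

theorem level_sum_le {D S P δ ε : ℝ} (hD : 0 < D) (hP : 0 < P) (hPD : P ≤ √D) (hS : 0 ≤ S) :
    D ^ ε * (D ^ δ * S + √(4 * D) + 4 * D / (D ^ δ * P) + 4 * D * √(4 * D) / (D ^ δ * P ^ 2)) ≤
      12 * (D ^ (δ + ε) * S + D ^ ((3 : ℝ) / 2 - δ + ε) / P ^ 2 + D ^ ((1 : ℝ) / 2 + ε)) := by
  have hs : √(4 * D) = 2 * √D := by
    rw [Real.sqrt_mul (by norm_num), show (4 : ℝ) = 2 ^ 2 by norm_num,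
      Real.sqrt_sq (by norm_num)]
  have hδ : 0 < D ^ δ := Real.rpow_pos_of_pos hD _
  have hε : 0 < D ^ ε := Real.rpow_pos_of_pos hD _
  have hsD : 0 < √D := Real.sqrt_pos.2 hD
  have e1 : D ^ (δ + ε) = D ^ ε * D ^ δ := by rw [Real.rpow_add hD, mul_comm]
  have e2 : D ^ ((1 : ℝ) / 2 + ε) = D ^ ε * √D := by
    rw [Real.rpow_add hD, mul_comm, Real.sqrt_eq_rpow]
  have e3 : D ^ ((3 : ℝ) / 2 - δ + ε) = D ^ ε * (D * √D / D ^ δ) := by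
    rw [Real.rpow_add hD, Real.rpow_sub hD, mul_comm, Real.sqrt_eq_rpow,
      show (3 : ℝ) / 2 = 1 + 1 / 2 by norm_num, Real.rpow_add hD, Real.rpow_one]
  have h1 : 4 * D / (D ^ δ * P) ≤ 4 * (D * √D / D ^ δ / P ^ 2) := by
    rw [show 4 * D / (D ^ δ * P) = 4 * (D * P / D ^ δ / P ^ 2) by field_simp]
    gcongr
  have h2 : 4 * D * (2 * √D) / (D ^ δ * P ^ 2) = 8 * (D * √D / D ^ δ / P ^ 2) := by
    field_simp
    ring
  have h3 : 0 ≤ D ^ δ * S := by positivity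
  rw [hs, h2, e1, e2, e3]
  calc _ ≤ D ^ ε * (12 * (D ^ δ * S + D * √D / D ^ δ / P ^ 2 + √D)) := by
        gcongr
        linarith
    _ = _ := by ring

/-- Fix a positive definite integral quaternary form `Q` and an odd prime
`p`.  For every `ε > 0` there is a constant `κ = κ(Q, p, ε)` such that for every primitive
Minkowski-reduced positive definite integral binary form `q = ⟨A,B,C⟩` of discriminant
`D = A·C − B²/4` with `v_p(D) = 0`:
(i) for every `n` with `p^(4n) < √D` and every `δ ∈ (0, 1/4)`,
`#𝒳(Q,2n) ≤ κ·(D^(δ+ε)·#𝒮(n) + D^(3/2−δ+ε)·p^(−8n) + D^(7/8+ε)·p^(−5n) + D^(1/2+ε))`;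
(ii) if moreover `−4D` is a fundamental discriminant, then for every `n`,
`#𝒳(Q,2n) ≤ κ·D^ε·#𝒮(n)`. -/
theorem XSet_card_le_SSet_card
    (MQ : Matrix (Fin 4) (Fin 4) ℚ) (hQ : IsIntegralPosDefForm MQ)
    (p : ℕ) [hp : Fact p.Prime] (hp2 : p ≠ 2) (ε : ℝ) (hε : 0 < ε) :
    ∃ κ : ℝ, ∀ A B C : ℤ, 0 < A → |B| ≤ A → A ≤ C →
      0 < (A : ℚ) * C - (B : ℚ) ^ 2 / 4 →
      Int.gcd (Int.gcd A B) C = 1 →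
      padicValRat p ((A : ℚ) * C - (B : ℚ) ^ 2 / 4) = 0 →
      (∀ n : ℕ, (p : ℝ) ^ (4 * n) <
          Real.sqrt (((A : ℚ) * C - (B : ℚ) ^ 2 / 4 : ℚ) : ℝ) →
        ∀ δ : ℝ, 0 < δ → δ < 1 / 4 →
          ((XSet MQ A B C p (2 * n)).ncard : ℝ) ≤
            κ * ((((A : ℚ) * C - (B : ℚ) ^ 2 / 4 : ℚ) : ℝ) ^ (δ + ε) *
                  ((SSetQ MQ A B C p n).ncard : ℝ) +
                (((A : ℚ) * C - (B : ℚ) ^ 2 / 4 : ℚ) : ℝ) ^ ((3 : ℝ) / 2 - δ + ε) /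
                  (p : ℝ) ^ (8 * n) +
                (((A : ℚ) * C - (B : ℚ) ^ 2 / 4 : ℚ) : ℝ) ^ ((7 : ℝ) / 8 + ε) /
                  (p : ℝ) ^ (5 * n) +
                (((A : ℚ) * C - (B : ℚ) ^ 2 / 4 : ℚ) : ℝ) ^ ((1 : ℝ) / 2 + ε))) ∧
      (FundDisc A B C → ∀ n : ℕ,
        ((XSet MQ A B C p (2 * n)).ncard : ℝ) ≤
          κ * (((A : ℚ) * C - (B : ℚ) ^ 2 / 4 : ℚ) : ℝ) ^ ε *
            ((SSetQ MQ A B C p n).ncard : ℝ)) := by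
  obtain ⟨N, hMN, hN, heven⟩ := hQ.exists_isPD
  obtain ⟨m, hm⟩ := finite_orthogonal_bound hN
  obtain ⟨R, hR, hdiv⟩ := exists_divisor_bound hε
  have hpR : (0 : ℝ) < p := by exact_mod_cast hp.out.pos
  have hΔ1 : (1 : ℝ) ≤ N.det.natAbs := by
    exact_mod_cast Int.natAbs_pos.2 hN.det_pos.ne'
  refine ⟨160000000 * N.det.natAbs ^ 6 * m * R * 12, fun A B C hA hBA hAC hD hprim hv => ?_⟩
  have hDE : (((4 * A * C - B ^ 2 : ℤ) : ℚ)) = 4 * ((A : ℚ) * C - (B : ℚ) ^ 2 / 4) := by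
    push_cast; ring
  have hE : 0 < 4 * A * C - B ^ 2 := by
    have : (0 : ℚ) < ((4 * A * C - B ^ 2 : ℤ) : ℚ) := by rw [hDE]; linarith
    exact_mod_cast this
  have hpE : ¬ (p : ℤ) ∣ 4 * A * C - B ^ 2 := by
    intro hd
    have h4 : padicValRat p (4 : ℚ) = 0 := by
      have h : ¬ p ∣ 4 := fun h => hp2 ((Nat.prime_dvd_prime_iff_eq hp.out Nat.prime_two).1
        (hp.out.dvd_of_dvd_pow (show p ∣ 2 ^ 2 by norm_num; exact h)))
      have := padicValRat.of_nat (p := p) (n := 4)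
      rw [padicValNat.eq_zero_of_not_dvd h] at this
      exact_mod_cast this
    have h0 : padicValRat p (((4 * A * C - B ^ 2 : ℤ) : ℚ)) = 0 := by
      rw [hDE, padicValRat.mul (by norm_num) hD.ne', h4, hv, add_zero]
    rw [padicValRat.of_int] at h0
    have := (padicValInt_dvd_iff (p := p) 1 (4 * A * C - B ^ 2)).1 (by simpa using hd)
    omega
  have hDER : ((4 * A * C - B ^ 2 : ℤ) : ℝ) =
      4 * (((A : ℚ) * C - (B : ℚ) ^ 2 / 4 : ℚ) : ℝ) := by
    exact_mod_cast congrArg (Rat.cast : ℚ → ℝ) hDE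
  have hDR : (0 : ℝ) < (((A : ℚ) * C - (B : ℚ) ^ 2 / 4 : ℚ) : ℝ) := by exact_mod_cast hD
  generalize (((A : ℚ) * C - (B : ℚ) ^ 2 / 4 : ℚ) : ℝ) = D at hDER hDR ⊢
  obtain ⟨t, ht, ht6, ht9⟩ := hdiv _ D hE hDER
  have hcard := fun n => card_XSet_le hMN hN heven m hm hA hBA hAC hE hprim n hp2 hpE t ht
  have hDε := Real.rpow_pos_of_pos hDR ε
  constructor
  · intro n hn δ _ _
    have h := (hcard n).2 (D ^ δ) (Real.rpow_pos_of_pos hDR δ)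
    rw [hDER] at h
    set S : ℝ := ((SSetQ MQ A B C p n).ncard : ℝ)
    have hS : 0 ≤ S := by positivity
    set P : ℝ := (p : ℝ) ^ (4 * n) with hP
    have hP8 : (p : ℝ) ^ (8 * n) = P ^ 2 := by rw [hP, ← pow_mul]; congr 1; ring
    rw [hP8] at h ⊢
    have hP0 : 0 < P := by positivity
    calc _ ≤ _ := h
      _ ≤ 160000000 * N.det.natAbs ^ 6 * m * (R * D ^ ε) * (D ^ δ * S + √(4 * D) +
          4 * D / (D ^ δ * P) + 4 * D * √(4 * D) / (D ^ δ * P ^ 2)) := by gcongr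
      _ = 160000000 * N.det.natAbs ^ 6 * m * R * (D ^ ε * (D ^ δ * S + √(4 * D) +
          4 * D / (D ^ δ * P) + 4 * D * √(4 * D) / (D ^ δ * P ^ 2))) := by ring
      _ ≤ 160000000 * N.det.natAbs ^ 6 * m * R * (12 * (D ^ (δ + ε) * S +
          D ^ ((3 : ℝ) / 2 - δ + ε) / P ^ 2 + D ^ ((1 : ℝ) / 2 + ε))) :=
        mul_le_mul_of_nonneg_left (level_sum_le hDR hP0 hn.le hS) (by positivity)
      _ ≤ _ := by
        rw [← mul_assoc (_ * R)]
        refine mul_le_mul_of_nonneg_left ?_ (by positivity)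
        have : 0 ≤ D ^ ((7 : ℝ) / 8 + ε) / (p : ℝ) ^ (5 * n) := by positivity
        linarith
  · intro hF n
    calc _ ≤ _ := (hcard n).1 hF
      _ = 32 * N.det.natAbs ^ 5 * m * (t : ℝ) ^ 6 * (SSetQ MQ A B C p n).ncard := rfl
      _ ≤ 160000000 * N.det.natAbs ^ 6 * m * (R * D ^ ε) * (SSetQ MQ A B C p n).ncard := by
        gcongr
        · norm_num
        · norm_num
      _ ≤ 160000000 * N.det.natAbs ^ 6 * m * (R * D ^ ε) * (SSetQ MQ A B C p n).ncard * 12 :=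
        le_mul_of_one_le_right (by positivity) (by norm_num)
      _ = _ := by ring

end
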